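/- arXiv:1903.01805 — 2 statements merged into one kernel-verified Lean document; each statement's English description precedes it below -/
import Mathlib

section
/- For every integer k ≥ 0, the class of B_k-CPG graphs is strictly contained in the class of B_{k+1}-CPG graphs: every B_k-CPG graph is B_{k+1}-CPG, and there exists a graph that is B_{k+1}-CPG but not B_k-CPG. -/
/-! ## Grid paths and CPG representations -/

/-- Two grid points of `ℤ × ℤ` at L¹-distance 1 (i.e. joined by a unit grid segment). -/
def GridStep (p q : ℤ × ℤ) : Prop :=
  (p.1 - q.1).natAbs + (p.2 - q.2).natAbs = 1

/-- A grid path: a sequence of at least two grid points, consecutive points at distance 1,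
with no repeated grid point (so the traced curve neither crosses nor retraces itself). -/
structure GridPath where
  pts : List (ℤ × ℤ)
  two_le_length : 2 ≤ pts.length
  step : pts.Chain' GridStep
  nodup : pts.Nodup

namespace GridPath

theorem ne_nil (P : GridPath) : P.pts ≠ [] := by
  intro h
  have h2 := P.two_le_length
  rw [h] at h2
  simp at h2

/-- The set of grid points of a grid path. -/
def toSet (P : GridPath) : Set (ℤ × ℤ) := {p | p ∈ P.pts}

/-- The first extreme point of a grid path. -/
def first (P : GridPath) : ℤ × ℤ := P.pts.head P.ne_nil

/-- The second extreme point of a grid path. -/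
def last (P : GridPath) : ℤ × ℤ := P.pts.getLast P.ne_nil

/-- `p` is an endpoint (extreme point) of the grid path `P`. -/
def IsEndpoint (P : GridPath) (p : ℤ × ℤ) : Prop := p = P.first ∨ p = P.last

/-- `p` is an interior grid point of `P`: it lies on `P` but is not an endpoint. -/
def IsInterior (P : GridPath) (p : ℤ × ℤ) : Prop := p ∈ P.toSet ∧ ¬ P.IsEndpoint p

/-- `p` is a bend of `P`: an interior grid point at which `P` turns 90 degrees. -/
def IsBend (P : GridPath) (p : ℤ × ℤ) : Prop :=
  ∃ a c : ℤ × ℤ, [a, p, c] <:+: P.pts ∧ a.1 ≠ c.1 ∧ a.2 ≠ c.2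

/-- The set of bend points of `P`. -/
def bendSet (P : GridPath) : Set (ℤ × ℤ) := {p | P.IsBend p}

/-- `P` has at most `k` bends. -/
def BendsAtMost (P : GridPath) (k : ℕ) : Prop := P.bendSet.ncard ≤ k

end GridPath

/-- `p` and `q` are consecutive grid points of the list `l` (in either order);
equivalently, the path traced by `l` uses the unit grid segment joining `p` and `q`. -/
def ConsecIn (l : List (ℤ × ℤ)) (p q : ℤ × ℤ) : Prop :=
  [p, q] <:+: l ∨ [q, p] <:+: l

/-- A CPG representation of a simple graph `G`: a family of pairwise interiorly disjoint
grid paths, one for each vertex, such that two distinct vertices are adjacent iff the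
corresponding paths have a common point. -/
structure CPGRep {V : Type*} (G : SimpleGraph V) where
  path : V → GridPath
  interiorly_disjoint : ∀ u v : V, u ≠ v → ∀ p : ℤ × ℤ,
    p ∈ (path u).toSet → p ∈ (path v).toSet →
    (path u).IsEndpoint p ∨ (path v).IsEndpoint p
  no_shared_segment : ∀ u v : V, u ≠ v → ∀ p q : ℤ × ℤ,
    ConsecIn (path u).pts p q → ¬ ConsecIn (path v).pts p q
  adj_iff : ∀ u v : V, u ≠ v →
    (G.Adj u v ↔ ∃ p : ℤ × ℤ, p ∈ (path u).toSet ∧ p ∈ (path v).toSet)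

namespace CPGRep

variable {V : Type*} {G : SimpleGraph V}

/-- A `k`-bend CPG representation: every path has at most `k` bends. -/
def BendsAtMost (R : CPGRep G) (k : ℕ) : Prop :=
  ∀ u : V, (R.path u).BendsAtMost k

/-- `p` is a free endpoint of the path of `u`: an endpoint of `R.path u`
belonging to no other path of the representation. -/
def FreeEndpoint (R : CPGRep G) (u : V) (p : ℤ × ℤ) : Prop :=
  (R.path u).IsEndpoint p ∧ ∀ v : V, v ≠ u → p ∉ (R.path v).toSet

end CPGRep

/-- A graph is CPG if it admits a CPG representation. -/
def IsCPG {V : Type*} (G : SimpleGraph V) : Prop := Nonempty (CPGRep G)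

/-- A graph is `B_k`-CPG if it admits a CPG representation in which every path
has at most `k` bends. -/
def IsBkCPG {V : Type*} (G : SimpleGraph V) (k : ℕ) : Prop :=
  ∃ R : CPGRep G, R.BendsAtMost k


/-! ## A discrete planarity lemma -/

/-- Connectedness through grid points of a set. -/
def GConn (S : Set (ℤ × ℤ)) : ℤ × ℤ → ℤ × ℤ → Prop :=
  Relation.ReflTransGen (fun a b => GridStep a b ∧ a ∈ S ∧ b ∈ S)

theorem GridStep.symm {p q : ℤ × ℤ} (h : GridStep p q) : GridStep q p := by
  unfold GridStep at *; omega

theorem GConn.symm {S : Set (ℤ × ℤ)} {a b : ℤ × ℤ} (h : GConn S a b) : GConn S b a := by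
  unfold GConn at *
  induction h with
  | refl => exact .refl
  | tail _ h2 ih => exact .head ⟨h2.1.symm, h2.2.2, h2.2.1⟩ ih

theorem GConn.trans {S : Set (ℤ × ℤ)} {a b c : ℤ × ℤ} (h : GConn S a b) (h' : GConn S b c) :
    GConn S a c := Relation.ReflTransGen.trans h h'

theorem GConn.mono {S T : Set (ℤ × ℤ)} (hST : S ⊆ T) {a b : ℤ × ℤ} (h : GConn S a b) :
    GConn T a b :=
  Relation.ReflTransGen.mono (p := fun a b => GridStep a b ∧ a ∈ T ∧ b ∈ T)
    (fun _ _ h => ⟨h.1, hST h.2.1, hST h.2.2⟩) _ _ h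

theorem exists_potential {B : Set (ℤ × ℤ)} {x y : ℤ × ℤ} (h : GConn B x y) :
    ∃ φ : ℤ → ℤ → ZMod 2, ∀ a b : ℤ, (a, b) ∉ B → φ (a + 1) b = φ a b ∧
      φ a (b + 1) = φ a b + (if y.2 = b ∧ a ≤ y.1 then 1 else 0)
        + (if x.2 = b ∧ a ≤ x.1 then 1 else 0) := by
  unfold GConn at h
  induction h with
  | refl =>
    refine ⟨fun _ _ => 0, fun a b _ => ⟨rfl, ?_⟩⟩
    show (0 : ZMod 2) = 0 + _ + _
    split_ifs <;> decide
  | @tail y z _ hs ih =>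
    obtain ⟨φ, hφ⟩ := ih
    obtain ⟨hst, hy, hz⟩ := hs
    refine ⟨fun a b => φ a b + (if y.1 = z.1 ∧ a ≤ y.1 ∧ max y.2 z.2 = b then 1 else 0), ?_⟩
    intro a b hab
    obtain ⟨h1, h2⟩ := hφ a b hab
    have hya : ¬ (y.1 = a ∧ y.2 = b) := fun h => hab (by rw [← h.1, ← h.2]; exact hy)
    have hza : ¬ (z.1 = a ∧ z.2 = b) := fun h => hab (by rw [← h.1, ← h.2]; exact hz)
    unfold GridStep at hst
    have two : (1 : ZMod 2) + 1 = 0 := by decide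
    simp only [h1, h2]
    generalize φ a b = f
    generalize (if x.2 = b ∧ a ≤ x.1 then (1 : ZMod 2) else 0) = g
    constructor
    · congr 1
      split_ifs <;> first | rfl | omega
    · split_ifs <;> first | omega | (clear * -; revert f g; decide)

theorem planar_cross {A B : Set (ℤ × ℤ)} (hAB : ∀ p, p ∈ A → p ∉ B) (a b : ℤ)
    (hpA : (a, b) ∉ A) (hpB : (a, b) ∉ B) (hA1 : (a, b - 1) ∈ A)
    (hBr : (a + 1, b) ∈ B)
    (hA : GConn A (a, b + 1) (a, b - 1)) (hB : GConn B (a + 1, b) (a - 1, b)) : False := by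
  obtain ⟨φ, hφ⟩ := exists_potential hB
  have tt : ∀ f g : ZMod 2, f + g + g = f := by decide
  have key : ∀ y, GConn A (a, b + 1) y → φ y.1 y.2 = φ a (b + 1) := by
    intro y hy
    unfold GConn at hy
    induction hy with
    | refl => rfl
    | @tail y z _ hs ih =>
      rw [← ih]
      obtain ⟨hst, hy, hz⟩ := hs
      obtain ⟨y1, y2⟩ := y
      obtain ⟨z1, z2⟩ := z
      have hyB := hφ _ _ (hAB _ hy)
      have hzB := hφ _ _ (hAB _ hz)
      have n1 : ¬ (y1 = a ∧ y2 = b) := fun h => hpA (by rw [← h.1, ← h.2]; exact hy)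
      have n2 : ¬ (z1 = a ∧ z2 = b) := fun h => hpA (by rw [← h.1, ← h.2]; exact hz)
      have n3 : ¬ (y1 = a + 1 ∧ y2 = b) := fun h => hAB _ hy (by rw [h.1, h.2]; exact hBr)
      have n4 : ¬ (z1 = a + 1 ∧ z2 = b) := fun h => hAB _ hz (by rw [h.1, h.2]; exact hBr)
      unfold GridStep at hst
      simp only at hst hyB hzB ⊢
      have hc : (z1 = y1 + 1 ∧ z2 = y2) ∨ (y1 = z1 + 1 ∧ z2 = y2) ∨ (z1 = y1 ∧ z2 = y2 + 1) ∨
          (z1 = y1 ∧ y2 = z2 + 1) := by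
        clear * - hst
        omega
      clear hst
      rcases hc with ⟨h1, h2⟩ | ⟨h1, h2⟩ | ⟨h1, h2⟩ | ⟨h1, h2⟩
      · rw [h1, h2, hyB.1]
      · rw [← h2, h1, hzB.1]
      · rw [h1, h2, hyB.2, if_congr (show (b = y2 ∧ y1 ≤ a - 1) ↔ (b = y2 ∧ y1 ≤ a + 1) by
          omega) rfl rfl, tt]
      · rw [h2, ← h1, hzB.2, if_congr (show (b = z2 ∧ z1 ≤ a - 1) ↔ (b = z2 ∧ z1 ≤ a + 1) by
          omega) rfl rfl, tt]
  have h1 := key _ hA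
  have h2 := (hφ _ _ hpB).2
  have h3 := (hφ _ _ (hAB _ hA1)).2
  simp only [sub_add_cancel] at h1 h2 h3
  rw [if_neg (show ¬ (True ∧ a ≤ a - 1) by omega),
    if_pos (show (True ∧ a ≤ a + 1) from ⟨trivial, by omega⟩)] at h2
  rw [if_neg (show ¬ (b = b - 1 ∧ a ≤ a - 1) by omega),
    if_neg (show ¬ (b = b - 1 ∧ a ≤ a + 1) by omega)] at h3
  rw [h2, h3] at h1
  revert h1
  generalize φ a (b - 1) = f
  revert f; decide

/-! ## Counting contacts -/

theorem GridPath.endpoint_or_split (P : GridPath) {p : ℤ × ℤ} (hp : p ∈ P.toSet) :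
    P.IsEndpoint p ∨ ∃ l₁ a c l₂, P.pts = l₁ ++ a :: p :: c :: l₂ := by
  obtain ⟨s, t, hst⟩ := List.append_of_mem (show p ∈ P.pts from hp)
  rcases List.eq_nil_or_concat s with rfl | ⟨s', a, rfl⟩
  · left; left
    unfold GridPath.first
    simp [hst]
  · cases t with
    | nil =>
      left; right
      unfold GridPath.last
      simp [hst]
    | cons c t' =>
      right
      exact ⟨s', a, c, t', by simp [hst]⟩

theorem GridPath.split_interior (P : GridPath) {p : ℤ × ℤ} (hp : P.IsInterior p) :
    ∃ l₁ a c l₂, P.pts = l₁ ++ a :: p :: c :: l₂ := by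
  rcases P.endpoint_or_split hp.1 with h | h
  · exact absurd h hp.2
  · exact h

theorem GridPath.chain (P : GridPath) : List.IsChain GridStep P.pts := P.step

theorem GridPath.first_mem (P : GridPath) : P.first ∈ P.toSet := List.head_mem _
theorem GridPath.last_mem (P : GridPath) : P.last ∈ P.toSet := List.getLast_mem _

theorem GridPath.IsEndpoint.mem {P : GridPath} {p : ℤ × ℤ} (h : P.IsEndpoint p) :
    p ∈ P.toSet := by
  rcases h with rfl | rfl
  · exact P.first_mem
  · exact P.last_mem

theorem GridPath.consec_step (P : GridPath) {p q : ℤ × ℤ} (h : ConsecIn P.pts p q) :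
    GridStep p q := by
  rcases h with h | h
  · have := P.chain.infix h
    simpa using this
  · have := P.chain.infix h
    exact GridStep.symm (by simpa using this)

theorem ConsecIn.mem_right {l : List (ℤ × ℤ)} {p q : ℤ × ℤ} (h : ConsecIn l p q) : q ∈ l := by
  rcases h with h | h
  · exact h.subset (by simp)
  · exact h.subset (by simp)

theorem ConsecIn.mem_left {l : List (ℤ × ℤ)} {p q : ℤ × ℤ} (h : ConsecIn l p q) : p ∈ l := by
  rcases h with h | h
  · exact h.subset (by simp)
  · exact h.subset (by simp)

theorem consec_left (l₁ l₂ : List (ℤ × ℤ)) (a p : ℤ × ℤ) :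
    ConsecIn (l₁ ++ a :: p :: l₂) p a :=
  Or.inr ⟨l₁, l₂, by simp⟩

theorem consec_right (l₁ l₂ : List (ℤ × ℤ)) (a p : ℤ × ℤ) :
    ConsecIn (l₁ ++ a :: p :: l₂) a p :=
  Or.inl ⟨l₁, l₂, by simp⟩

theorem GridPath.exists_consec (P : GridPath) {p : ℤ × ℤ} (hp : p ∈ P.toSet) :
    ∃ q, ConsecIn P.pts p q := by
  obtain ⟨s, t, hst⟩ := List.append_of_mem (show p ∈ P.pts from hp)
  rcases List.eq_nil_or_concat s with rfl | ⟨s', a, rfl⟩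
  · cases t with
    | nil => have := P.two_le_length; simp [hst] at this
    | cons c t' => exact ⟨c, by rw [hst]; exact consec_right [] t' p c⟩
  · exact ⟨a, by rw [hst]; simpa using consec_left s' t a p⟩

theorem GridPath.exists_two_consec (P : GridPath) {p : ℤ × ℤ} (hp : P.IsInterior p) :
    ∃ q r, q ≠ r ∧ ConsecIn P.pts p q ∧ ConsecIn P.pts p r := by
  obtain ⟨l₁, a, c, l₂, h⟩ := P.split_interior hp
  refine ⟨a, c, ?_, ?_, ?_⟩
  · rintro rfl
    have := P.nodup
    rw [h] at this
    simp [List.nodup_append] at this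
  · rw [h]; exact consec_left _ _ _ _
  · rw [h]; simpa using consec_right (l₁ ++ [a]) l₂ p c

/-- The four grid neighbours. -/
def nbrs (p : ℤ × ℤ) : Finset (ℤ × ℤ) :=
  {(p.1 + 1, p.2), (p.1 - 1, p.2), (p.1, p.2 + 1), (p.1, p.2 - 1)}

theorem mem_nbrs {p q : ℤ × ℤ} (h : GridStep p q) : q ∈ nbrs p := by
  obtain ⟨a, b⟩ := p
  obtain ⟨c, d⟩ := q
  unfold GridStep at h
  simp only [nbrs, Finset.mem_insert, Finset.mem_singleton, Prod.mk.injEq]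
  simp only at h
  omega

theorem nbrs_card (p : ℤ × ℤ) : (nbrs p).card ≤ 4 := Finset.card_le_four

/-- The two endpoints of a path. -/
def GridPath.ep (P : GridPath) (b : Bool) : ℤ × ℤ := if b then P.first else P.last

section counting
open Classical

theorem local_count {ι : Type*} [Fintype ι] (Q : ι → GridPath)
    (hid : ∀ u v, u ≠ v → ∀ p, p ∈ (Q u).toSet → p ∈ (Q v).toSet →
      (Q u).IsEndpoint p ∨ (Q v).IsEndpoint p)
    (hseg : ∀ u v, u ≠ v → ∀ p q, ConsecIn (Q u).pts p q → ¬ ConsecIn (Q v).pts p q)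
    (p : ℤ × ℤ) :
    (Finset.univ.filter (fun u => p ∈ (Q u).toSet)).offDiag.card ≤
      3 * (Finset.univ.filter (fun t : ι × Bool => (Q t.1).ep t.2 = p)).card := by
  set S := Finset.univ.filter (fun u => p ∈ (Q u).toSet) with hS
  set I := S.filter (fun u => ¬ (Q u).IsEndpoint p) with hI
  set E := S.filter (fun u => (Q u).IsEndpoint p) with hE
  have hmemS : ∀ u, u ∈ S ↔ p ∈ (Q u).toSet := by simp [hS]
  have hcard : E.card + I.card = S.card := Finset.card_filter_add_card_filter_not _
  have hI1 : I.card ≤ 1 := by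
    rw [Finset.card_le_one]
    intro a ha b hb
    by_contra hab
    rw [hI, Finset.mem_filter, hmemS] at ha hb
    rcases hid a b hab p ha.1 hb.1 with h | h
    · exact ha.2 h
    · exact hb.2 h
  have htok : E.card ≤ (Finset.univ.filter (fun t : ι × Bool => (Q t.1).ep t.2 = p)).card := by
    have : E ⊆ (Finset.univ.filter (fun t : ι × Bool => (Q t.1).ep t.2 = p)).image Prod.fst := by
      intro u hu
      rw [hE, Finset.mem_filter] at hu
      rw [Finset.mem_image]
      rcases hu.2 with h | h
      · exact ⟨(u, true), by simp [GridPath.ep, h], rfl⟩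
      · exact ⟨(u, false), by simp [GridPath.ep, h], rfl⟩
    exact (Finset.card_le_card this).trans Finset.card_image_le
  let arms : ι → Finset (ℤ × ℤ) := fun u => (nbrs p).filter (fun q => ConsecIn (Q u).pts p q)
  have harm : ∀ u q, ConsecIn (Q u).pts p q → q ∈ arms u := fun u q h =>
    Finset.mem_filter.2 ⟨mem_nbrs ((Q u).consec_step h), h⟩
  have hdisj : (S : Set ι).PairwiseDisjoint arms := by
    intro a _ b _ hab
    rw [Function.onFun, Finset.disjoint_left]
    intro q ha hb
    exact hseg a b hab p q (Finset.mem_filter.1 ha).2 (Finset.mem_filter.1 hb).2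
  have h4 : ∑ u ∈ S, (arms u).card ≤ 4 := by
    rw [← Finset.card_biUnion (fun a ha b hb hab => hdisj ha hb hab)]
    refine le_trans (Finset.card_le_card ?_) (nbrs_card p)
    intro q hq
    obtain ⟨u, _, hq⟩ := Finset.mem_biUnion.1 hq
    exact (Finset.mem_filter.1 hq).1
  have hlow : S.card + I.card ≤ ∑ u ∈ S, (arms u).card := by
    have e1 : I.card = ∑ u ∈ S, if ¬ (Q u).IsEndpoint p then 1 else 0 := Finset.card_filter _ _
    rw [e1, Finset.card_eq_sum_ones S, ← Finset.sum_add_distrib]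
    refine Finset.sum_le_sum fun u hu => ?_
    rw [hmemS] at hu
    split_ifs with h
    · obtain ⟨q, h1⟩ := (Q u).exists_consec hu
      exact Finset.card_pos.2 ⟨q, harm _ _ h1⟩
    · obtain ⟨q, r, hqr, h1, h2⟩ := (Q u).exists_two_consec ⟨hu, h⟩
      exact Finset.one_lt_card.2 ⟨q, harm _ _ h1, r, harm _ _ h2, hqr⟩
  have hle : S.card + I.card ≤ 4 := hlow.trans h4
  rw [Finset.offDiag_card]
  refine le_trans ?_ (Nat.mul_le_mul_left 3 htok)
  have : S.card ≤ 4 := by omega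
  generalize S.card = s at *
  interval_cases s <;> omega

theorem global_count {ι : Type*} [Fintype ι] (Q : ι → GridPath)
    (hid : ∀ u v, u ≠ v → ∀ p, p ∈ (Q u).toSet → p ∈ (Q v).toSet →
      (Q u).IsEndpoint p ∨ (Q v).IsEndpoint p)
    (hseg : ∀ u v, u ≠ v → ∀ p q, ConsecIn (Q u).pts p q → ¬ ConsecIn (Q v).pts p q)
    (T : Set (ℤ × ℤ)) (Ed : Finset (ι × ι))
    (hEd : ∀ e ∈ Ed, e.1 ≠ e.2 ∧ ∃ p, p ∈ (Q e.1).toSet ∧ p ∈ (Q e.2).toSet ∧ p ∉ T) :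
    Ed.card ≤ 3 * (Finset.univ.filter (fun t : ι × Bool => (Q t.1).ep t.2 ∉ T)).card := by
  have : ∀ e : ι × ι, ∃ p, e ∈ Ed → p ∈ (Q e.1).toSet ∧ p ∈ (Q e.2).toSet ∧ p ∉ T := by
    intro e
    by_cases he : e ∈ Ed
    · obtain ⟨p, hp⟩ := (hEd e he).2
      exact ⟨p, fun _ => hp⟩
    · exact ⟨0, fun h => absurd h he⟩
  choose pt hpt using this
  rw [Finset.card_eq_sum_card_image pt Ed]
  calc ∑ p ∈ Ed.image pt, (Ed.filter (fun e => pt e = p)).card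
      ≤ ∑ p ∈ Ed.image pt,
          3 * (Finset.univ.filter (fun t : ι × Bool => (Q t.1).ep t.2 = p)).card := by
        refine Finset.sum_le_sum fun p _ => le_trans (Finset.card_le_card ?_)
          (local_count Q hid hseg p)
        intro e he
        rw [Finset.mem_filter] at he
        have := hpt e he.1
        rw [he.2] at this
        rw [Finset.mem_offDiag]
        exact ⟨by simp [this.1], by simp [this.2.1], (hEd e he.1).1⟩
    _ = 3 * ((Ed.image pt).biUnion
          (fun p => Finset.univ.filter (fun t : ι × Bool => (Q t.1).ep t.2 = p))).card := by
        rw [← Finset.mul_sum, Finset.card_biUnion]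
        intro p _ q _ hpq
        rw [Function.onFun, Finset.disjoint_left]
        intro t h1 h2
        simp at h1 h2
        exact hpq (h1.symm.trans h2)
    _ ≤ _ := by
        refine Nat.mul_le_mul_left 3 (Finset.card_le_card ?_)
        intro t ht
        obtain ⟨p, hp, ht⟩ := Finset.mem_biUnion.1 ht
        obtain ⟨e, he, rfl⟩ := Finset.mem_image.1 hp
        simp at ht ⊢
        rw [ht]
        exact (hpt e he).2.2

end counting

/-! ## Abstract lower bound -/

/-- Two paths have a common grid point. -/
def Touch (P Q : GridPath) : Prop := ∃ p, p ∈ P.toSet ∧ p ∈ Q.toSet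

theorem Touch.symm {P Q : GridPath} (h : Touch P Q) : Touch Q P := by
  obtain ⟨p, h1, h2⟩ := h
  exact ⟨p, h2, h1⟩

theorem planar_cross' {A B : Set (ℤ × ℤ)} (hAB : ∀ p, p ∈ A → p ∉ B) {p a c x y : ℤ × ℤ}
    (hpA : p ∉ A) (hpB : p ∉ B) (ha : a ∈ B) (hc : c ∈ B) (hx : x ∈ A) (hy : y ∈ A)
    (sa : GridStep p a) (sc : GridStep p c) (sx : GridStep p x) (sy : GridStep p y)
    (hac : a ≠ c) (hxy : x ≠ y) (hst : a.1 = c.1 ∨ a.2 = c.2)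
    (hB : GConn B a c) (hA : GConn A x y) : False := by
  have n1 : x ≠ a := by rintro rfl; exact hAB _ hx ha
  have n2 : x ≠ c := by rintro rfl; exact hAB _ hx hc
  have n3 : y ≠ a := by rintro rfl; exact hAB _ hy ha
  have n4 : y ≠ c := by rintro rfl; exact hAB _ hy hc
  have hBA : ∀ p, p ∈ B → p ∉ A := fun p h h' => hAB p h' h
  obtain ⟨p1, p2⟩ := p
  obtain ⟨a1, a2⟩ := a
  obtain ⟨c1, c2⟩ := c
  obtain ⟨x1, x2⟩ := x
  obtain ⟨y1, y2⟩ := y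
  simp only [ne_eq, Prod.mk.injEq] at hac hxy n1 n2 n3 n4
  unfold GridStep at sa sc sx sy
  simp only at hst sa sc sx sy
  have nb : ∀ u w : ℤ, (p1 - u).natAbs + (p2 - w).natAbs = 1 →
      (u = p1 + 1 ∧ w = p2) ∨ (u = p1 - 1 ∧ w = p2) ∨ (u = p1 ∧ w = p2 + 1) ∨
      (u = p1 ∧ w = p2 - 1) := by
    intro u w h; omega
  rcases nb _ _ sa with ⟨rfl, rfl⟩ | ⟨rfl, rfl⟩ | ⟨rfl, rfl⟩ | ⟨rfl, rfl⟩ <;>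
  rcases nb _ _ sc with ⟨rfl, rfl⟩ | ⟨rfl, rfl⟩ | ⟨rfl, rfl⟩ | ⟨rfl, rfl⟩ <;>
  first
  | (exfalso; clear * - hac hst; omega)
  | (rcases nb _ _ sx with ⟨rfl, rfl⟩ | ⟨rfl, rfl⟩ | ⟨rfl, rfl⟩ | ⟨rfl, rfl⟩ <;>
     rcases nb _ _ sy with ⟨rfl, rfl⟩ | ⟨rfl, rfl⟩ | ⟨rfl, rfl⟩ | ⟨rfl, rfl⟩ <;>
     first
     | (exfalso; clear * - hxy n1 n2 n3 n4; omega)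
     | exact planar_cross hAB _ _ hpA hpB hy ha hA hB
     | exact planar_cross hAB _ _ hpA hpB hx ha hA.symm hB
     | exact planar_cross hAB _ _ hpA hpB hy hc hA hB.symm
     | exact planar_cross hAB _ _ hpA hpB hx hc hA.symm hB.symm
     | exact planar_cross hBA _ _ hpB hpA hc hx hB hA
     | exact planar_cross hBA _ _ hpB hpA ha hx hB.symm hA
     | exact planar_cross hBA _ _ hpB hpA hc hy hB hA.symm
     | exact planar_cross hBA _ _ hpB hpA ha hy hB.symm hA.symm)

theorem list_conn {S : Set (ℤ × ℤ)} : ∀ (l : List (ℤ × ℤ)) (a : ℤ × ℤ),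
    List.IsChain GridStep (a :: l) → (∀ x ∈ a :: l, x ∈ S) → ∀ y ∈ a :: l, GConn S a y := by
  intro l
  induction l with
  | nil =>
    intro a _ _ y hy
    have : y = a := by simpa using hy
    subst this
    exact Relation.ReflTransGen.refl
  | cons b l ih =>
    intro a hch hS y hy
    rw [List.isChain_cons_cons] at hch
    rcases List.mem_cons.1 hy with rfl | hy
    · exact Relation.ReflTransGen.refl
    · exact Relation.ReflTransGen.head ⟨hch.1, hS _ (by simp), hS _ (by simp)⟩
        (ih b hch.2 (fun x hx => hS x (List.mem_cons_of_mem _ hx)) y hy)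

theorem list_conn' {S : Set (ℤ × ℤ)} (l : List (ℤ × ℤ))
    (hl : List.IsChain GridStep l) (hS : ∀ x ∈ l, x ∈ S) :
    ∀ x ∈ l, ∀ y ∈ l, GConn S x y := by
  cases l with
  | nil => intro x hx; simp at hx
  | cons a l =>
    intro x hx y hy
    exact (list_conn l a hl hS x hx).symm.trans (list_conn l a hl hS y hy)

theorem GridPath.conn (P : GridPath) {S : Set (ℤ × ℤ)} (hS : P.toSet ⊆ S) {x y : ℤ × ℤ}
    (hx : x ∈ P.toSet) (hy : y ∈ P.toSet) : GConn S x y :=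
  list_conn' P.pts P.chain (fun _ h => hS h) x hx y hy

theorem GridPath.endpoint_arm (P : GridPath) {p : ℤ × ℤ} (hp : P.IsEndpoint p) :
    ∃ x, ConsecIn P.pts p x ∧ x ≠ p ∧ ∀ y ∈ P.toSet, y ≠ p → GConn (P.toSet \ {p}) x y := by
  have hc := P.chain
  have hne := P.ne_nil
  obtain ⟨l, h2, hcc, hn⟩ := P
  simp only at hc hne
  rcases hp with h | h
  · unfold GridPath.first at h
    unfold GridPath.toSet
    simp only at h ⊢
    match l, h2 with
    | a :: x :: l, _ =>
      simp only [List.head_cons] at h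
      subst h
      refine ⟨x, consec_right [] l p x, ?_, ?_⟩
      · rintro rfl; simp at hn
      · intro y hy hyp
        have hy' : y ∈ x :: l := by
          rcases List.mem_cons.1 hy with h | h
          · exact absurd h hyp
          · exact h
        refine list_conn' (x :: l) (List.isChain_cons_cons.1 hc).2 ?_ x (by simp) y hy'
        intro z hz
        refine ⟨List.mem_cons_of_mem _ hz, ?_⟩
        rintro rfl
        exact (List.nodup_cons.1 hn).1 hz
  · unfold GridPath.last at h
    unfold GridPath.toSet
    simp only at h ⊢
    obtain ⟨l', rfl⟩ : ∃ l', l = l' ++ [p] :=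
      ⟨l.dropLast, by rw [h]; exact (List.dropLast_append_getLast hne).symm⟩
    rcases List.eq_nil_or_concat l' with rfl | ⟨l, x, rfl⟩
    · simp at h2
    · refine ⟨x, ?_, ?_, ?_⟩
      · simpa using consec_left l [] x p
      · rintro rfl; simp [List.nodup_append] at hn
      · intro y hy hyp
        have hy' : y ∈ l.concat x := by
          rcases List.mem_append.1 hy with h | h
          · exact h
          · exact absurd (by simpa using h) hyp
        refine list_conn' (l.concat x) hc.left_of_append ?_ x (by simp) y hy'
        intro z hz
        refine ⟨List.mem_append_left _ hz, ?_⟩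
        rintro rfl
        exact (List.nodup_append.1 hn).2.2 z hz z (by simp) rfl

theorem cluster_conn {m : ℕ} (Q : Fin (m + 1) → GridPath)
    (h : ∀ j, j ≠ 0 → ∃ j' < j, Touch (Q j) (Q j')) {S : Set (ℤ × ℤ)}
    (hS : ∀ j, (Q j).toSet ⊆ S) {j j' : Fin (m + 1)} {x y : ℤ × ℤ}
    (hx : x ∈ (Q j).toSet) (hy : y ∈ (Q j').toSet) : GConn S x y := by
  have key : ∀ n : ℕ, ∀ j : Fin (m + 1), j.val = n → ∀ x ∈ (Q j).toSet,
      GConn S x (Q 0).first := by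
    intro n
    induction n using Nat.strong_induction_on with
    | _ n ih =>
      intro j hj x hx
      by_cases h0 : j = 0
      · subst h0
        exact (Q 0).conn (hS 0) hx (Q 0).first_mem
      · obtain ⟨j', hlt, z, hz, hz'⟩ := h j h0
        exact ((Q j).conn (hS j) hx hz).trans (ih j'.val (by omega) j' rfl z hz')
  exact (key _ j rfl x hx).trans (key _ j' rfl y hy).symm

/-- If the path `v` is straight at the contact point, we get a contradiction. -/
theorem straight_contra (v b b' : GridPath) (C C0 : Set (ℤ × ℤ)) (p : ℤ × ℤ)
    (hv : v.IsInterior p) (hb : b.IsEndpoint p) (hb' : b'.IsEndpoint p)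
    (hnb : ¬ v.IsBend p)
    (s1 : ∀ p q, ConsecIn b.pts p q → ¬ ConsecIn b'.pts p q)
    (hbv : ∀ q, q ∈ b.toSet → q ∈ v.toSet → q = p)
    (hbv' : ∀ q, q ∈ b'.toSet → q ∈ v.toSet → q = p)
    (hC : ∀ x ∈ C, ∀ y ∈ C, GConn C x y)
    (hC0 : ∀ x ∈ C0, ∀ y ∈ C0, GConn C0 x y)
    (hCv : ∀ x ∈ C, x ∉ v.toSet)
    (hCC0 : ∀ x ∈ C, x ∉ C0)
    (hbC0 : ∀ x ∈ b.toSet, x ∉ C0)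
    (hbC0' : ∀ x ∈ b'.toSet, x ∉ C0)
    (hf : v.first ∈ C0) (hl : v.last ∈ C0)
    (hbC : ∃ x ∈ b.toSet, x ∈ C) (hbC' : ∃ x ∈ b'.toSet, x ∈ C) : False := by
  obtain ⟨x, hx, hxp, hxc⟩ := b.endpoint_arm hb
  obtain ⟨y, hy, hyp, hyc⟩ := b'.endpoint_arm hb'
  obtain ⟨l₁, a, c, l₂, hpts⟩ := v.split_interior hv
  have hpv : p ∈ v.toSet := hv.1
  have hpC : p ∉ C := fun h => hCv _ h hpv
  obtain ⟨z, hzb, hzC⟩ := hbC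
  obtain ⟨z', hzb', hzC'⟩ := hbC'
  have hzp : z ≠ p := by rintro rfl; exact hpC hzC
  have hzp' : z' ≠ p := by rintro rfl; exact hpC hzC'
  have hpC0 : p ∉ C0 := hbC0 _ hb.mem
  have hn := v.nodup
  have hch := v.chain
  have hav : a ∈ v.toSet := by show a ∈ v.pts; rw [hpts]; simp
  have hcv : c ∈ v.toSet := by show c ∈ v.pts; rw [hpts]; simp
  have hap : a ≠ p := by
    rintro rfl; rw [hpts] at hn; simp [List.nodup_append] at hn
  have hcp : c ≠ p := by
    rintro rfl; rw [hpts] at hn; simp [List.nodup_append] at hn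
  have hac : a ≠ c := by
    rintro rfl; rw [hpts] at hn; simp [List.nodup_append] at hn
  have hfirst : GConn (v.toSet \ {p}) a v.first := by
    have hsub : ∀ z ∈ l₁ ++ [a], z ∈ v.toSet \ {p} := by
      intro z hz
      refine ⟨?_, ?_⟩
      · show z ∈ v.pts; rw [hpts]
        rcases List.mem_append.1 hz with h | h <;> simp_all
      · rintro rfl
        rw [hpts, show l₁ ++ a :: z :: c :: l₂ = (l₁ ++ [a]) ++ z :: c :: l₂ by simp,
          List.nodup_append] at hn
        exact hn.2.2 z hz z (by simp) rfl
    refine list_conn' (l₁ ++ [a]) ?_ hsub a (by simp) _ ?_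
    · rw [hpts, show l₁ ++ a :: p :: c :: l₂ = (l₁ ++ [a]) ++ p :: c :: l₂ by simp] at hch
      exact hch.left_of_append
    · unfold GridPath.first
      simp only [hpts]
      cases l₁ <;> simp
  have hlast : GConn (v.toSet \ {p}) c v.last := by
    have hsub : ∀ z ∈ c :: l₂, z ∈ v.toSet \ {p} := by
      intro z hz
      refine ⟨?_, ?_⟩
      · show z ∈ v.pts; rw [hpts]
        simp only [List.mem_append, List.mem_cons] at hz ⊢
        tauto
      · rintro rfl
        rw [hpts, show l₁ ++ a :: z :: c :: l₂ = (l₁ ++ [a]) ++ z :: c :: l₂ by simp,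
          List.nodup_append] at hn
        exact (List.nodup_cons.1 hn.2.1).1 hz
    refine list_conn' (c :: l₂) ?_ hsub c (by simp) _ ?_
    · rw [hpts, show l₁ ++ a :: p :: c :: l₂ = (l₁ ++ [a, p]) ++ c :: l₂ by simp] at hch
      exact hch.right_of_append
    · have : v.last = (c :: l₂).getLast (by simp) := by
        unfold GridPath.last
        simp only [hpts]
        rw [List.getLast_append_of_ne_nil (h₂ := by simp)]
        simp
      rw [this]
      exact List.getLast_mem _
  have hxb : x ∈ b.toSet := hx.mem_right
  have hyb : y ∈ b'.toSet := hy.mem_right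
  refine planar_cross' (A := (b.toSet \ {p}) ∪ (b'.toSet \ {p}) ∪ C)
    (B := (v.toSet \ {p}) ∪ C0) (p := p) (a := a) (c := c) (x := x) (y := y) ?_ ?_ ?_
    (Or.inl ⟨hav, hap⟩) (Or.inl ⟨hcv, hcp⟩) (Or.inl (Or.inl ⟨hxb, hxp⟩))
    (Or.inl (Or.inr ⟨hyb, hyp⟩)) ?_ ?_ (b.consec_step hx) (b'.consec_step hy) hac ?_ ?_ ?_ ?_
  · rintro q ((h | h) | h) (h' | h')
    · exact h.2 (hbv q h.1 h'.1)
    · exact hbC0 q h.1 h'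
    · exact h.2 (hbv' q h.1 h'.1)
    · exact hbC0' q h.1 h'
    · exact hCv q h h'.1
    · exact hCC0 q h h'
  · rintro ((h | h) | h)
    · exact h.2 rfl
    · exact h.2 rfl
    · exact hpC h
  · rintro (h | h)
    · exact h.2 rfl
    · exact hpC0 h
  · exact v.consec_step (by rw [hpts]; exact consec_left _ _ _ _)
  · exact v.consec_step (by rw [hpts]; simpa using consec_right (l₁ ++ [a]) l₂ p c)
  · rintro rfl; exact s1 _ _ hx hy
  · by_contra h
    push Not at h
    exact hnb ⟨a, c, ⟨l₁, l₂, by rw [hpts]; simp⟩, h⟩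
  · refine (hfirst.mono Set.subset_union_left).trans (GConn.trans ?_
      (hlast.mono Set.subset_union_left).symm)
    exact (hC0 _ hf _ hl).mono Set.subset_union_right
  · refine GConn.trans ((hxc z hzb hzp).mono ?_) (GConn.trans ((hC _ hzC _ hzC').mono ?_)
      (((hyc z' hzb' hzp').mono ?_).symm))
    · intro q h; exact Or.inl (Or.inl h)
    · intro q h; exact Or.inr h
    · intro q h; exact Or.inl (Or.inr h)

section contact
open Classical

theorem body_contact (Q : Fin 17 → GridPath)
    (hid : ∀ u v, u ≠ v → ∀ p, p ∈ (Q u).toSet → p ∈ (Q v).toSet →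
      (Q u).IsEndpoint p ∨ (Q v).IsEndpoint p)
    (hseg : ∀ u v, u ≠ v → ∀ p q, ConsecIn (Q u).pts p q → ¬ ConsecIn (Q v).pts p q)
    (Ed : Finset (Fin 17 × Fin 17)) (hcard : 100 ≤ Ed.card)
    (hEd : ∀ e ∈ Ed, e.1 ≠ e.2 ∧ Touch (Q e.1) (Q e.2)) (β : Bool) :
    ∃ j, j ≠ 16 ∧ (Q 16).ep β ∈ (Q j).toSet := by
  by_contra hcon
  push Not at hcon
  have hx : (Q 16).ep β ∈ (Q 16).toSet := by
    unfold GridPath.ep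
    split_ifs
    · exact GridPath.first_mem _
    · exact GridPath.last_mem _
  obtain ⟨T, hT⟩ : ∃ T : Set (ℤ × ℤ), T = {(Q 16).ep β} := ⟨_, rfl⟩
  have := global_count Q hid hseg T Ed (by
    intro e he
    obtain ⟨hne, p, h1, h2⟩ := hEd e he
    refine ⟨hne, p, h1, h2, ?_⟩
    rw [hT]
    rintro rfl
    by_cases h : e.1 = 16
    · exact hcon e.2 (fun h' => hne (h.trans h'.symm)) h2
    · exact hcon e.1 h h1)
  have h2 : (Finset.univ.filter (fun t : Fin 17 × Bool =>
      (Q t.1).ep t.2 ∉ T)).card ≤ 33 := by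
    have : Finset.univ.filter (fun t : Fin 17 × Bool =>
      (Q t.1).ep t.2 ∉ T) ⊆ Finset.univ.erase (16, β) := by
      intro t ht
      rw [Finset.mem_filter] at ht
      rw [Finset.mem_erase]
      refine ⟨?_, Finset.mem_univ _⟩
      rintro rfl
      exact ht.2 (by rw [hT]; rfl)
    refine (Finset.card_le_card this).trans ?_
    rw [Finset.card_erase_of_mem (Finset.mem_univ _)]
    simp
  omega

theorem GridPath.IsEndpoint.exists_ep {P : GridPath} {p : ℤ × ℤ} (h : P.IsEndpoint p) :
    ∃ β, P.ep β = p := by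
  rcases h with h | h
  · exact ⟨true, by simp [GridPath.ep, h]⟩
  · exact ⟨false, by simp [GridPath.ep, h]⟩

theorem gadget_contact (v : GridPath) (Q : Fin 17 → GridPath)
    (hid : ∀ u v, u ≠ v → ∀ p, p ∈ (Q u).toSet → p ∈ (Q v).toSet →
      (Q u).IsEndpoint p ∨ (Q v).IsEndpoint p)
    (hseg : ∀ u v, u ≠ v → ∀ p q, ConsecIn (Q u).pts p q → ¬ ConsecIn (Q v).pts p q)
    (hvid : ∀ u, ∀ p, p ∈ (Q u).toSet → p ∈ v.toSet → (Q u).IsEndpoint p ∨ v.IsEndpoint p)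
    (hvC : ∀ j, j ≠ 15 → j ≠ 16 → ¬ Touch v (Q j))
    (hvb : Touch v (Q 15)) (hvb' : Touch v (Q 16))
    (hve : ∀ j p, p ∈ (Q j).toSet → ¬ v.IsEndpoint p)
    (Ed : Finset (Fin 17 × Fin 17)) (hcard : 98 ≤ Ed.card)
    (hEd : ∀ e ∈ Ed, e.1 ≠ e.2 ∧ Touch (Q e.1) (Q e.2)) :
    ∃ p, v.IsInterior p ∧ (Q 15).IsEndpoint p ∧ (Q 16).IsEndpoint p ∧
      (∀ q, q ∈ (Q 15).toSet → q ∈ v.toSet → q = p) ∧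
      (∀ q, q ∈ (Q 16).toSet → q ∈ v.toSet → q = p) := by
  have hep : ∀ j p, p ∈ (Q j).toSet → p ∈ v.toSet → (Q j).IsEndpoint p := by
    intro j p h1 h2
    rcases hvid j p h1 h2 with h | h
    · exact h
    · exact absurd h (hve j p h1)
  have htok : ∀ s : Finset (Fin 17 × Bool), (∀ t ∈ s, (Q t.1).ep t.2 ∈ v.toSet) →
      (Finset.univ.filter (fun t : Fin 17 × Bool => (Q t.1).ep t.2 ∉ v.toSet)).card + s.card
        ≤ 34 := by
    intro s hs
    rw [← Finset.card_union_of_disjoint]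
    · refine (Finset.card_le_univ _).trans ?_
      simp
    · rw [Finset.disjoint_left]
      intro t ht ht'
      exact (Finset.mem_filter.1 ht).2 (hs t ht')
  obtain ⟨x, hxv, hx⟩ := hvb
  obtain ⟨x', hxv', hx'⟩ := hvb'
  obtain ⟨β, hβ⟩ := (hep 15 x hx hxv).exists_ep
  obtain ⟨β', hβ'⟩ := (hep 16 x' hx' hxv').exists_ep
  have hoff : ∀ e : Fin 17 × Fin 17, ∀ p, p ∈ (Q e.1).toSet → p ∈ (Q e.2).toSet → p ∈ v.toSet →
      e.1 ≠ e.2 → e = (15, 16) ∨ e = (16, 15) := by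
    rintro ⟨i, j⟩ p h1 h2 hv hne
    have hi : i = 15 ∨ i = 16 := by
      by_contra h; push Not at h; exact hvC i h.1 h.2 ⟨p, hv, h1⟩
    have hj : j = 15 ∨ j = 16 := by
      by_contra h; push Not at h; exact hvC j h.1 h.2 ⟨p, hv, h2⟩
    rcases hi with rfl | rfl <;> rcases hj with rfl | rfl <;> simp_all
  have hex : ∃ p, p ∈ (Q 15).toSet ∧ p ∈ (Q 16).toSet ∧ p ∈ v.toSet := by
    by_contra hcon
    push Not at hcon
    have h1 := global_count Q hid hseg v.toSet Ed (by
      intro e he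
      obtain ⟨hne, p, h1, h2⟩ := hEd e he
      refine ⟨hne, p, h1, h2, ?_⟩
      intro hv
      rcases hoff e p h1 h2 hv hne with rfl | rfl
      · exact hcon p h1 h2 hv
      · exact hcon p h2 h1 hv)
    have h2 := htok {(15, β), (16, β')} (by
      intro t ht
      simp only [Finset.mem_insert, Finset.mem_singleton] at ht
      rcases ht with rfl | rfl
      · simpa only [hβ] using hxv
      · simpa only [hβ'] using hxv')
    rw [Finset.card_pair (by simp)] at h2
    omega
  obtain ⟨p, h15, h16, hpv⟩ := hex
  have he15 := hep 15 p h15 hpv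
  have he16 := hep 16 p h16 hpv
  have huniq : ∀ j j' : Fin 17, j ≠ j' → ∀ p p', p ∈ (Q j).toSet → p ∈ v.toSet →
      p' ∈ (Q j').toSet → p' ∈ v.toSet → ∀ q, q ∈ (Q j).toSet → q ∈ v.toSet → q = p := by
    intro j j' hjj p p' hp hpv hp' hpv' q hq hqv
    by_contra hqp
    obtain ⟨β₁, h1⟩ := (hep j p hp hpv).exists_ep
    obtain ⟨β₂, h2⟩ := (hep j q hq hqv).exists_ep
    obtain ⟨β₃, h3⟩ := (hep j' p' hp' hpv').exists_ep
    have hββ : β₁ ≠ β₂ := by rintro rfl; exact hqp (h2.symm.trans h1)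
    have ht := htok {(j, β₁), (j, β₂), (j', β₃)} (by
      intro t ht
      simp only [Finset.mem_insert, Finset.mem_singleton] at ht
      rcases ht with rfl | rfl | rfl
      · simpa only [h1] using hpv
      · simpa only [h2] using hqv
      · simpa only [h3] using hpv')
    rw [Finset.card_eq_three.2 ⟨_, _, _, by simpa using hββ, by simp [hjj], by simp [hjj], rfl⟩] at ht
    have hg := global_count Q hid hseg v.toSet (Ed \ {(15, 16), (16, 15)}) (by
      intro e he
      rw [Finset.mem_sdiff] at he
      obtain ⟨hne, p, h1, h2⟩ := hEd e he.1
      refine ⟨hne, p, h1, h2, ?_⟩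
      intro hv
      exact he.2 (by simpa using hoff e p h1 h2 hv hne))
    have hsd := Finset.le_card_sdiff ({(15, 16), (16, 15)} : Finset (Fin 17 × Fin 17)) Ed
    rw [Finset.card_pair (by simp)] at hsd
    omega
  exact ⟨p, ⟨hpv, hve 15 p h15⟩, he15, he16,
    huniq 15 16 (by simp) p p h15 hpv h16 hpv, huniq 16 15 (by simp) p p h16 hpv h15 hpv⟩

end contact

/-- The vertex type of the separating graph. -/
abbrev Vx (N : ℕ) := Option (Fin 16 ⊕ (Fin N × Fin 17))

/-- Vertices of the body. -/
def vb {N : ℕ} (j : Fin 16) : Vx N := some (Sum.inl j)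
/-- Vertices of the gadgets. -/
def vg {N : ℕ} (i : Fin N) (j : Fin 17) : Vx N := some (Sum.inr (i, j))
/-- The body together with the main path (index 16). -/
def vbv {N : ℕ} (j : Fin 17) : Vx N := if h : j.val < 16 then vb ⟨j.val, h⟩ else none

theorem bendSet_finite (P : GridPath) : P.bendSet.Finite := by
  refine (List.finite_toSet P.pts).subset ?_
  rintro p ⟨a, c, h, _⟩
  exact h.subset (by simp)

theorem lower_bound {N k : ℕ} (hk : k < N) (G : SimpleGraph (Vx N))
    (EdB EdG : Finset (Fin 17 × Fin 17)) (hEdB : 100 ≤ EdB.card) (hEdG : 98 ≤ EdG.card)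
    (hB : ∀ e ∈ EdB, e.1 ≠ e.2 ∧ G.Adj (vbv e.1) (vbv e.2))
    (hG : ∀ e ∈ EdG, e.1 ≠ e.2 ∧ ∀ i, G.Adj (vg i e.1) (vg i e.2))
    (hconB : ∀ j : Fin 16, j ≠ 0 → ∃ j' < j, G.Adj (vb j) (vb j'))
    (hconG : ∀ i, ∀ j : Fin 17, j ≠ 0 → ∃ j' < j, j'.val < 15 ∧ G.Adj (vg i j) (vg i j'))
    (hvC : ∀ i j, j ≠ 15 → j ≠ 16 → ¬ G.Adj none (vg i j))
    (hv15 : ∀ i, G.Adj none (vg i 15)) (hv16 : ∀ i, G.Adj none (vg i 16))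
    (hBG : ∀ j i j', ¬ G.Adj (vb j) (vg i j'))
    (hGG : ∀ i j i' j', i ≠ i' → ¬ G.Adj (vg i j) (vg i' j')) :
    ¬ IsBkCPG G k := by
  rintro ⟨R, hR⟩
  have tou : ∀ u w, G.Adj u w → Touch (R.path u) (R.path w) := fun u w h =>
    (R.adj_iff u w h.ne).1 h
  have ntou : ∀ u w, u ≠ w → ¬ G.Adj u w → ∀ p, p ∈ (R.path u).toSet → p ∉ (R.path w).toSet :=
    fun u w hne h p h1 h2 => h ((R.adj_iff u w hne).2 ⟨p, h1, h2⟩)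
  have inj_vbv : ∀ j j' : Fin 17, j ≠ j' → (vbv j : Vx N) ≠ vbv j' := by
    intro j j' h h'
    unfold vbv vb at h'
    split_ifs at h' <;> simp at h' <;> omega
  have inj_vg : ∀ i : Fin N, ∀ j j' : Fin 17, j ≠ j' → (vg i j : Vx N) ≠ vg i j' := by
    intro i j j' h h'
    simp [vg] at h'
    exact h h'
  have hvbv16 : (vbv 16 : Vx N) = none := by simp [vbv]
  have hends : ∀ β, ∃ j : Fin 16, (R.path none).ep β ∈ (R.path (vb j)).toSet := by
    intro β
    obtain ⟨j, hj, h⟩ := body_contact (fun j => R.path (vbv j))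
      (fun u v h => R.interiorly_disjoint _ _ (inj_vbv _ _ h))
      (fun u v h => R.no_shared_segment _ _ (inj_vbv _ _ h)) EdB hEdB
      (fun e he => ⟨(hB e he).1, tou _ _ (hB e he).2⟩) β
    simp only [hvbv16] at h
    have hj' : j.val < 16 := by omega
    refine ⟨⟨j.val, hj'⟩, ?_⟩
    simpa [vbv, hj'] using h
  have hvend : ∀ p, (R.path none).IsEndpoint p → ∃ j : Fin 16, p ∈ (R.path (vb j)).toSet := by
    intro p hp
    obtain ⟨β, rfl⟩ := hp.exists_ep
    exact hends β
  have hgb : ∀ i j j' p, p ∈ (R.path (vg i j)).toSet → p ∉ (R.path (vb j')).toSet := by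
    intro i j j' p h h'
    exact ntou (vb j') (vg i j) (by simp [vb, vg]) (hBG _ _ _) p h' h
  have key : ∀ i : Fin N, ∃ p, p ∈ (R.path (vg i 15)).toSet ∧ (R.path none).IsBend p := by
    intro i
    obtain ⟨p, hp1, hp2, hp3, hp4, hp5⟩ := gadget_contact (R.path none) (fun j => R.path (vg i j))
      (fun u v h => R.interiorly_disjoint _ _ (inj_vg i _ _ h))
      (fun u v h => R.no_shared_segment _ _ (inj_vg i _ _ h))
      (fun u => R.interiorly_disjoint _ _ (by simp [vg]))
      (fun j h1 h2 => by
        rintro ⟨p, h3, h4⟩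
        exact ntou _ _ (by simp [vg]) (hvC i j h1 h2) p h3 h4)
      (tou _ _ (hv15 i)) (tou _ _ (hv16 i))
      (fun j p h1 h2 => by
        obtain ⟨j', h3⟩ := hvend p h2
        exact hgb i j j' p h1 h3)
      EdG hEdG (fun e he => ⟨(hG e he).1, tou _ _ ((hG e he).2 i)⟩)
    refine ⟨p, hp2.mem, ?_⟩
    by_contra hnb
    refine straight_contra (R.path none) (R.path (vg i 15)) (R.path (vg i 16))
      (⋃ j : Fin 15, (R.path (vg i (Fin.castLE (by omega) j))).toSet)
      (⋃ j : Fin 16, (R.path (vb j)).toSet) p hp1 hp2 hp3 hnb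
      (R.no_shared_segment _ _ (inj_vg i _ _ (by simp))) hp4 hp5 ?_ ?_ ?_ ?_ ?_ ?_ ?_ ?_ ?_ ?_
    · intro x hx y hy
      obtain ⟨j, hx⟩ := Set.mem_iUnion.1 hx
      obtain ⟨j', hy⟩ := Set.mem_iUnion.1 hy
      refine cluster_conn (fun j : Fin (14 + 1) => R.path (vg i (Fin.castLE (by omega) j))) ?_ ?_
        (j := j) (j' := j') hx hy
      · intro j hj
        obtain ⟨j', h1, h2, h3⟩ := hconG i (Fin.castLE (by omega) j) (by
          intro h; apply hj; ext; simpa using congrArg Fin.val h)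
        refine ⟨⟨j'.val, h2⟩, ?_, tou _ _ h3⟩
        rw [Fin.lt_def] at h1 ⊢
        exact h1
      · intro j
        exact Set.subset_iUnion (fun j : Fin 15 => (R.path (vg i (Fin.castLE (by omega) j))).toSet) j
    · intro x hx y hy
      obtain ⟨j, hx⟩ := Set.mem_iUnion.1 hx
      obtain ⟨j', hy⟩ := Set.mem_iUnion.1 hy
      refine cluster_conn (fun j : Fin (15 + 1) => R.path (vb j)) ?_ ?_ (j := j) (j' := j') hx hy
      · intro j hj
        obtain ⟨j', h1, h3⟩ := hconB j hj
        exact ⟨j', h1, tou _ _ h3⟩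
      · intro j
        exact Set.subset_iUnion (fun j : Fin 16 => (R.path (vb j)).toSet) j
    · intro x hx hxv
      obtain ⟨j, hx⟩ := Set.mem_iUnion.1 hx
      refine ntou _ _ (by simp [vg]) (hvC i (Fin.castLE (by omega) j) ?_ ?_) x hxv hx
      · intro h; have := congrArg Fin.val h; simp at this; omega
      · intro h; have := congrArg Fin.val h; simp at this; omega
    · intro x hx hx'
      obtain ⟨j, hx⟩ := Set.mem_iUnion.1 hx
      obtain ⟨j', hx'⟩ := Set.mem_iUnion.1 hx'
      exact hgb _ _ _ x hx hx'
    · intro x hx hx'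
      obtain ⟨j', hx'⟩ := Set.mem_iUnion.1 hx'
      exact hgb _ _ _ x hx hx'
    · intro x hx hx'
      obtain ⟨j', hx'⟩ := Set.mem_iUnion.1 hx'
      exact hgb _ _ _ x hx hx'
    · exact Set.mem_iUnion.2 (hvend _ (Or.inl rfl))
    · exact Set.mem_iUnion.2 (hvend _ (Or.inr rfl))
    · obtain ⟨j', h1, h2, h3⟩ := hconG i 15 (by simp)
      obtain ⟨x, hx, hx'⟩ := tou _ _ h3
      exact ⟨x, hx, Set.mem_iUnion.2 ⟨⟨j'.val, h2⟩, hx'⟩⟩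
    · obtain ⟨j', h1, h2, h3⟩ := hconG i 16 (by simp)
      obtain ⟨x, hx, hx'⟩ := tou _ _ h3
      exact ⟨x, hx, Set.mem_iUnion.2 ⟨⟨j'.val, h2⟩, hx'⟩⟩
  choose pt hpt1 hpt2 using key
  have hinj : Function.Injective pt := by
    intro i i' h
    by_contra hne
    refine ntou _ _ ?_ (hGG i 15 i' 15 hne) (pt i) (hpt1 i) (by rw [h]; exact hpt1 i')
    simp [vg, hne]
  have h1 : (Set.range pt).ncard = N := by
    rw [← Set.image_univ, Set.ncard_image_of_injective _ hinj]
    simp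
  have h2 : (Set.range pt).ncard ≤ (R.path none).bendSet.ncard := by
    refine Set.ncard_le_ncard ?_ (bendSet_finite _)
    rintro _ ⟨i, rfl⟩
    exact hpt2 i
  have h3 : (R.path none).bendSet.ncard ≤ k := hR none
  omega

/-! ## The construction: data -/

/-- Compatibility of two paths in a contact representation (at most one common point). -/
def Compat (P Q : GridPath) : Prop :=
  ∀ p, p ∈ P.toSet → p ∈ Q.toSet → (P.IsEndpoint p ∨ Q.IsEndpoint p) ∧
    ∀ q, q ∈ P.toSet → q ∈ Q.toSet → p = q

theorem Compat.symm {P Q : GridPath} (h : Compat P Q) : Compat Q P :=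
  fun p h1 h2 => ⟨(h p h2 h1).1.symm, fun q h3 h4 => (h p h2 h1).2 q h4 h3⟩

theorem Compat.of_disjoint {P Q : GridPath} (h : ∀ p, p ∈ P.toSet → p ∉ Q.toSet) : Compat P Q :=
  fun p h1 h2 => absurd h2 (h p h1)

/-- The contact graph of a family of paths. -/
def contactGraph {V : Type} (P : V → GridPath) : SimpleGraph V where
  Adj u w := u ≠ w ∧ Touch (P u) (P w)
  symm := ⟨fun _ _ h => ⟨h.1.symm, h.2.symm⟩⟩
  loopless := ⟨fun _ h => h.1 rfl⟩

/-- Representation of the contact graph. -/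
def contactRep {V : Type} (P : V → GridPath) (h : ∀ u w, u ≠ w → Compat (P u) (P w)) :
    CPGRep (contactGraph P) where
  path := P
  interiorly_disjoint u w hne p h1 h2 := (h u w hne p h1 h2).1
  no_shared_segment u w hne p q h1 h2 := by
    have hpq := (h u w hne p h1.mem_left h2.mem_left).2 q h1.mem_right h2.mem_right
    have hs := (P u).consec_step h1
    subst hpq
    simp [GridStep] at hs
  adj_iff u w hne := ⟨fun h => h.2, fun h => ⟨hne, h⟩⟩

/-- The map placing a copy of a base picture. -/
def tau (q₁ q₂ : ℤ) (a b : Bool) (p : ℤ × ℤ) : ℤ × ℤ :=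
  (q₁ + (if a then p.1 - 3 else 3 - p.1), q₂ + (if b then p.2 - 4 else 4 - p.2))

theorem tau_inj (q₁ q₂ : ℤ) (a b : Bool) : Function.Injective (tau q₁ q₂ a b) := by
  rintro ⟨x, y⟩ ⟨x', y'⟩ h
  cases a <;> cases b <;> simp [tau] at h ⊢ <;> omega

theorem tau_step (q₁ q₂ : ℤ) (a b : Bool) {p p' : ℤ × ℤ} (h : GridStep p p') :
    GridStep (tau q₁ q₂ a b p) (tau q₁ q₂ a b p') := by
  unfold GridStep at *
  cases a <;> cases b <;> simp only [tau] <;> simp <;> omega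

/-- Placed copy of a path. -/
def GridPath.place (P : GridPath) (q₁ q₂ : ℤ) (a b : Bool) : GridPath where
  pts := P.pts.map (tau q₁ q₂ a b)
  two_le_length := by rw [List.length_map]; exact P.two_le_length
  step := by
    show List.IsChain _ _
    rw [List.isChain_map]
    exact P.chain.imp (fun _ _ h => tau_step _ _ _ _ h)
  nodup := P.nodup.map (tau_inj _ _ _ _)

theorem mem_place {P : GridPath} {q₁ q₂ : ℤ} {a b : Bool} {p : ℤ × ℤ} :
    p ∈ (P.place q₁ q₂ a b).toSet ↔ ∃ r ∈ P.toSet, tau q₁ q₂ a b r = p := by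
  show p ∈ List.map _ _ ↔ _
  rw [List.mem_map]; rfl

theorem place_endpoint {P : GridPath} {q₁ q₂ : ℤ} {a b : Bool} {p : ℤ × ℤ}
    (h : P.IsEndpoint p) : (P.place q₁ q₂ a b).IsEndpoint (tau q₁ q₂ a b p) := by
  rcases h with rfl | rfl
  · left; simp [GridPath.first, GridPath.place]
  · right; simp [GridPath.last, GridPath.place]

theorem Compat.place {P Q : GridPath} (h : Compat P Q) (q₁ q₂ : ℤ) (a b : Bool) :
    Compat (P.place q₁ q₂ a b) (Q.place q₁ q₂ a b) := by
  intro p h1 h2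
  obtain ⟨r, hr, rfl⟩ := mem_place.1 h1
  obtain ⟨r', hr', he⟩ := mem_place.1 h2
  obtain rfl := tau_inj _ _ _ _ he
  obtain ⟨h3, h4⟩ := h r' hr hr'
  refine ⟨h3.imp place_endpoint place_endpoint, ?_⟩
  intro q h5 h6
  obtain ⟨s, hs, rfl⟩ := mem_place.1 h5
  obtain ⟨s', hs', he⟩ := mem_place.1 h6
  obtain rfl := tau_inj _ _ _ _ he
  rw [h4 s' hs hs']

theorem Touch.place {P Q : GridPath} (h : Touch P Q) (q₁ q₂ : ℤ) (a b : Bool) :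
    Touch (P.place q₁ q₂ a b) (Q.place q₁ q₂ a b) := by
  obtain ⟨p, h1, h2⟩ := h
  exact ⟨_, mem_place.2 ⟨p, h1, rfl⟩, mem_place.2 ⟨p, h2, rfl⟩⟩

/-- The list of bends of a list of grid points. -/
def bendList : List (ℤ × ℤ) → List (ℤ × ℤ)
  | a :: p :: c :: l =>
    if a.1 ≠ c.1 ∧ a.2 ≠ c.2 then p :: bendList (p :: c :: l) else bendList (p :: c :: l)
  | _ => []

theorem mem_bendList {a p c : ℤ × ℤ} (h1 : a.1 ≠ c.1) (h2 : a.2 ≠ c.2) :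
    ∀ l : List (ℤ × ℤ), [a, p, c] <:+: l → p ∈ bendList l
  | [], h => by simp at h
  | [x], h => by have := h.length_le; simp at this
  | [x, y], h => by have := h.length_le; simp at this
  | x :: y :: z :: l, h => by
    rw [List.infix_cons_iff] at h
    unfold bendList
    rcases h with h | h
    · obtain ⟨t, ht⟩ := h
      simp only [List.cons_append, List.cons.injEq] at ht
      obtain ⟨rfl, rfl, rfl, _⟩ := ht
      rw [if_pos ⟨h1, h2⟩]
      simp
    · have := mem_bendList h1 h2 (y :: z :: l) h
      split_ifs
      · exact List.mem_cons_of_mem _ this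
      · exact this

theorem bendsAtMost_of_list (P : GridPath) {k : ℕ} (h : (bendList P.pts).length ≤ k) :
    P.BendsAtMost k := by
  unfold GridPath.BendsAtMost
  have : P.bendSet ⊆ ((bendList P.pts).toFinset : Set (ℤ × ℤ)) := by
    rintro p ⟨a, c, h, h1, h2⟩
    simpa using mem_bendList h1 h2 _ h
  refine (Set.ncard_le_ncard this (Finset.finite_toSet _)).trans ?_
  rw [Set.ncard_coe_finset]
  exact (List.toFinset_card_le _).trans h

theorem bendList_tau (q₁ q₂ : ℤ) (a b : Bool) : ∀ l : List (ℤ × ℤ),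
    (bendList (l.map (tau q₁ q₂ a b))).length = (bendList l).length
  | [] => rfl
  | [_] => rfl
  | [_, _] => rfl
  | x :: y :: z :: l => by
    have ih := bendList_tau q₁ q₂ a b (y :: z :: l)
    simp only [List.map_cons] at ih ⊢
    rw [bendList, bendList]
    have hiff : ((tau q₁ q₂ a b x).1 ≠ (tau q₁ q₂ a b z).1 ∧
        (tau q₁ q₂ a b x).2 ≠ (tau q₁ q₂ a b z).2) ↔ (x.1 ≠ z.1 ∧ x.2 ≠ z.2) := by
      cases a <;> cases b <;> simp [tau]
    simp only [hiff]
    split_ifs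
    · simp [ih]
    · exact ih

theorem place_bends {P : GridPath} {k : ℕ} (h : (bendList P.pts).length ≤ k)
    (q₁ q₂ : ℤ) (a b : Bool) : (P.place q₁ q₂ a b).BendsAtMost k := by
  refine bendsAtMost_of_list _ ?_
  show (bendList (P.pts.map _)).length ≤ k
  rw [bendList_tau]
  exact h

/-- Paths common to the gadget and the body. -/
def commonL : List (List (ℤ × ℤ)) :=
  [[(1,1),(2,1),(3,1)], [(-1,1),(0,1),(1,1)], [(1,1),(1,0),(1,-1)], [(1,-1),(0,-1),(-1,-1)],
   [(-1,-1),(-1,0),(-1,1)], [(-1,1),(-1,2),(-1,3)], [(1,-1),(1,-2),(1,-3)],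
   [(-1,-1),(-2,-1),(-3,-1)], [(1,1),(1,2),(1,3),(0,3),(-1,3)], [(1,-1),(2,-1),(3,-1),(3,0),(3,1)],
   [(-1,-1),(-1,-2),(-1,-3),(0,-3),(1,-3)], [(-1,1),(-2,1),(-3,1),(-3,0),(-3,-1)],
   [(1,-3),(1,-4),(0,-4),(-1,-4),(-2,-4),(-3,-4),(-3,-3),(-3,-2),(-3,-1)],
   [(-3,-1),(-4,-1),(-4,0),(-4,1),(-4,2),(-4,3),(-3,3),(-2,3),(-1,3)]]

/-- Base gadget. -/
def gadL (j : Fin 17) : List (ℤ × ℤ) :=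
  ([(3,1),(4,1),(4,0),(4,-1),(4,-2),(4,-3),(3,-3),(2,-3),(1,-3)] ::
    (commonL ++ [[(-1,3),(-1,4),(0,4),(1,4),(2,4),(3,4)], [(3,1),(3,2),(3,3),(3,4)]])).getD j.val []

/-- Base body. The last entry lists the two contact points with the main path. -/
def bodL (j : Fin 17) : List (ℤ × ℤ) :=
  ([(3,1),(4,1),(5,1),(6,1),(7,1),(8,1),(8,0),(8,-1),(8,-2),(8,-3),(7,-3),(6,-3),(5,-3),(4,-3),
      (3,-3),(2,-3),(1,-3)] ::
    (commonL ++ [[(-1,3),(-1,4),(0,4),(1,4),(2,4),(3,4),(3,3),(3,2),(3,1)],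
      [(-1,4),(8,1)]])).getD j.val []

instance (p q : ℤ × ℤ) : Decidable (GridStep p q) := by unfold GridStep; infer_instance

/-- Validity of a list as a grid path. -/
def ListOK (l : List (ℤ × ℤ)) : Prop :=
  2 ≤ l.length ∧ l.IsChain GridStep ∧ l.Nodup ∧ (bendList l).length ≤ 2

instance (l : List (ℤ × ℤ)) : Decidable (ListOK l) := by unfold ListOK; infer_instance

/-- `p` is an extreme entry of `l`. -/
def LEnd (l : List (ℤ × ℤ)) (p : ℤ × ℤ) : Prop := l.head? = some p ∨ l.getLast? = some p

instance (l : List (ℤ × ℤ)) (p : ℤ × ℤ) : Decidable (LEnd l p) := by unfold LEnd; infer_instance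

/-- List version of `Compat`. -/
def LCompat (l m : List (ℤ × ℤ)) : Prop :=
  ∀ p ∈ l, p ∈ m → (LEnd l p ∨ LEnd m p) ∧ ∀ q ∈ l, q ∈ m → p = q

instance (l m : List (ℤ × ℤ)) : Decidable (LCompat l m) := by unfold LCompat; infer_instance

theorem LEnd.isEndpoint {P : GridPath} {p : ℤ × ℤ} (h : LEnd P.pts p) : P.IsEndpoint p := by
  rcases h with h | h
  · left
    rw [List.head?_eq_some_head P.ne_nil] at h
    exact (Option.some.inj h).symm
  · right
    rw [List.getLast?_eq_some_getLast P.ne_nil] at h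
    exact (Option.some.inj h).symm

theorem LCompat.compat {P Q : GridPath} (h : LCompat P.pts Q.pts) : Compat P Q :=
  fun p h1 h2 => ⟨(h p h1 h2).1.imp LEnd.isEndpoint LEnd.isEndpoint, (h p h1 h2).2⟩

theorem gad_ok : ∀ j, ListOK (gadL j) := by decide +kernel
theorem bod_ok : ∀ j : Fin 16, ListOK (bodL j.castSucc) := by decide +kernel
theorem gad_compat : ∀ i j, i ≠ j → LCompat (gadL i) (gadL j) := by decide +kernel
theorem bod_compat : ∀ i j : Fin 16, i ≠ j → LCompat (bodL i.castSucc) (bodL j.castSucc) := by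
  decide +kernel

/-- Ordered adjacent pairs in a family of lists. -/
def edges (L : Fin 17 → List (ℤ × ℤ)) : Finset (Fin 17 × Fin 17) :=
  Finset.univ.filter (fun e => e.1 ≠ e.2 ∧ ∃ p ∈ L e.1, p ∈ L e.2)

theorem edges_gad : (edges gadL).card = 98 := by decide +kernel
theorem edges_bod : (edges bodL).card = 100 := by decide +kernel

theorem gad_conn : ∀ j : Fin 17, j ≠ 0 → ∃ j' < j, j'.val < 15 ∧ ∃ p ∈ gadL j, p ∈ gadL j' := by
  decide +kernel
theorem bod_conn : ∀ j : Fin 16, j ≠ 0 → ∃ j' < j, ∃ p ∈ bodL j.castSucc,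
    p ∈ bodL j'.castSucc := by decide +kernel

theorem gad_box : ∀ j, ∀ p ∈ gadL j, -4 ≤ p.1 ∧ p.1 ≤ 4 ∧ -4 ≤ p.2 ∧ p.2 ≤ 4 ∧
    (p.2 = 4 → p.1 ≤ 3) := by decide +kernel
theorem bod_box : ∀ j, ∀ p ∈ bodL j, -4 ≤ p.1 ∧ p.1 ≤ 8 ∧ -4 ≤ p.2 ∧ p.2 ≤ 4 ∧
    (p.2 = 4 → -1 ≤ p.1) ∧ (p.1 = 8 → p.2 ≤ 1) := by decide +kernel

theorem gad_corner : ∀ j, (3, 4) ∈ gadL j → LEnd (gadL j) (3, 4) ∧ (j = 15 ∨ j = 16) := by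
  decide +kernel
theorem bod_corner : ∀ j : Fin 16, ¬ ((-1, 4) ∈ bodL j.castSucc ∧ (8, 1) ∈ bodL j.castSucc) := by
  decide +kernel

/-- Base gadget path. -/
def gadP (j : Fin 17) : GridPath := ⟨gadL j, (gad_ok j).1, (gad_ok j).2.1, (gad_ok j).2.2.1⟩
/-- Base body path. -/
def bodP (j : Fin 16) : GridPath :=
  ⟨bodL j.castSucc, (bod_ok j).1, (bod_ok j).2.1, (bod_ok j).2.2.1⟩

/-! ## The construction: placement -/

/-- Right-most coordinate. -/
def xx (n : ℕ) : ℕ := 20 * ((n + 1) / 2) + 9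
/-- Height of the first vertical run. -/
def mm (n : ℕ) : ℕ := 3 + 20 * ((n + 2) / 2)
/-- Total number of steps. -/
def tt (n : ℕ) : ℕ := mm n + xx n + 20 * (n + 1)

/-- The points of the main path. -/
def vpt (n t : ℕ) : ℤ × ℤ :=
  if t < mm n then ((xx n : ℤ), -(mm n : ℤ) + t)
  else if t < mm n + xx n then ((xx n : ℤ) - (t - mm n), 0)
  else if (t - mm n - xx n) % 40 < 20 then
    (20 * (((t - mm n - xx n) / 40 : ℕ) : ℤ),
      -20 * (((t - mm n - xx n) / 40 : ℕ) : ℤ) - (((t - mm n - xx n) % 40 : ℕ) : ℤ))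
  else (20 * (((t - mm n - xx n) / 40 : ℕ) : ℤ) + ((((t - mm n - xx n) % 40 : ℕ) : ℤ) - 20),
      -20 * (((t - mm n - xx n) / 40 : ℕ) : ℤ) - 20)

theorem vpt_step (n t : ℕ) : GridStep (vpt n t) (vpt n (t + 1)) := by
  unfold GridStep
  have hx : 0 < xx n := by unfold xx; omega
  unfold vpt
  split_ifs <;> simp only <;> push_cast <;> omega

theorem vpt_inj (n : ℕ) {t t' : ℕ} (ht : t ≤ tt n) (ht' : t' ≤ tt n) (h : vpt n t = vpt n t') :
    t = t' := by
  unfold tt xx mm at ht ht'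
  unfold vpt xx mm at h
  split_ifs at h <;> simp only [Prod.mk.injEq] at h <;> omega

/-- The main path. -/
def vP (n : ℕ) : GridPath where
  pts := (List.range (tt n + 1)).map (vpt n)
  two_le_length := by simp [tt, xx]; omega
  step := by
    show List.IsChain _ _
    rw [List.isChain_map, List.isChain_range]
    intro m _
    exact vpt_step n m
  nodup := by
    refine List.Nodup.map_on ?_ List.nodup_range
    intro x hx y hy h
    rw [List.mem_range] at hx hy
    exact vpt_inj n (by omega) (by omega) h

theorem mem_vP {n : ℕ} {p : ℤ × ℤ} : p ∈ (vP n).toSet ↔ ∃ t ≤ tt n, vpt n t = p := by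
  show p ∈ List.map _ _ ↔ _
  simp [List.mem_map]

theorem vP_first (n : ℕ) : (vP n).first = ((xx n : ℤ), -(mm n : ℤ)) := by
  have : (vP n).first = vpt n 0 := by simp [GridPath.first, vP, List.head_map]
  rw [this]
  have : 0 < mm n := by unfold mm; omega
  simp [vpt, this]

theorem vP_last (n : ℕ) : (vP n).last =
    (20 * (((n + 1) / 2 : ℕ) : ℤ), -20 * (((n + 2) / 2 : ℕ) : ℤ)) := by
  have : (vP n).last = vpt n (tt n) := by simp [GridPath.last, vP]
  rw [this]
  unfold vpt tt
  split_ifs <;> simp only [Prod.mk.injEq] <;> omega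

/-- Geometric description of the points of the main path. -/
theorem vP_cases {n : ℕ} {p : ℤ × ℤ} (hp : p ∈ (vP n).toSet) :
    (p.1 = 20 * (((n + 1) / 2 : ℕ) : ℤ) + 9 ∧ -3 - 20 * (((n + 2) / 2 : ℕ) : ℤ) ≤ p.2 ∧ p.2 ≤ 0) ∨
    (p.2 = 0 ∧ 0 ≤ p.1 ∧ p.1 ≤ 20 * (((n + 1) / 2 : ℕ) : ℤ) + 9) ∨
    (∃ m : ℕ, 2 * m ≤ n ∧ p.1 = 20 * m ∧ -20 * (m : ℤ) - 20 ≤ p.2 ∧ p.2 ≤ -20 * m) ∨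
    (∃ m : ℕ, 2 * m + 1 ≤ n ∧ p.2 = -20 * (m : ℤ) - 20 ∧ 20 * (m : ℤ) ≤ p.1 ∧
      p.1 ≤ 20 * m + 20) := by
  obtain ⟨t, ht, rfl⟩ := mem_vP.1 hp
  unfold tt mm xx at ht
  unfold vpt mm xx
  split_ifs with h1 h2 h3
  · left; simp only; push_cast; omega
  · right; left; refine ⟨rfl, ?_, ?_⟩ <;> simp only <;> push_cast <;> omega
  · by_cases h4 : 2 * ((t - (3 + 20 * ((n + 2) / 2)) - (20 * ((n + 1) / 2) + 9)) / 40) ≤ n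
    · right; right; left
      refine ⟨(t - (3 + 20 * ((n + 2) / 2)) - (20 * ((n + 1) / 2) + 9)) / 40, h4, rfl, ?_, ?_⟩ <;>
        (try simp only) <;> omega
    · right; right; right
      refine ⟨(t - (3 + 20 * ((n + 2) / 2)) - (20 * ((n + 1) / 2) + 9)) / 40 - 1, ?_, ?_, ?_, ?_⟩ <;>
        (try simp only) <;> omega
  · by_cases h4 : 2 * ((t - (3 + 20 * ((n + 2) / 2)) - (20 * ((n + 1) / 2) + 9)) / 40) + 1 ≤ n
    · right; right; right
      refine ⟨(t - (3 + 20 * ((n + 2) / 2)) - (20 * ((n + 1) / 2) + 9)) / 40, h4, ?_, ?_, ?_⟩ <;>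
        (try simp only) <;> omega
    · right; right; left
      refine ⟨(t - (3 + 20 * ((n + 2) / 2)) - (20 * ((n + 1) / 2) + 9)) / 40, ?_, ?_, ?_, ?_⟩ <;>
        (try simp only) <;> omega

theorem vP_bends (n : ℕ) : (vP n).BendsAtMost (n + 2) := by
  unfold GridPath.BendsAtMost
  have hsub : (vP n).bendSet ⊆ (((insert (mm n) ((Finset.range (n + 1)).image
      (fun i => mm n + xx n + 20 * i))).image (vpt n) : Finset (ℤ × ℤ)) : Set (ℤ × ℤ)) := by
    rintro p ⟨a, c, ⟨s, t, hst⟩, h1, h2⟩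
    have hpts : (vP n).pts = (List.range (tt n + 1)).map (vpt n) := rfl
    rw [hpts] at hst
    have hlen := congrArg List.length hst
    simp at hlen
    have ea := congrArg (fun l => l[s.length]?) hst
    have ep := congrArg (fun l => l[s.length + 1]?) hst
    have ec := congrArg (fun l => l[s.length + 2]?) hst
    simp [show s.length < tt n + 1 by omega] at ea
    simp [show s.length + 1 < tt n + 1 by omega] at ep
    simp [show s.length + 2 < tt n + 1 by omega] at ec
    subst ea; subst ep; subst ec
    generalize s.length = u at *
    have hu : u + 2 ≤ tt n := by omega
    rw [Finset.mem_coe, Finset.mem_image]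
    refine ⟨u + 1, ?_, rfl⟩
    rw [Finset.mem_insert, Finset.mem_image]
    by_cases hM : u + 1 = mm n
    · exact Or.inl hM
    right
    have hx : 9 ≤ xx n := by unfold xx; omega
    have hm : 3 ≤ mm n := by unfold mm; omega
    have key : mm n + xx n ≤ u + 1 ∧ (u + 1 - mm n - xx n) % 20 = 0 := by
      unfold vpt at h1 h2
      generalize mm n = M at *
      generalize xx n = X at *
      clear hst hlen hpts
      constructor
      · by_contra hcon
        by_cases h3 : u + 1 < M
        · apply h1
          split_ifs <;> simp only <;> push_cast <;> omega
        · apply h2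
          split_ifs <;> simp only <;> push_cast <;> omega
      · by_contra hcon
        split_ifs at h1 h2 <;> simp only at h1 h2 <;> push_cast at h1 h2 <;> omega
    refine ⟨(u + 1 - mm n - xx n) / 20, ?_, ?_⟩
    · rw [Finset.mem_range]
      unfold tt at hu
      omega
    · omega
  refine (Set.ncard_le_ncard hsub (Finset.finite_toSet _)).trans ?_
  rw [Set.ncard_coe_finset]
  refine Finset.card_image_le.trans ((Finset.card_insert_le _ _).trans ?_)
  have := Finset.card_image_le (s := Finset.range (n + 1)) (f := fun i => mm n + xx n + 20 * i)
  rw [Finset.card_range] at this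
  omega


/-- First coordinate of the anchor of gadget `i`. -/
def gx (n i : ℕ) : ℤ := if i = n + 1 then (xx n : ℤ) else 20 * ((i / 2 : ℕ) : ℤ)
/-- Second coordinate of the anchor of gadget `i`. -/
def gy (n i : ℕ) : ℤ := if i = n + 1 then 0 else -20 * (((i + 1) / 2 : ℕ) : ℤ)
/-- Horizontal orientation of gadget `i`. -/
def ga (n i : ℕ) : Bool := if i = n + 1 then false else decide (i = 0 ∨ i % 2 = 1)
/-- Vertical orientation of gadget `i`. -/
def gb (n i : ℕ) : Bool := if i = n + 1 then false else decide (i % 2 = 1)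

/-- The family of paths. -/
def fam (n : ℕ) : Vx (n + 2) → GridPath
  | none => vP n
  | some (Sum.inl j) => (bodP j).place (20 * (((n + 1) / 2 : ℕ) : ℤ) + 4)
      (-20 * (((n + 2) / 2 : ℕ) : ℤ)) true true
  | some (Sum.inr (i, j)) => (gadP j).place (gx n i) (gy n i) (ga n i) (gb n i)

/-- The placement of the body. -/
abbrev btau (n : ℕ) : ℤ × ℤ → ℤ × ℤ :=
  tau (20 * (((n + 1) / 2 : ℕ) : ℤ) + 4) (-20 * (((n + 2) / 2 : ℕ) : ℤ)) true true

theorem mem_bod {n : ℕ} {j : Fin 16} {p : ℤ × ℤ} (hp : p ∈ (fam n (vb j)).toSet) :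
    ∃ r ∈ bodL j.castSucc, btau n r = p := mem_place.1 hp

theorem mem_gad {n : ℕ} {i : Fin (n + 2)} {j : Fin 17} {p : ℤ × ℤ}
    (hp : p ∈ (fam n (vg i j)).toSet) :
    ∃ r ∈ gadL j, tau (gx n i) (gy n i) (ga n i) (gb n i) r = p := mem_place.1 hp

theorem bod_region {n : ℕ} {x y : ℤ} {p : ℤ × ℤ} (h : btau n (x, y) = p) :
    p.1 = 20 * (((n + 1) / 2 : ℕ) : ℤ) + 1 + x ∧ p.2 = -20 * (((n + 2) / 2 : ℕ) : ℤ) - 4 + y := by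
  subst h
  simp only [btau, tau, if_true]
  omega

theorem gad_region {n i : ℕ} {x y : ℤ} {p : ℤ × ℤ}
    (h : tau (gx n i) (gy n i) (ga n i) (gb n i) (x, y) = p) :
    (i = n + 1 ∧ p.1 = 20 * (((n + 1) / 2 : ℕ) : ℤ) + 9 + 3 - x ∧ p.2 = 4 - y) ∨
    (i ≠ n + 1 ∧ i = 0 ∧ p.1 = x - 3 ∧ p.2 = 4 - y) ∨
    (i ≠ n + 1 ∧ i % 2 = 1 ∧ p.1 = 20 * ((i / 2 : ℕ) : ℤ) + (x - 3) ∧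
      p.2 = -20 * ((i / 2 : ℕ) : ℤ) - 20 + (y - 4)) ∨
    (i ≠ n + 1 ∧ i ≠ 0 ∧ i % 2 = 0 ∧ p.1 = 20 * ((i / 2 : ℕ) : ℤ) + (3 - x) ∧
      p.2 = -20 * ((i / 2 : ℕ) : ℤ) + (4 - y)) := by
  subst h
  unfold gx gy ga gb tau xx
  by_cases h1 : i = n + 1
  · left
    simp [h1]
    omega
  · right
    by_cases h2 : i = 0
    · left; subst h2; simp [h1]
    · right
      by_cases h3 : i % 2 = 1
      · left; simp [h1, h3]; omega
      · right; simp [h1, h2, h3]; omega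

theorem v_bod {n : ℕ} {x y : ℤ} {p : ℤ × ℤ} (hv : p ∈ (vP n).toSet) (h : btau n (x, y) = p)
    (hbox : -4 ≤ x ∧ x ≤ 8 ∧ -4 ≤ y ∧ y ≤ 4 ∧ (y = 4 → -1 ≤ x) ∧ (x = 8 → y ≤ 1)) :
    (x = -1 ∧ y = 4) ∨ (x = 8 ∧ y = 1) := by
  have h1 := bod_region h
  rcases vP_cases hv with h2 | h2 | ⟨m, h2⟩ | ⟨m, h2⟩ <;> omega

theorem v_gad {n i : ℕ} (hi : i < n + 2) {x y : ℤ} {p : ℤ × ℤ} (hv : p ∈ (vP n).toSet)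
    (h : tau (gx n i) (gy n i) (ga n i) (gb n i) (x, y) = p)
    (hbox : -4 ≤ x ∧ x ≤ 4 ∧ -4 ≤ y ∧ y ≤ 4 ∧ (y = 4 → x ≤ 3)) :
    x = 3 ∧ y = 4 := by
  rcases gad_region h with h1 | h1 | h1 | h1 <;>
  rcases vP_cases hv with h2 | h2 | ⟨m, h2⟩ | ⟨m, h2⟩ <;> omega

theorem bod_gad {n i : ℕ} (hi : i < n + 2) {x y x' y' : ℤ} {p : ℤ × ℤ}
    (h : tau (gx n i) (gy n i) (ga n i) (gb n i) (x, y) = p)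
    (hbox : -4 ≤ x ∧ x ≤ 4 ∧ -4 ≤ y ∧ y ≤ 4 ∧ (y = 4 → x ≤ 3))
    (h' : btau n (x', y') = p)
    (hbox' : -4 ≤ x' ∧ x' ≤ 8 ∧ -4 ≤ y' ∧ y' ≤ 4 ∧ (y' = 4 → -1 ≤ x') ∧ (x' = 8 → y' ≤ 1)) :
    False := by
  have h2 := bod_region h'
  rcases gad_region h with h1 | h1 | h1 | h1 <;> omega

theorem gad_gad {n i i' : ℕ} (hi : i < n + 2) (hi' : i' < n + 2) (hne : i ≠ i') {x y x' y' : ℤ}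
    {p : ℤ × ℤ}
    (h : tau (gx n i) (gy n i) (ga n i) (gb n i) (x, y) = p)
    (hbox : -4 ≤ x ∧ x ≤ 4 ∧ -4 ≤ y ∧ y ≤ 4 ∧ (y = 4 → x ≤ 3))
    (h' : tau (gx n i') (gy n i') (ga n i') (gb n i') (x', y') = p)
    (hbox' : -4 ≤ x' ∧ x' ≤ 4 ∧ -4 ≤ y' ∧ y' ≤ 4 ∧ (y' = 4 → x' ≤ 3)) :
    False := by
  rcases gad_region h with h1 | h1 | h1 | h1 <;>
  rcases gad_region h' with h2 | h2 | h2 | h2 <;> omega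

theorem bg_disj {n : ℕ} (j : Fin 16) (i : Fin (n + 2)) (j' : Fin 17) (p : ℤ × ℤ)
    (h1 : p ∈ (fam n (vb j)).toSet) (h2 : p ∈ (fam n (vg i j')).toSet) : False := by
  obtain ⟨r, hr, e⟩ := mem_bod h1
  obtain ⟨r', hr', e'⟩ := mem_gad h2
  exact bod_gad i.isLt e' (gad_box _ _ hr') e (bod_box _ _ hr)

theorem gg_disj {n : ℕ} (i : Fin (n + 2)) (j : Fin 17) (i' : Fin (n + 2)) (j' : Fin 17)
    (hne : i ≠ i') (p : ℤ × ℤ)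
    (h1 : p ∈ (fam n (vg i j)).toSet) (h2 : p ∈ (fam n (vg i' j')).toSet) : False := by
  obtain ⟨r, hr, e⟩ := mem_gad h1
  obtain ⟨r', hr', e'⟩ := mem_gad h2
  exact gad_gad i.isLt i'.isLt (fun h => hne (Fin.ext h)) e (gad_box _ _ hr) e' (gad_box _ _ hr')

theorem vg_contact {n : ℕ} (i : Fin (n + 2)) (j : Fin 17) (p : ℤ × ℤ)
    (h1 : p ∈ (fam n none).toSet) (h2 : p ∈ (fam n (vg i j)).toSet) :
    p = tau (gx n i) (gy n i) (ga n i) (gb n i) (3, 4) ∧ (3, 4) ∈ gadL j := by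
  obtain ⟨⟨x, y⟩, hr, e⟩ := mem_gad h2
  obtain ⟨rfl, rfl⟩ := v_gad i.isLt h1 e (gad_box _ _ hr)
  exact ⟨e.symm, hr⟩

theorem vb_contact {n : ℕ} (j : Fin 16) (p : ℤ × ℤ)
    (h1 : p ∈ (fam n none).toSet) (h2 : p ∈ (fam n (vb j)).toSet) :
    (p = btau n (-1, 4) ∧ (-1, 4) ∈ bodL j.castSucc) ∨
    (p = btau n (8, 1) ∧ (8, 1) ∈ bodL j.castSucc) := by
  obtain ⟨⟨x, y⟩, hr, e⟩ := mem_bod h2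
  rcases v_bod h1 e (bod_box _ _ hr) with ⟨rfl, rfl⟩ | ⟨rfl, rfl⟩
  · exact Or.inl ⟨e.symm, hr⟩
  · exact Or.inr ⟨e.symm, hr⟩

theorem btau_last (n : ℕ) : btau n (-1, 4) = (vP n).last := by
  rw [vP_last]
  simp [btau, tau]

theorem btau_first (n : ℕ) : btau n (8, 1) = (vP n).first := by
  rw [vP_first]
  simp only [btau, tau, xx, mm, if_true, Prod.mk.injEq]
  push_cast
  omega

theorem gad_anchor (n i : ℕ) (hi : i < n + 2) :
    tau (gx n i) (gy n i) (ga n i) (gb n i) (3, 4) ∈ (vP n).toSet := by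
  rw [mem_vP]
  have e : tau (gx n i) (gy n i) (ga n i) (gb n i) (3, 4) = (gx n i, gy n i) := by
    unfold tau; simp
  rw [e]
  have hx : 9 ≤ xx n := by unfold xx; omega
  by_cases h : i = n + 1
  · refine ⟨mm n, by unfold tt; omega, ?_⟩
    unfold vpt gx gy
    rw [if_neg (by omega), if_pos (by omega), if_pos h, if_pos h]
    simp
  · refine ⟨mm n + xx n + 20 * i, by unfold tt; omega, ?_⟩
    unfold vpt gx gy
    rw [if_neg (by omega), if_neg (by omega), if_neg h, if_neg h]
    split_ifs <;> simp only [Prod.mk.injEq] <;> omega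

theorem fam_compat (n : ℕ) : ∀ u w : Vx (n + 2), u ≠ w → Compat (fam n u) (fam n w) := by
  have hvb : ∀ j : Fin 16, Compat (fam n none) (fam n (vb j)) := by
    intro j p h1 h2
    rcases vb_contact j p h1 h2 with ⟨rfl, hm⟩ | ⟨rfl, hm⟩
    · refine ⟨Or.inl (Or.inr (btau_last n)), ?_⟩
      intro q h3 h4
      rcases vb_contact j q h3 h4 with ⟨rfl, hm'⟩ | ⟨rfl, hm'⟩
      · rfl
      · exact absurd ⟨hm, hm'⟩ (bod_corner j)
    · refine ⟨Or.inl (Or.inl (btau_first n)), ?_⟩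
      intro q h3 h4
      rcases vb_contact j q h3 h4 with ⟨rfl, hm'⟩ | ⟨rfl, hm'⟩
      · exact absurd ⟨hm', hm⟩ (bod_corner j)
      · rfl
  have hvg : ∀ i j, Compat (fam n none) (fam n (vg i j)) := by
    intro i j p h1 h2
    obtain ⟨rfl, hm⟩ := vg_contact i j p h1 h2
    refine ⟨Or.inr ?_, ?_⟩
    · exact place_endpoint (LEnd.isEndpoint (P := gadP j) (gad_corner j hm).1)
    · intro q h3 h4
      exact (vg_contact i j q h3 h4).1.symm
  intro u w hne
  rcases u with _ | j | ⟨i, j⟩ <;> rcases w with _ | j' | ⟨i', j'⟩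
  · exact absurd rfl hne
  · exact hvb j'
  · exact hvg i' j'
  · exact (hvb j).symm
  · refine Compat.place ?_ _ _ _ _
    exact LCompat.compat (bod_compat j j' (by rintro rfl; exact hne rfl))
  · exact Compat.of_disjoint (fun p h1 h2 => bg_disj j i' j' p h1 h2)
  · exact (hvg i j).symm
  · exact Compat.of_disjoint (fun p h1 h2 => bg_disj j' i j p h2 h1)
  · by_cases h : i = i'
    · subst h
      refine Compat.place ?_ _ _ _ _
      exact LCompat.compat (gad_compat j j' (by rintro rfl; exact hne rfl))
    · exact Compat.of_disjoint (fun p h1 h2 => gg_disj i j i' j' h p h1 h2)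

theorem fam_bends (n : ℕ) (u : Vx (n + 2)) : (fam n u).BendsAtMost (n + 2) := by
  rcases u with _ | j | ⟨i, j⟩
  · exact vP_bends n
  · exact place_bends ((bod_ok j).2.2.2.trans (by omega)) _ _ _ _
  · exact place_bends ((gad_ok j).2.2.2.trans (by omega)) _ _ _ _

theorem fam_bodv (n : ℕ) (j : Fin 17) (p : ℤ × ℤ) (hp : p ∈ bodL j) :
    btau n p ∈ (fam n (vbv j)).toSet := by
  by_cases h : j.val < 16
  · have e : (vbv j : Vx (n + 2)) = vb ⟨j.val, h⟩ := by simp [vbv, h]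
    rw [e]
    exact mem_place.2 ⟨p, hp, rfl⟩
  · have hj : j = 16 := by ext; simp; omega
    subst hj
    have e : (vbv 16 : Vx (n + 2)) = none := by simp [vbv]
    rw [e]
    have : p = (-1, 4) ∨ p = (8, 1) := by
      have : bodL 16 = [(-1, 4), (8, 1)] := by decide
      rw [this] at hp
      simpa using hp
    rcases this with rfl | rfl
    · rw [btau_last]; exact (vP n).last_mem
    · rw [btau_first]; exact (vP n).first_mem

theorem separation (n : ℕ) : IsBkCPG (contactGraph (fam n)) (n + 2) ∧
    ¬ IsBkCPG (contactGraph (fam n)) (n + 1) := by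
  refine ⟨⟨contactRep (fam n) (fam_compat n), fam_bends n⟩, ?_⟩
  have gadT : ∀ i j j', (∃ p ∈ gadL j, p ∈ gadL j') → Touch (fam n (vg i j)) (fam n (vg i j')) := by
    rintro i j j' ⟨p, h1, h2⟩
    exact Touch.place (P := gadP j) (Q := gadP j') ⟨p, h1, h2⟩ _ _ _ _
  have hv : ∀ i j, (3, 4) ∈ gadL j → (contactGraph (fam n)).Adj none (vg i j) := by
    intro i j h
    refine ⟨by simp [vg], _, gad_anchor n i i.isLt, mem_place.2 ⟨(3, 4), h, rfl⟩⟩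
  refine lower_bound (N := n + 2) (by omega) _ (edges bodL) (edges gadL) edges_bod.ge edges_gad.ge
    ?_ ?_ ?_ ?_ ?_ ?_ ?_ ?_ ?_
  · rintro ⟨j, j'⟩ he
    obtain ⟨-, hne, p, h1, h2⟩ := Finset.mem_filter.1 he
    refine ⟨hne, ?_, btau n p, fam_bodv n _ _ h1, fam_bodv n _ _ h2⟩
    intro h'
    unfold vbv vb at h'
    simp only at h' hne
    split_ifs at h' <;> simp at h' <;> omega
  · rintro ⟨j, j'⟩ he
    obtain ⟨-, hne, h⟩ := Finset.mem_filter.1 he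
    refine ⟨hne, fun i => ⟨?_, gadT i _ _ h⟩⟩
    intro h'
    simp [vg] at h'
    exact hne h'
  · intro j hj
    obtain ⟨j', hlt, p, h1, h2⟩ := bod_conn j hj
    refine ⟨j', hlt, ?_, Touch.place (P := bodP j) (Q := bodP j') ⟨p, h1, h2⟩ _ _ _ _⟩
    simp [vb, hlt.ne']
  · intro i j hj
    obtain ⟨j', hlt, h15, h⟩ := gad_conn j hj
    refine ⟨j', hlt, h15, ?_, gadT _ _ _ h⟩
    simp [vg, hlt.ne']
  · rintro i j h15 h16 ⟨-, p, h1, h2⟩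
    rcases (gad_corner j (vg_contact i j p h1 h2).2).2 with h | h
    · exact h15 h
    · exact h16 h
  · intro i; exact hv i 15 (by decide)
  · intro i; exact hv i 16 (by decide)
  · rintro j i j' ⟨-, p, h1, h2⟩
    exact bg_disj j i j' p h1 h2
  · rintro i j i' j' hne ⟨-, p, h1, h2⟩
    exact gg_disj i j i' j' hne p h1 h2

/-! ## The case `k = 0` -/

/-- Orientation of coordinates. -/
def ori (β : Bool) (y x : ℤ) : ℤ × ℤ := if β then (x, y) else (y, x)

theorem ori_inj {β : Bool} {y x y' x' : ℤ} (h : ori β y x = ori β y' x') : y = y' ∧ x = x' := by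
  cases β <;> simp [ori] at h <;> omega

/-- `P` is the straight segment from `l` to `r`. -/
def Seg (β : Bool) (P : GridPath) (y l r : ℤ) : Prop :=
  l < r ∧ (∀ p ∈ P.toSet, ∃ x, l ≤ x ∧ x ≤ r ∧ p = ori β y x) ∧
    ∀ x, l ≤ x → x < r → ConsecIn P.pts (ori β y x) (ori β y (x + 1))

theorem consec_getElem (l : List (ℤ × ℤ)) (i : ℕ) (h : i + 1 < l.length) :
    [l[i], l[i + 1]] <:+: l := by
  refine ⟨l.take i, l.drop (i + 2), ?_⟩
  conv_rhs => rw [← List.take_append_drop i l, List.drop_eq_getElem_cons (by omega),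
    List.drop_eq_getElem_cons h]
  simp

theorem triple_getElem (l : List (ℤ × ℤ)) (i : ℕ) (h : i + 2 < l.length) :
    [l[i], l[i + 1], l[i + 2]] <:+: l := by
  refine ⟨l.take i, l.drop (i + 3), ?_⟩
  conv_rhs => rw [← List.take_append_drop i l, List.drop_eq_getElem_cons (by omega),
    List.drop_eq_getElem_cons (by omega), List.drop_eq_getElem_cons h]
  simp

theorem seg_up (β : Bool) (P : GridPath) (y x₀ : ℤ)
    (h : ∀ i : ℕ, ∀ hi : i < P.pts.length, P.pts[i] = ori β y (x₀ + i)) :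
    ∃ l r, Seg β P y l r := by
  have h2 := P.two_le_length
  refine ⟨x₀, x₀ + (P.pts.length - 1 : ℕ), by omega, ?_, ?_⟩
  · intro p hp
    obtain ⟨i, hi, rfl⟩ := List.getElem_of_mem (show p ∈ P.pts from hp)
    exact ⟨x₀ + i, by omega, by omega, h i hi⟩
  · intro x h3 h4
    obtain ⟨i, rfl⟩ : ∃ i : ℕ, x = x₀ + i := ⟨(x - x₀).toNat, by omega⟩
    have := consec_getElem P.pts i (by omega)
    rw [h, h] at this
    left
    convert this using 4
    push_cast; ring

theorem seg_down (β : Bool) (P : GridPath) (y x₀ : ℤ)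
    (h : ∀ i : ℕ, ∀ hi : i < P.pts.length, P.pts[i] = ori β y (x₀ - i)) :
    ∃ l r, Seg β P y l r := by
  have h2 := P.two_le_length
  refine ⟨x₀ - (P.pts.length - 1 : ℕ), x₀, by omega, ?_, ?_⟩
  · intro p hp
    obtain ⟨i, hi, rfl⟩ := List.getElem_of_mem (show p ∈ P.pts from hp)
    exact ⟨x₀ - i, by omega, by omega, h i hi⟩
  · intro x h3 h4
    obtain ⟨i, rfl⟩ : ∃ i : ℕ, x = x₀ - (i + 1) := ⟨(x₀ - x - 1).toNat, by omega⟩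
    have := consec_getElem P.pts i (by omega)
    rw [h, h] at this
    right
    convert this using 3
    · ring
    · push_cast; ring

theorem straight_seg (P : GridPath) (h : P.BendsAtMost 0) : ∃ β y l r, Seg β P y l r := by
  have h0 : P.bendSet = ∅ := by
    have : P.bendSet.ncard = 0 := Nat.le_zero.1 h
    exact (Set.ncard_eq_zero (bendSet_finite P)).1 this
  have h2 := P.two_le_length
  have hstep : ∀ i (hi : i + 1 < P.pts.length), GridStep P.pts[i] P.pts[i + 1] := by
    intro i hi
    exact P.consec_step (Or.inl (consec_getElem P.pts i hi))
  have hdiff : ∀ i (hi : i + 1 < P.pts.length),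
      (P.pts[i + 1]).1 - (P.pts[i]).1 = (P.pts[1]).1 - (P.pts[0]).1 ∧
      (P.pts[i + 1]).2 - (P.pts[i]).2 = (P.pts[1]).2 - (P.pts[0]).2 := by
    intro i
    induction i with
    | zero => intro hi; exact ⟨rfl, rfl⟩
    | succ i ih =>
      intro hi
      have h3 := ih (by omega)
      have s1 := hstep i (by omega)
      have s2 := hstep (i + 1) hi
      have hne : P.pts[i] ≠ P.pts[i + 2] := by
        intro he
        have := (P.nodup.getElem_inj_iff).1 he
        omega
      have hnb : ¬ ((P.pts[i]).1 ≠ (P.pts[i + 2]).1 ∧ (P.pts[i]).2 ≠ (P.pts[i + 2]).2) := by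
        intro hb
        have : P.pts[i + 1] ∈ P.bendSet := ⟨_, _, triple_getElem P.pts i hi, hb⟩
        rw [h0] at this
        exact this
      rw [ne_eq, Prod.ext_iff] at hne
      unfold GridStep at s1 s2
      simp only [show i + 1 + 1 = i + 2 from rfl] at *
      omega
  have hs := hstep 0 (by omega)
  unfold GridStep at hs
  simp only [zero_add] at hs
  have hcases : ((P.pts[1]).1 - (P.pts[0]).1 = 1 ∧ (P.pts[1]).2 - (P.pts[0]).2 = 0) ∨
      ((P.pts[1]).1 - (P.pts[0]).1 = -1 ∧ (P.pts[1]).2 - (P.pts[0]).2 = 0) ∨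
      ((P.pts[1]).1 - (P.pts[0]).1 = 0 ∧ (P.pts[1]).2 - (P.pts[0]).2 = 1) ∨
      ((P.pts[1]).1 - (P.pts[0]).1 = 0 ∧ (P.pts[1]).2 - (P.pts[0]).2 = -1) := by
    omega
  have gen : ∀ dx dy : ℤ, (P.pts[1]).1 - (P.pts[0]).1 = dx → (P.pts[1]).2 - (P.pts[0]).2 = dy →
      ∀ i : ℕ, ∀ hi : i < P.pts.length,
        P.pts[i] = ((P.pts[0]).1 + i * dx, (P.pts[0]).2 + i * dy) := by
    intro dx dy hx hy i
    induction i with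
    | zero => intro _; simp
    | succ i ih =>
      intro hi
      have h3 := ih (by omega)
      have h4 := hdiff i hi
      rw [hx, hy, h3] at h4
      simp only at h4
      ext
      · push_cast; linarith [h4.1]
      · push_cast; linarith [h4.2]
  rcases hcases with ⟨hx, hy⟩ | ⟨hx, hy⟩ | ⟨hx, hy⟩ | ⟨hx, hy⟩
  · exact ⟨true, (P.pts[0]).2, seg_up true P _ (P.pts[0]).1 (fun i hi => by
      rw [gen _ _ hx hy i hi]; simp [ori])⟩
  · exact ⟨true, (P.pts[0]).2, seg_down true P _ (P.pts[0]).1 (fun i hi => by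
      rw [gen _ _ hx hy i hi]; simp [ori]; ring)⟩
  · exact ⟨false, (P.pts[0]).1, seg_up false P _ (P.pts[0]).2 (fun i hi => by
      rw [gen _ _ hx hy i hi]; simp [ori])⟩
  · exact ⟨false, (P.pts[0]).1, seg_down false P _ (P.pts[0]).2 (fun i hi => by
      rw [gen _ _ hx hy i hi]; simp [ori]; ring)⟩

theorem seg_pair {β : Bool} {P Q : GridPath} {y l r y' l' r' : ℤ} (hP : Seg β P y l r)
    (hQ : Seg β Q y' l' r') (ht : Touch P Q)
    (hns : ∀ p q, ConsecIn P.pts p q → ¬ ConsecIn Q.pts p q) : r = l' ∨ r' = l := by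
  obtain ⟨p, h1, h2⟩ := ht
  obtain ⟨x, hx1, hx2, e⟩ := hP.2.1 p h1
  obtain ⟨x', hx1', hx2', e'⟩ := hQ.2.1 p h2
  obtain ⟨rfl, rfl⟩ := ori_inj (e.symm.trans e')
  by_contra hcon
  have a := hP.1
  have b := hQ.1
  exact hns _ _ (hP.2.2 (max l l') (by omega) (by omega)) (hQ.2.2 (max l l') (by omega) (by omega))

/-- Five pairwise touching paths. -/
def k5L (j : Fin 5) : List (ℤ × ℤ) :=
  [[(0,0),(0,1),(0,2)], [(0,0),(1,0),(2,0)], [(0,0),(-1,0),(-1,1),(-1,2)],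
   [(0,0),(0,-1),(1,-1),(2,-1)], [(-1,2),(0,2),(1,2),(2,2),(2,1),(2,0),(2,-1)]].getD j.val []

theorem k5_ok : ∀ j, ListOK (k5L j) ∧ (bendList (k5L j)).length ≤ 1 := by decide +kernel
theorem k5_compat : ∀ i j, i ≠ j → LCompat (k5L i) (k5L j) := by decide +kernel
theorem k5_touch : ∀ i j, ∃ p ∈ k5L i, p ∈ k5L j := by decide +kernel

/-- The five paths. -/
def k5P (j : Fin 5) : GridPath :=
  ⟨k5L j, (k5_ok j).1.1, (k5_ok j).1.2.1, (k5_ok j).1.2.2.1⟩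

theorem separation_zero : IsBkCPG (contactGraph k5P) 1 ∧ ¬ IsBkCPG (contactGraph k5P) 0 := by
  refine ⟨⟨contactRep k5P (fun u w h => LCompat.compat (k5_compat u w h)),
    fun u => bendsAtMost_of_list _ (k5_ok u).2⟩, ?_⟩
  rintro ⟨R, hR⟩
  have hseg : ∀ u, ∃ β y l r, Seg β (R.path u) y l r := fun u => straight_seg _ (hR u)
  choose β y l r hs using hseg
  have pig : ∀ c : Fin 5 → Bool, ∃ i j k, i ≠ j ∧ j ≠ k ∧ i ≠ k ∧ c i = c j ∧ c i = c k := by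
    decide +kernel
  obtain ⟨i, j, k, h1, h2, h3, h4, h5⟩ := pig β
  have ht : ∀ u w, u ≠ w → Touch (R.path u) (R.path w) := fun u w h =>
    (R.adj_iff u w h).1 ⟨h, k5_touch u w⟩
  have pair : ∀ u w, u ≠ w → β u = β w → r u = l w ∨ r w = l u := by
    intro u w h hb
    have hw := hs w
    rw [← hb] at hw
    exact seg_pair (hs u) hw (ht u w h) (R.no_shared_segment u w h)
  have p1 := pair i j h1 h4
  have p2 := pair i k h3 h5
  have p3 := pair j k h2 (h4.symm.trans h5)
  have q1 := (hs i).1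
  have q2 := (hs j).1
  have q3 := (hs k).1
  omega

/-- For every `k ≥ 0`, the class of `B_k`-CPG graphs is strictly contained in the class of
`B_{k+1}`-CPG graphs: every `B_k`-CPG graph is `B_{k+1}`-CPG, and some (finite) graph is
`B_{k+1}`-CPG but not `B_k`-CPG. -/
theorem Bk_CPG_strictly_contained_in_Bsucck_CPG (k : ℕ) :
    (∀ (V : Type) [Fintype V] (G : SimpleGraph V), IsBkCPG G k → IsBkCPG G (k + 1)) ∧
      ∃ (V : Type) (_ : Fintype V) (G : SimpleGraph V),
        IsBkCPG G (k + 1) ∧ ¬ IsBkCPG G k := by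
  refine ⟨fun V _ G h => ?_, ?_⟩
  · obtain ⟨R, hR⟩ := h
    exact ⟨R, fun u => Nat.le_succ_of_le (hR u)⟩
  · cases k with
    | zero => exact ⟨Fin 5, inferInstance, contactGraph k5P, separation_zero⟩
    | succ n => exact ⟨Vx (n + 2), inferInstance, contactGraph (fam n), separation n⟩
end

section
/- There exists a constant C > 0 such that every CPG graph on n vertices admits a CPG representation in which all paths are contained in an axis-parallel rectangle of the grid of area at most C·n². -/
namespace CPGArea

/-- `x` lies in the half-open interval between `a` and `b`. -/
def Btw (a b x : ℤ) : Prop := (a < x ∧ x ≤ b) ∨ (b < x ∧ x ≤ a)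

/-- The block permutation of `ℤ` reversing the order of the three blocks
`(p1,p2]`, `(p2,p3]`, `(p3,p4]`. -/
def rho (p1 p2 p3 p4 x : ℤ) : ℤ :=
  if x ≤ p1 then x else if x ≤ p2 then x + (p4 - p2)
  else if x ≤ p3 then x - p2 + p1 + p4 - p3
  else if x ≤ p4 then x - (p3 - p1) else x

section rho
variable {p1 p2 p3 p4 : ℤ}

theorem rho_cases (h1 : p1 < p2) (h2 : p2 < p3) (h3 : p3 < p4) (x : ℤ) :
    (x ≤ p1 ∧ rho p1 p2 p3 p4 x = x) ∨
    (p1 < x ∧ x ≤ p2 ∧ rho p1 p2 p3 p4 x = x + (p4 - p2)) ∨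
    (p2 < x ∧ x ≤ p3 ∧ rho p1 p2 p3 p4 x = x - p2 + p1 + p4 - p3) ∨
    (p3 < x ∧ x ≤ p4 ∧ rho p1 p2 p3 p4 x = x - (p3 - p1)) ∨
    (p4 < x ∧ rho p1 p2 p3 p4 x = x) := by
  unfold rho
  split_ifs <;> omega

theorem rho_inj (h1 : p1 < p2) (h2 : p2 < p3) (h3 : p3 < p4) {x y : ℤ}
    (h : rho p1 p2 p3 p4 x = rho p1 p2 p3 p4 y) : x = y := by
  rcases rho_cases h1 h2 h3 x with hx | hx | hx | hx | hx <;>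
  rcases rho_cases h1 h2 h3 y with hy | hy | hy | hy | hy <;> omega

/-- The index of the block containing `x`. -/
def blk (p1 p2 p3 p4 x : ℤ) : Fin 5 :=
  if x ≤ p1 then 0 else if x ≤ p2 then 1 else if x ≤ p3 then 2 else if x ≤ p4 then 3 else 4

/-- Whether the relative order of two blocks is changed. -/
def chg (i j : Fin 5) : Bool := (i ≠ j) && (i ≠ 0) && (i ≠ 4) && (j ≠ 0) && (j ≠ 4)

theorem rho_lt (h1 : p1 < p2) (h2 : p2 < p3) (h3 : p3 < p4) (a x : ℤ) :
    decide (rho p1 p2 p3 p4 a < rho p1 p2 p3 p4 x) =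
      (decide (a < x) ^^ chg (blk p1 p2 p3 p4 a) (blk p1 p2 p3 p4 x)) := by
  have key : (rho p1 p2 p3 p4 a < rho p1 p2 p3 p4 x) ↔
    ((decide (a < x) ^^ chg (blk p1 p2 p3 p4 a) (blk p1 p2 p3 p4 x)) = true) := by
    unfold rho blk
    split_ifs <;> simp [chg] <;> omega
  rw [Bool.eq_iff_iff, ← key, decide_eq_true_iff]

theorem btw_bool (a b x : ℤ) : Btw a b x ↔ (decide (a < x) ^^ decide (b < x)) = true := by
  unfold Btw
  by_cases h : a < x <;> by_cases h' : b < x <;> simp [h, h'] <;> omega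

theorem btw_blk (h1 : p1 < p2) (h2 : p2 < p3) (h3 : p3 < p4) (x : ℤ) :
    (Btw p1 p3 x ↔ (blk p1 p2 p3 p4 x = 1 ∨ blk p1 p2 p3 p4 x = 2)) ∧
    (Btw p2 p4 x ↔ (blk p1 p2 p3 p4 x = 2 ∨ blk p1 p2 p3 p4 x = 3)) := by
  unfold Btw blk
  split_ifs <;> simp <;> omega

theorem chg_sum : ∀ a b x y : Fin 5,
    (((a = 1 ∨ a = 2) ↔ (b = 1 ∨ b = 2)) ∧ ((x = 1 ∨ x = 2) ↔ (y = 1 ∨ y = 2))) ∨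
    (((a = 2 ∨ a = 3) ↔ (b = 2 ∨ b = 3)) ∧ ((x = 2 ∨ x = 3) ↔ (y = 2 ∨ y = 3))) →
    ((chg a x ^^ chg b x) = (chg a y ^^ chg b y)) := by
  decide

theorem bool_aux : ∀ a1 a2 a3 a4 c1 c2 c3 c4 : Bool, (c1 ^^ c2) = (c3 ^^ c4) →
    ((((a1 ^^ c1) ^^ (a2 ^^ c2)) = true ↔ ((a3 ^^ c3) ^^ (a4 ^^ c4)) = true) ↔
      ((a1 ^^ a2) = true ↔ (a3 ^^ a4) = true)) := by
  decide

/-- Separation by a chord `a b` not crossing `P Q` is unchanged for points on the same side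
of `P Q`. -/
theorem rho_sep (h1 : p1 < p2) (h2 : p2 < p3) (h3 : p3 < p4) {P Q a b x y : ℤ}
    (hPQ : (P = p1 ∧ Q = p3) ∨ (P = p2 ∧ Q = p4))
    (hab : Btw P Q a ↔ Btw P Q b)
    (hxy : Btw P Q x ↔ Btw P Q y) :
    (Btw (rho p1 p2 p3 p4 a) (rho p1 p2 p3 p4 b) (rho p1 p2 p3 p4 x) ↔
      Btw (rho p1 p2 p3 p4 a) (rho p1 p2 p3 p4 b) (rho p1 p2 p3 p4 y)) ↔
    (Btw a b x ↔ Btw a b y) := by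
  have hc : (chg (blk p1 p2 p3 p4 a) (blk p1 p2 p3 p4 x) ^^
      chg (blk p1 p2 p3 p4 b) (blk p1 p2 p3 p4 x)) =
      (chg (blk p1 p2 p3 p4 a) (blk p1 p2 p3 p4 y) ^^
      chg (blk p1 p2 p3 p4 b) (blk p1 p2 p3 p4 y)) := by
    apply chg_sum
    rcases hPQ with ⟨rfl, rfl⟩ | ⟨rfl, rfl⟩
    · left
      rw [(btw_blk h1 h2 h3 a).1, (btw_blk h1 h2 h3 b).1] at hab
      rw [(btw_blk h1 h2 h3 x).1, (btw_blk h1 h2 h3 y).1] at hxy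
      exact ⟨hab, hxy⟩
    · right
      rw [(btw_blk h1 h2 h3 a).2, (btw_blk h1 h2 h3 b).2] at hab
      rw [(btw_blk h1 h2 h3 x).2, (btw_blk h1 h2 h3 y).2] at hxy
      exact ⟨hab, hxy⟩
  simp only [btw_bool, rho_lt h1 h2 h3]
  exact bool_aux _ _ _ _ _ _ _ _ hc

/-- The new chord has the same sides as the old one. -/
theorem rho_side (h1 : p1 < p2) (h2 : p2 < p3) (h3 : p3 < p4) {x y : ℤ} :
    ((Btw (rho p1 p2 p3 p4 p2) (rho p1 p2 p3 p4 p4) (rho p1 p2 p3 p4 x) ↔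
      Btw (rho p1 p2 p3 p4 p2) (rho p1 p2 p3 p4 p4) (rho p1 p2 p3 p4 y)) ↔
    (Btw p1 p3 x ↔ Btw p1 p3 y)) ∧
    ((Btw (rho p1 p2 p3 p4 p1) (rho p1 p2 p3 p4 p3) (rho p1 p2 p3 p4 x) ↔
      Btw (rho p1 p2 p3 p4 p1) (rho p1 p2 p3 p4 p3) (rho p1 p2 p3 p4 y)) ↔
    (Btw p2 p4 x ↔ Btw p2 p4 y)) := by
  unfold Btw at *
  have e1 : rho p1 p2 p3 p4 p1 = p1 := by unfold rho; split_ifs <;> omega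
  have e2 : rho p1 p2 p3 p4 p2 = p4 := by unfold rho; split_ifs <;> omega
  have e3 : rho p1 p2 p3 p4 p3 = p1 + p4 - p2 := by unfold rho; split_ifs <;> omega
  have e4 : rho p1 p2 p3 p4 p4 = p4 - (p3 - p1) := by unfold rho; split_ifs <;> omega
  rw [e1, e2, e3, e4]
  rcases rho_cases h1 h2 h3 x with hx | hx | hx | hx | hx <;>
  rcases rho_cases h1 h2 h3 y with hy | hy | hy | hy | hy <;> constructor <;> omega

end rho

theorem btw_comm (a b x : ℤ) : Btw a b x ↔ Btw b a x := by
  unfold Btw; omega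

theorem nc_symm {a b c d : ℤ} (h1 : a ≠ c) (h2 : a ≠ d) (h3 : b ≠ c) (h4 : b ≠ d)
    (h : Btw a b c ↔ Btw a b d) : (Btw c d a ↔ Btw c d b) := by
  unfold Btw at *; omega

/-- The exchange permutation for a pair of crossing chords. -/
theorem exists_rho {e0 e1 f0 f1 : ℤ} (hef : e0 ≠ f0) (hef' : e0 ≠ f1) (hef2 : e1 ≠ f0)
    (hef3 : e1 ≠ f1) (hx : ¬ (Btw f0 f1 e0 ↔ Btw f0 f1 e1)) :
    ∃ r : ℤ → ℤ, Function.Injective r ∧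
      (∀ a b x y, (Btw f0 f1 a ↔ Btw f0 f1 b) → (Btw f0 f1 x ↔ Btw f0 f1 y) →
        ((Btw (r a) (r b) (r x) ↔ Btw (r a) (r b) (r y)) ↔ (Btw a b x ↔ Btw a b y))) ∧
      (∀ a b x y, (Btw e0 e1 a ↔ Btw e0 e1 b) → (Btw e0 e1 x ↔ Btw e0 e1 y) →
        ((Btw (r a) (r b) (r x) ↔ Btw (r a) (r b) (r y)) ↔ (Btw a b x ↔ Btw a b y))) ∧
      (∀ x y, (Btw (r e0) (r e1) (r x) ↔ Btw (r e0) (r e1) (r y)) ↔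
        (Btw f0 f1 x ↔ Btw f0 f1 y)) ∧
      (∀ x y, (Btw (r f0) (r f1) (r x) ↔ Btw (r f0) (r f1) (r y)) ↔
        (Btw e0 e1 x ↔ Btw e0 e1 y)) := by
  wlog he : e0 < e1 generalizing e0 e1
  · have hne : e0 ≠ e1 := by rintro rfl; exact hx Iff.rfl
    obtain ⟨r, a1, a2, a3, a4, a5⟩ := this hef2 hef3 hef hef' (fun h => hx h.symm) (by omega)
    refine ⟨r, a1, a2, ?_, ?_, ?_⟩
    · intro a b x y; simpa only [btw_comm e0 e1] using a3 a b x y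
    · intro x y; simpa only [btw_comm (r e0) (r e1)] using a4 x y
    · intro x y; simpa only [btw_comm e0 e1] using a5 x y
  wlog hf : f0 < f1 generalizing f0 f1
  · have hne : f0 ≠ f1 := by
      rintro rfl
      apply hx; unfold Btw; omega
    obtain ⟨r, a1, a2, a3, a4, a5⟩ := this hef' hef hef3 hef2
      (by rw [btw_comm f1 f0, btw_comm f1 f0]; exact hx) (by omega)
    refine ⟨r, a1, ?_, a3, ?_, ?_⟩
    · intro a b x y; simpa only [btw_comm f0 f1] using a2 a b x y
    · intro x y; simpa only [btw_comm f0 f1] using a4 x y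
    · intro x y; simpa only [btw_comm (r f0) (r f1)] using a5 x y
  have hc : (f0 < e0 ∧ e0 < f1 ∧ f1 < e1) ∨ (e0 < f0 ∧ f0 < e1 ∧ e1 < f1) := by
    unfold Btw at hx; omega
  rcases hc with ⟨h1, h2, h3⟩ | ⟨h1, h2, h3⟩
  · refine ⟨rho f0 e0 f1 e1, fun x y h => rho_inj h1 h2 h3 h, ?_, ?_, ?_, ?_⟩
    · intro a b x y; exact rho_sep h1 h2 h3 (Or.inl ⟨rfl, rfl⟩)
    · intro a b x y; exact rho_sep h1 h2 h3 (Or.inr ⟨rfl, rfl⟩)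
    · intro x y; exact (rho_side h1 h2 h3).1
    · intro x y; exact (rho_side h1 h2 h3).2
  · refine ⟨rho e0 f0 e1 f1, fun x y h => rho_inj h1 h2 h3 h, ?_, ?_, ?_, ?_⟩
    · intro a b x y; exact rho_sep h1 h2 h3 (Or.inr ⟨rfl, rfl⟩)
    · intro a b x y; exact rho_sep h1 h2 h3 (Or.inl ⟨rfl, rfl⟩)
    · intro x y; exact (rho_side h1 h2 h3).2
    · intro x y; exact (rho_side h1 h2 h3).1

/-! ### Tree encodings of plane graphs -/

/-- A contour-word encoding of a plane (multi)graph with edge set `S`, darts `(e, i)` labelled by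
vertices, spanning tree `T`, and contour positions `pos`. -/
structure Enc {E W : Type*} (S : E → Prop) (lab : E → Bool → W) (T : E → Prop)
    (pos : E → Bool → ℤ) : Prop where
  inj : ∀ e f i j, S e → S f → pos e i = pos f j → e = f ∧ i = j
  nc : ∀ e f, S e → S f → e ≠ f → (T e ↔ T f) →
    (Btw (pos e false) (pos e true) (pos f false) ↔ Btw (pos e false) (pos e true) (pos f true))
  lab_iff : ∀ e f i j, S e → S f → (lab e i = lab f j ↔ ∀ t, S t → T t →
    (Btw (pos t false) (pos t true) (pos e i) ↔ Btw (pos t false) (pos t true) (pos f j)))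

section Enc
variable {E W : Type*} {S : E → Prop} {lab : E → Bool → W} {T : E → Prop} {pos : E → Bool → ℤ}

theorem Enc.tree_ne (h : Enc S lab T pos) {e : E} (he : S e) (ht : T e) :
    lab e false ≠ lab e true := by
  intro hl
  have h1 := (h.lab_iff e e false true he he).1 hl e he ht
  have h2 : pos e false ≠ pos e true := by
    intro h3
    have := (h.inj e e false true he he h3).2
    simp at this
  unfold Btw at h1
  omega

theorem Enc.exchange (h : Enc S lab T pos) {e f : E} (he : S e) (hf : S f) (hte : ¬ T e)
    (htf : T f) (hx : ¬ (Btw (pos f false) (pos f true) (pos e false) ↔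
      Btw (pos f false) (pos f true) (pos e true))) :
    ∃ T' pos', Enc S lab T' pos' ∧ T' e := by
  have hne : e ≠ f := by rintro rfl; exact hte htf
  have hd : ∀ {a b : E} (i j : Bool), S a → S b → a ≠ b → pos a i ≠ pos b j :=
    fun i j ha hb hab hp => hab (h.inj _ _ i j ha hb hp).1
  obtain ⟨r, rinj, rf, re, se, sf⟩ := exists_rho (hd false false he hf hne)
    (hd false true he hf hne) (hd true false he hf hne) (hd true true he hf hne) hx
  have tree_nc : ∀ g, S g → T g → g ≠ f → (Btw (pos f false) (pos f true) (pos g false) ↔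
      Btw (pos f false) (pos f true) (pos g true)) :=
    fun g hg tg hgf => h.nc f g hf hg (Ne.symm hgf) (by simp [htf, tg])
  have non_nc : ∀ g, S g → ¬ T g → g ≠ e → (Btw (pos e false) (pos e true) (pos g false) ↔
      Btw (pos e false) (pos e true) (pos g true)) :=
    fun g hg tg hgf => h.nc e g he hg (Ne.symm hgf) (by simp [hte, tg])
  have hnr : ∀ {a b : E} (i j : Bool), S a → S b → a ≠ b → r (pos a i) ≠ r (pos b j) :=
    fun i j ha hb hab hp => hd i j ha hb hab (rinj hp)
  refine ⟨fun g => g = e ∨ (T g ∧ g ≠ f), fun g i => r (pos g i), ⟨?_, ?_, ?_⟩, Or.inl rfl⟩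
  · intro a b i j ha hb hab
    exact h.inj a b i j ha hb (rinj hab)
  · intro a b ha hb hab hT
    by_cases hae : a = e
    · subst hae
      have tb : T b ∧ b ≠ f := by
        have := hT.1 (Or.inl rfl)
        rcases this with h1 | h1
        · exact absurd h1.symm hab
        · exact h1
      exact (se _ _).2 (tree_nc b hb tb.1 tb.2)
    by_cases hbe : b = e
    · subst hbe
      have ta : T a ∧ a ≠ f := by
        have := hT.2 (Or.inl rfl)
        rcases this with h1 | h1
        · exact absurd h1 hab
        · exact h1
      exact nc_symm (hnr _ _ hb ha hab.symm) (hnr _ _ hb ha hab.symm) (hnr _ _ hb ha hab.symm)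
        (hnr _ _ hb ha hab.symm) ((se _ _).2 (tree_nc a ha ta.1 ta.2))
    simp only [hae, hbe, false_or] at hT
    by_cases haf : a = f
    · subst haf
      have tb : ¬ T b := fun hb' => (hT.2 ⟨hb', fun h => hab h.symm⟩).2 rfl
      exact (sf _ _).2 (non_nc b hb tb hbe)
    by_cases hbf : b = f
    · subst hbf
      have ta : ¬ T a := fun ha' => (hT.1 ⟨ha', hab⟩).2 rfl
      exact nc_symm (hnr _ _ hb ha hab.symm) (hnr _ _ hb ha hab.symm) (hnr _ _ hb ha hab.symm)
        (hnr _ _ hb ha hab.symm) ((sf _ _).2 (non_nc a ha ta hae))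
    have hT' : T a ↔ T b := by simpa [haf, hbf] using hT
    have hnc := h.nc a b ha hb hab hT'
    by_cases ta : T a
    · exact (rf _ _ _ _ (tree_nc a ha ta haf) (tree_nc b hb (hT'.1 ta) hbf)).2 hnc
    · exact (re _ _ _ _ (non_nc a ha ta hae)
        (non_nc b hb (fun h => ta (hT'.2 h)) hbe)).2 hnc
  · intro a b i j ha hb
    rw [h.lab_iff a b i j ha hb]
    constructor
    · intro hs t hSt ht
      have hsf := hs f hf htf
      rcases ht with rfl | ⟨ht, htf'⟩
      · exact (se _ _).2 hsf
      · exact (rf _ _ _ _ (tree_nc t hSt ht htf') hsf).2 (hs t hSt ht)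
    · intro hs t hSt ht
      have hsf := (se _ _).1 (hs e he (Or.inl rfl))
      by_cases htf' : t = f
      · subst htf'; exact hsf
      · exact (rf _ _ _ _ (tree_nc t hSt ht htf') hsf).1 (hs t hSt (Or.inr ⟨ht, htf'⟩))

theorem contract_aux {a b c d x y : ℤ} (hab : a ≠ b) (h1 : a ≠ c) (h2 : a ≠ d) (h3 : b ≠ c)
    (h4 : b ≠ d) (hn : Btw a b c ↔ Btw a b d) (hx : Btw a b x) (hy : ¬ Btw a b y)
    (hxy : Btw c d x ↔ Btw c d y) : (Btw c d x ↔ Btw c d a) := by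
  unfold Btw at *
  omega

/-- Relabelling merging the two end vertices of `e`. -/
def merge [DecidableEq W] (u v w : W) : W := if w = u then v else w

theorem Enc.contract_tree [DecidableEq W] (h : Enc S lab T pos) {e : E} (he : S e) (hte : T e) :
    Enc (fun g => S g ∧ g ≠ e) (fun g i => merge (lab e false) (lab e true) (lab g i)) T pos := by
  have hd : ∀ {a b : E} (i j : Bool), S a → S b → a ≠ b → pos a i ≠ pos b j :=
    fun i j ha hb hab hp => hab (h.inj _ _ i j ha hb hp).1
  have hee : pos e false ≠ pos e true := by
    intro h3
    have := (h.inj e e false true he he h3).2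
    simp at this
  have huv := h.tree_ne he hte
  have key : ∀ t, S t → T t → t ≠ e → (Btw (pos t false) (pos t true) (pos e false) ↔
      Btw (pos t false) (pos t true) (pos e true)) :=
    fun t st tt hne => h.nc t e st he hne (by simp [tt, hte])
  have key2 : ∀ t, S t → T t → t ≠ e → (Btw (pos e false) (pos e true) (pos t false) ↔
      Btw (pos e false) (pos e true) (pos t true)) :=
    fun t st tt hne => h.nc e t he st hne.symm (by simp [tt, hte])
  refine ⟨fun a b i j ha hb => h.inj a b i j ha.1 hb.1,
    fun a b ha hb => h.nc a b ha.1 hb.1, ?_⟩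
  intro a b i j ha hb
  have hmerge : merge (lab e false) (lab e true) (lab a i) =
      merge (lab e false) (lab e true) (lab b j) ↔ (lab a i = lab b j ∨
      (lab a i = lab e false ∧ lab b j = lab e true) ∨
      (lab a i = lab e true ∧ lab b j = lab e false)) := by
    unfold merge
    split_ifs <;> grind
  rw [hmerge]
  constructor
  · rintro (h1 | ⟨h1, h2⟩ | ⟨h1, h2⟩) t st tt
    · exact (h.lab_iff a b i j ha.1 hb.1).1 h1 t st.1 tt
    · rw [(h.lab_iff a e i false ha.1 he).1 h1 t st.1 tt, (h.lab_iff b e j true hb.1 he).1 h2 t st.1 tt]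
      exact key t st.1 tt st.2
    · rw [(h.lab_iff a e i true ha.1 he).1 h1 t st.1 tt, (h.lab_iff b e j false hb.1 he).1 h2 t st.1 tt]
      exact (key t st.1 tt st.2).symm
  · intro hs
    have main : ∀ (a b : E) (i j : Bool), S a → S b →
        (∀ t, S t ∧ t ≠ e → T t → (Btw (pos t false) (pos t true) (pos a i) ↔
          Btw (pos t false) (pos t true) (pos b j))) →
        Btw (pos e false) (pos e true) (pos a i) → ¬ Btw (pos e false) (pos e true) (pos b j) →
        (lab a i = lab e false ∧ lab b j = lab e true) ∨
        (lab a i = lab e true ∧ lab b j = lab e false) := by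
      intro a b i j ha hb hs hA hB
      have hk : ∀ t, S t → T t → t ≠ e →
          ((Btw (pos t false) (pos t true) (pos a i) ↔
            Btw (pos t false) (pos t true) (pos e false)) ∧
           (Btw (pos t false) (pos t true) (pos b j) ↔
            Btw (pos t false) (pos t true) (pos e false))) := by
        intro t st tt hne
        have h1 := contract_aux hee (hd _ _ he st hne.symm) (hd _ _ he st hne.symm)
          (hd _ _ he st hne.symm) (hd _ _ he st hne.symm) (key2 t st tt hne) hA hB (hs t ⟨st, hne⟩ tt)
        exact ⟨h1, (hs t ⟨st, hne⟩ tt).symm.trans h1⟩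
      by_cases hlt : pos e false < pos e true
      · right
        rw [h.lab_iff a e i true ha he, h.lab_iff b e j false hb he]
        constructor
        · intro t st tt
          by_cases hte' : t = e
          · subst hte'
            unfold Btw at *; omega
          · rw [(hk t st tt hte').1]; exact key t st tt hte'
        · intro t st tt
          by_cases hte' : t = e
          · subst hte'
            unfold Btw at *; omega
          · exact (hk t st tt hte').2
      · left
        rw [h.lab_iff a e i false ha he, h.lab_iff b e j true hb he]
        constructor
        · intro t st tt
          by_cases hte' : t = e
          · subst hte'
            unfold Btw at *; omega
          · exact (hk t st tt hte').1
        · intro t st tt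
          by_cases hte' : t = e
          · subst hte'
            unfold Btw at *; omega
          · rw [(hk t st tt hte').2]; exact key t st tt hte'
    by_cases hA : Btw (pos e false) (pos e true) (pos a i) <;>
    by_cases hB : Btw (pos e false) (pos e true) (pos b j)
    · left
      rw [h.lab_iff a b i j ha.1 hb.1]
      intro t st tt
      by_cases hte' : t = e
      · subst hte'; simp [hA, hB]
      · exact hs t ⟨st, hte'⟩ tt
    · right; exact main a b i j ha.1 hb.1 hs hA hB
    · right
      have := main b a j i hb.1 ha.1 (fun t st tt => (hs t st tt).symm) hB hA
      tauto
    · left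
      rw [h.lab_iff a b i j ha.1 hb.1]
      intro t st tt
      by_cases hte' : t = e
      · subst hte'; simp [hA, hB]
      · exact hs t ⟨st, hte'⟩ tt

theorem Enc.contract [DecidableEq W] (h : Enc S lab T pos) {e : E} (he : S e) :
    ∃ T' pos', Enc (fun g => S g ∧ g ≠ e)
      (fun g i => merge (lab e false) (lab e true) (lab g i)) T' pos' := by
  by_cases hl : lab e false = lab e true
  · have hte : ¬ T e := fun ht => h.tree_ne he ht hl
    refine ⟨T, pos, fun a b i j ha hb => h.inj a b i j ha.1 hb.1,
      fun a b ha hb => h.nc a b ha.1 hb.1, ?_⟩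
    intro a b i j ha hb
    have : ∀ w, merge (lab e false) (lab e true) w = w := by
      intro w; unfold merge; split_ifs with hw
      · rw [hw, hl]
      · rfl
    rw [this, this, h.lab_iff a b i j ha.1 hb.1]
    constructor
    · intro hs t st tt; exact hs t st.1 tt
    · intro hs t st tt; exact hs t ⟨st, by rintro rfl; exact hte tt⟩ tt
  · by_cases hte : T e
    · exact ⟨T, pos, h.contract_tree he hte⟩
    · rw [h.lab_iff e e false true he he] at hl
      push Not at hl
      obtain ⟨f, sf, tf, hx⟩ := hl
      obtain ⟨T', pos', h', htree⟩ := h.exchange he sf hte tf (by tauto)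
      exact ⟨T', pos', h'.contract_tree he htree⟩

/-- Contract a whole list of edges. -/
theorem Enc.contract_list [DecidableEq W] {P : Type*} (pt : E → Bool → W) (phi : W → P)
    (F : List E) (hF : ∀ e ∈ F, S e) (hphi : ∀ e ∈ F, phi (pt e false) = phi (pt e true))
    (h : Enc S pt T pos) :
    ∃ (g : W → W) (T' : E → Prop) (pos' : E → Bool → ℤ),
      Enc (fun e => S e ∧ e ∉ F) (fun e i => g (pt e i)) T' pos' ∧
      (∀ e ∈ F, g (pt e false) = g (pt e true)) ∧ (∀ p q, g p = g q → phi p = phi q) := by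
  induction F with
  | nil =>
    refine ⟨id, T, pos, ?_, by simp, by simp⟩
    simpa using h
  | cons e F ih =>
    obtain ⟨g, T', pos', h', hg, hgp⟩ := ih (fun x hx => hF x (List.mem_cons_of_mem _ hx))
      (fun x hx => hphi x (List.mem_cons_of_mem _ hx))
    by_cases heF : e ∈ F
    · refine ⟨g, T', pos', ?_, ?_, hgp⟩
      · have : (fun x => S x ∧ x ∉ e :: F) = (fun x => S x ∧ x ∉ F) := by
          funext x; grind
        rw [this]; exact h'
      · intro x hx
        rcases List.mem_cons.1 hx with rfl | hx
        · exact hg _ heF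
        · exact hg _ hx
    · obtain ⟨T2, pos2, h2⟩ := h'.contract (e := e) ⟨hF e (by simp), heF⟩
      refine ⟨fun w => merge (g (pt e false)) (g (pt e true)) (g w), T2, pos2, ?_, ?_, ?_⟩
      · have : (fun x => S x ∧ x ∉ e :: F) = (fun x => (S x ∧ x ∉ F) ∧ x ≠ e) := by
          funext x; grind
        rw [this]; exact h2
      · intro x hx
        rcases List.mem_cons.1 hx with rfl | hx
        · simp [merge]
        · simp only [hg _ hx]
      · intro p q hpq
        have he := hphi e (by simp)
        simp only [merge] at hpq
        split_ifs at hpq with h1 h2 h2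
        · rw [hgp _ _ h1, hgp _ _ h2]
        · rw [hgp _ _ h1, he, hgp _ _ hpq]
        · rw [hgp _ _ h2, he, hgp _ _ hpq]
        · exact hgp _ _ hpq

/-- From an encoding to a diagram with a noncrossing matching and a noncrossing partition. -/
theorem Enc.slots (h : Enc S lab T pos) : ∃ slot : E → Bool → ℤ,
    (∀ e f i j, S e → S f → slot e i = slot f j → e = f ∧ i = j) ∧
    (∀ e f, S e → S f → e ≠ f → (Btw (slot e false) (slot e true) (slot f false) ↔
      Btw (slot e false) (slot e true) (slot f true))) ∧
    (∀ a b c d i j k l, S a → S b → S c → S d → slot a i < slot b j → slot b j < slot c k →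
      slot c k < slot d l → lab a i = lab c k → lab b j = lab d l → lab a i = lab b j) := by
  classical
  let lo : E → ℤ := fun e => min (pos e false) (pos e true)
  let slot : E → Bool → ℤ := fun e i =>
    if T e then (if pos e i = lo e then 3 * lo e - 1 else 3 * lo e + 1) else 3 * pos e i
  have hee : ∀ e, S e → pos e false ≠ pos e true := by
    intro e he h3
    have := (h.inj e e false true he he h3).2
    simp at this
  have hd : ∀ {a b : E} (i j : Bool), S a → S b → a ≠ b → pos a i ≠ pos b j :=
    fun i j ha hb hab hp => hab (h.inj _ _ i j ha hb hp).1
  -- description of slots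
  have hdesc : ∀ e, S e →
      (¬ T e ∧ slot e false = 3 * pos e false ∧ slot e true = 3 * pos e true) ∨
      (T e ∧ pos e false < pos e true ∧ slot e false = 3 * pos e false - 1 ∧
        slot e true = 3 * pos e false + 1) ∨
      (T e ∧ pos e true < pos e false ∧ slot e true = 3 * pos e true - 1 ∧
        slot e false = 3 * pos e true + 1) := by
    intro e he
    have := hee e he
    by_cases ht : T e
    · right
      simp only [slot, lo, ht, if_true, true_and]
      rcases lt_or_gt_of_ne this with h1 | h1
      · left
        rw [min_eq_left h1.le, if_neg h1.ne']; simp [h1]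
      · right
        rw [min_eq_right h1.le, if_neg h1.ne']; simp [h1]
    · left; simp [slot, ht]
  have hside : ∀ t, S t → T t → ∀ e, S e → ∀ i,
      (Btw (3 * pos t false) (3 * pos t true) (slot e i) ↔
        Btw (pos t false) (pos t true) (pos e i)) := by
    intro t st tt e se i
    have hte := hee t st
    have hdd := hdesc e se
    by_cases het : t = e
    · subst het
      unfold Btw
      cases i <;> omega
    · have d1 := hd false false st se het
      have d2 := hd false true st se het
      have d3 := hd true false st se het
      have d4 := hd true true st se het
      by_cases te : T e
      · have n1 := h.nc t e st se het (by simp [tt, te])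
        have n2 := h.nc e t se st (Ne.symm het) (by simp [tt, te])
        unfold Btw at *
        cases i <;> omega
      · simp only [te, not_false_eq_true, true_and, false_and, or_false] at hdd
        unfold Btw at *
        cases i <;> omega
  refine ⟨slot, ?_, ?_, ?_⟩
  · intro e f i j se sf hs
    have d1 := hdesc e se
    have d2 := hdesc f sf
    by_cases hef : e = f
    · subst hef
      have := hee e se
      refine ⟨rfl, ?_⟩
      cases i <;> cases j <;> first | rfl | (exfalso; omega)
    · exfalso
      have d3 := hd false false se sf hef
      have d4 := hd false true se sf hef
      have d5 := hd true false se sf hef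
      have d6 := hd true true se sf hef
      cases i <;> cases j <;> omega
  · intro e f se sf hef
    have g1 := hdesc e se
    have g2 := hdesc f sf
    have d3 := hd false false se sf hef
    have d4 := hd false true se sf hef
    have d5 := hd true false se sf hef
    have d6 := hd true true se sf hef
    by_cases hT : T e ∨ T f
    · by_cases te : T e <;> by_cases tf : T f <;>
        simp only [te, tf, not_false_eq_true, not_true_eq_false, true_and, false_and, or_false,
          false_or] at g1 g2
      · unfold Btw; omega
      · unfold Btw; omega
      · unfold Btw; omega
      · exact absurd hT (by tauto)
    · have := h.nc e f se sf hef (by tauto)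
      push Not at hT
      simp only [hT, not_false_eq_true, true_and, false_and, or_false] at g1 g2
      unfold Btw at *; omega
  · intro a b c d i j k l sa sb sc sd h1 h2 h3 hac hbd
    rw [h.lab_iff _ _ _ _ sa sb]
    intro t st tt
    have e1 := (h.lab_iff _ _ _ _ sa sc).1 hac t st tt
    have e2 := (h.lab_iff _ _ _ _ sb sd).1 hbd t st tt
    rw [← hside t st tt a sa, ← hside t st tt c sc] at e1
    rw [← hside t st tt b sb, ← hside t st tt d sd] at e2
    rw [← hside t st tt a sa, ← hside t st tt b sb]
    unfold Btw at *
    omega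

end Enc
end CPGArea

namespace CPGArea

/-! ### The base encoding: a rectangular grid with a comb spanning tree -/

/-- Edges of the grid: `(false, x, y)` is horizontal, `(true, x, y)` is vertical. -/
abbrev GE := Bool × ℤ × ℤ

/-- The end points of a grid edge. -/
def gpt (e : GE) (i : Bool) : ℤ × ℤ :=
  (if e.1 = false ∧ i = true then e.2.1 + 1 else e.2.1,
   if e.1 = true ∧ i = true then e.2.2 + 1 else e.2.2)

/-- The edges inside the box `[0,N]²`. -/
def gS (N : ℤ) (e : GE) : Prop :=
  0 ≤ e.2.1 ∧ 0 ≤ e.2.2 ∧ (gpt e true).1 ≤ N ∧ (gpt e true).2 ≤ N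

/-- The comb spanning tree. -/
def gT (e : GE) : Prop := e.1 = false ∨ e.2.1 = 0

/-- The contour positions of the comb. -/
def gpos (N : ℤ) : GE → Bool → ℤ
  | (false, x, y), false => y * (4 * N + 10) + 2 * x + 1
  | (false, x, y), true => y * (4 * N + 10) + 4 * N + 1 - 2 * x
  | (true, x, y), false => y * (4 * N + 10) + 4 * N + 2 - 2 * x
  | (true, x, y), true => if x = 0 then (N + 1) * (4 * N + 10) + (N - y)
      else (y + 1) * (4 * N + 10) + 2 * x

theorem mulK {N y y' : ℤ} (hN : 0 ≤ N) :
    (y < y' → y * (4 * N + 10) + (4 * N + 10) ≤ y' * (4 * N + 10)) ∧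
    (y' < y → y' * (4 * N + 10) + (4 * N + 10) ≤ y * (4 * N + 10)) ∧
    (y = y' → y * (4 * N + 10) = y' * (4 * N + 10)) := by
  refine ⟨fun h => ?_, fun h => ?_, fun h => by rw [h]⟩
  · have : (y + 1) * (4 * N + 10) ≤ y' * (4 * N + 10) :=
      mul_le_mul_of_nonneg_right (by omega) (by omega)
    linarith
  · have : (y' + 1) * (4 * N + 10) ≤ y * (4 * N + 10) :=
      mul_le_mul_of_nonneg_right (by omega) (by omega)
    linarith

theorem gside_h {N : ℤ} (hN : 0 ≤ N) {x y : ℤ} (ht : gS N (false, x, y)) {e : GE} (he : gS N e)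
    (i : Bool) : Btw (gpos N (false, x, y) false) (gpos N (false, x, y) true) (gpos N e i) ↔
      ((gpt e i).2 = y ∧ x < (gpt e i).1) := by
  obtain ⟨b, x', y'⟩ := e
  have m1 := mulK (y := y) (y' := y') hN
  have m2 := mulK (y := y) (y' := y' + 1) hN
  have m3 := mulK (y := y) (y' := N + 1) hN
  have m4 : (y' + 1) * (4 * N + 10) = y' * (4 * N + 10) + (4 * N + 10) := by ring
  cases b <;> cases i <;> simp [gS, gpt, gpos] at ht he ⊢ <;> (try split_ifs) <;> unfold Btw <;>
    omega

theorem gside_v {N : ℤ} (hN : 0 ≤ N) {y : ℤ} (ht : gS N (true, 0, y)) {e : GE} (he : gS N e)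
    (i : Bool) : Btw (gpos N (true, 0, y) false) (gpos N (true, 0, y) true) (gpos N e i) ↔
      y < (gpt e i).2 := by
  obtain ⟨b, x', y'⟩ := e
  have m1 := mulK (y := y) (y' := y') hN
  have m2 := mulK (y := y) (y' := y' + 1) hN
  have m3 := mulK (y := y) (y' := N + 1) hN
  have m5 := mulK (y := y') (y' := N + 1) hN
  have m6 := mulK (y := y' + 1) (y' := N + 1) hN
  have m4 : (y' + 1) * (4 * N + 10) = y' * (4 * N + 10) + (4 * N + 10) := by ring
  cases b <;> cases i <;> simp [gS, gpt, gpos] at ht he ⊢ <;> (try split_ifs) <;> unfold Btw <;>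
    omega

theorem grid_enc {N : ℤ} (hN : 0 ≤ N) : Enc (gS N) gpt gT (gpos N) := by
  refine ⟨?_, ?_, ?_⟩
  · rintro ⟨b, x, y⟩ ⟨b', x', y'⟩ i j he hf hp
    have m1 := mulK (y := y) (y' := y') hN
    have m2 := mulK (y := y) (y' := y' + 1) hN
    have m2' := mulK (y := y + 1) (y' := y') hN
    have m3 := mulK (y := y) (y' := N + 1) hN
    have m5 := mulK (y := y') (y' := N + 1) hN
    have m6 := mulK (y := y' + 1) (y' := N + 1) hN
    have m7 := mulK (y := y + 1) (y' := N + 1) hN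
    have m4 : (y' + 1) * (4 * N + 10) = y' * (4 * N + 10) + (4 * N + 10) := by ring
    have m8 : (y + 1) * (4 * N + 10) = y * (4 * N + 10) + (4 * N + 10) := by ring
    cases b <;> cases b' <;> cases i <;> cases j <;> simp [gS, gpt, gpos] at he hf hp ⊢ <;>
      (try split_ifs at hp) <;> omega
  · intro e f he hf hef hT
    by_cases hTe : gT e
    · have hTf := hT.1 hTe
      obtain ⟨b, x, y⟩ := e
      obtain ⟨b', x', y'⟩ := f
      cases b
      · rw [gside_h hN he hf, gside_h hN he hf]
        cases b' <;> simp [gT, gpt, gS] at * <;> omega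
      · simp [gT] at hTe
        subst hTe
        rw [gside_v hN he hf, gside_v hN he hf]
        cases b' <;> simp [gT, gpt, gS] at * <;> omega
    · have hTf := fun h => hTe (hT.2 h)
      obtain ⟨b, x, y⟩ := e
      obtain ⟨b', x', y'⟩ := f
      cases b <;> cases b' <;> simp [gT] at hTe hTf
      simp [gS, gpt, gpos, hTe, hTf] at he hf hef ⊢
      have m1 := mulK (y := y) (y' := y') hN
      have m2 := mulK (y := y) (y' := y' + 1) hN
      have m2' := mulK (y := y + 1) (y' := y') hN
      have m4 : (y' + 1) * (4 * N + 10) = y' * (4 * N + 10) + (4 * N + 10) := by ring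
      have m8 : (y + 1) * (4 * N + 10) = y * (4 * N + 10) + (4 * N + 10) := by ring
      unfold Btw
      omega
  · intro e f i j he hf
    constructor
    · rintro hp ⟨b, x, y⟩ ht hT
      cases b
      · rw [gside_h hN ht he, gside_h hN ht hf, hp]
      · simp [gT] at hT
        subst hT
        rw [gside_v hN ht he, gside_v hN ht hf, hp]
    · intro hs
      have bd : ∀ e : GE, ∀ i, gS N e → 0 ≤ (gpt e i).1 ∧ 0 ≤ (gpt e i).2 ∧ (gpt e i).1 ≤ N ∧
          (gpt e i).2 ≤ N := by
        rintro ⟨b, x, y⟩ i h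
        cases b <;> cases i <;> simp [gS, gpt] at * <;> omega
      obtain ⟨a1, a2, a3, a4⟩ := bd e i he
      obtain ⟨b1, b2, b3, b4⟩ := bd f j hf
      have hv : ∀ y, 0 ≤ y → y < N → (y < (gpt e i).2 ↔ y < (gpt f j).2) := by
        intro y h1 h2
        have ht : gS N (true, 0, y) := by simp [gS, gpt]; omega
        have := hs _ ht (Or.inr rfl)
        rwa [gside_v hN ht he, gside_v hN ht hf] at this
      have hh : ∀ x y, 0 ≤ x → x < N → 0 ≤ y → y ≤ N → ((gpt e i).2 = y ∧ x < (gpt e i).1 ↔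
          (gpt f j).2 = y ∧ x < (gpt f j).1) := by
        intro x y h1 h2 h3 h4
        have ht : gS N (false, x, y) := by simp [gS, gpt]; omega
        have := hs _ ht (Or.inl rfl)
        rwa [gside_h hN ht he, gside_h hN ht hf] at this
      have hy : (gpt e i).2 = (gpt f j).2 := by
        by_contra hne
        have := hv (min (gpt e i).2 (gpt f j).2) (by omega) (by omega)
        omega
      have hx : (gpt e i).1 = (gpt f j).1 := by
        by_contra hne
        have := hh (min (gpt e i).1 (gpt f j).1) (gpt e i).2 (by omega) (by omega) a2 a4
        omega
      exact Prod.ext hx hy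

end CPGArea

namespace CPGArea

/-! ### Drawing noncrossing diagrams -/

/-- The unit-distance graph on a set of grid points. -/
def gridIn (A : Set (ℤ × ℤ)) : SimpleGraph (ℤ × ℤ) where
  Adj p q := p ∈ A ∧ q ∈ A ∧ GridStep p q
  symm := ⟨by
    rintro p q ⟨h1, h2, h3⟩
    refine ⟨h2, h1, ?_⟩
    unfold GridStep at *; omega⟩
  loopless := ⟨by
    rintro p ⟨-, -, h⟩
    unfold GridStep at h
    simp at h⟩

theorem reach_vert {A : Set (ℤ × ℤ)} {x a b : ℤ} (hab : a ≤ b)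
    (h : ∀ y, a ≤ y → y ≤ b → (x, y) ∈ A) : (gridIn A).Reachable (x, a) (x, b) := by
  induction b, hab using Int.leInduction with
  | base => exact SimpleGraph.Reachable.refl _
  | succ b hb ih =>
    refine (ih (fun y h1 h2 => h y h1 (by omega))).trans (SimpleGraph.Adj.reachable ?_)
    exact ⟨h b hb (by omega), h (b + 1) (by omega) le_rfl, by simp [GridStep]⟩

theorem reach_horiz {A : Set (ℤ × ℤ)} {y a b : ℤ} (hab : a ≤ b)
    (h : ∀ x, a ≤ x → x ≤ b → (x, y) ∈ A) : (gridIn A).Reachable (a, y) (b, y) := by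
  induction b, hab using Int.leInduction with
  | base => exact SimpleGraph.Reachable.refl _
  | succ b hb ih =>
    refine (ih (fun y h1 h2 => h y h1 (by omega))).trans (SimpleGraph.Adj.reachable ?_)
    exact ⟨h b hb (by omega), h (b + 1) (by omega) le_rfl, by simp [GridStep]⟩

theorem gridIn_mono {A B : Set (ℤ × ℤ)} (h : A ⊆ B) {p q : ℤ × ℤ}
    (hr : (gridIn A).Reachable p q) : (gridIn B).Reachable p q :=
  SimpleGraph.Reachable.mono (G := gridIn A) (G' := gridIn B)
    (fun _ _ hab => ⟨h hab.1, h hab.2.1, hab.2.2⟩) hr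

/-- The part of the drawing of a dart below the axis: slot `s`, leftmost slot `X` of the node,
rank `r` of the dart. -/
def route (M X s r : ℤ) : Set (ℤ × ℤ) := {p |
  (p.1 = 2 * s ∧ -(3 * (M - X) + max (r - 1) 0) ≤ p.2 ∧ p.2 ≤ 0) ∨
  (p.2 = -(3 * (M - X) + max (r - 1) 0) ∧ 2 * X - max (r - 2) 0 ≤ p.1 ∧ p.1 ≤ 2 * s) ∨
  (p.1 = 2 * X - max (r - 2) 0 ∧ -(3 * (M - X) + max (r - 1) 0) ≤ p.2 ∧ p.2 ≤ -(3 * (M - X))) ∨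
  (p.1 = 2 * X ∧ p.2 = -(3 * (M - X)))}

/-- The part of the drawing of an edge above the axis. -/
def arch (M s t : ℤ) : Set (ℤ × ℤ) := {p |
  ((p.1 = 2 * s ∨ p.1 = 2 * t) ∧ 0 ≤ p.2 ∧ p.2 ≤ M - min s t) ∨
  (p.2 = M - min s t ∧ 2 * min s t ≤ p.1 ∧ p.1 ≤ 2 * max s t)}

theorem route_reach {M X s r : ℤ} (hXs : X ≤ s) (hsM : s < M) (hr : 0 ≤ r) (hr3 : r ≤ 3) :
    (gridIn (route M X s r)).Reachable (2 * X, -(3 * (M - X))) (2 * s, 0) := by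
  have h1 : (gridIn (route M X s r)).Reachable
      (2 * s, -(3 * (M - X) + max (r - 1) 0)) (2 * s, 0) := by
    apply reach_vert (by omega)
    intro y h1 h2
    exact Or.inl ⟨rfl, h1, h2⟩
  have h2 : (gridIn (route M X s r)).Reachable
      (2 * X - max (r - 2) 0, -(3 * (M - X) + max (r - 1) 0))
      (2 * s, -(3 * (M - X) + max (r - 1) 0)) := by
    apply reach_horiz (by omega)
    intro y h1 h2
    exact Or.inr (Or.inl ⟨rfl, h1, h2⟩)
  have h3 : (gridIn (route M X s r)).Reachable
      (2 * X - max (r - 2) 0, -(3 * (M - X) + max (r - 1) 0))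
      (2 * X - max (r - 2) 0, -(3 * (M - X))) := by
    apply reach_vert (by omega)
    intro y h1 h2
    exact Or.inr (Or.inr (Or.inl ⟨rfl, h1, h2⟩))
  have h4 : (gridIn (route M X s r)).Reachable
      (2 * X - max (r - 2) 0, -(3 * (M - X))) (2 * X, -(3 * (M - X))) := by
    apply reach_horiz (by omega)
    intro x h1 h2
    have hx : x = 2 * X - max (r - 2) 0 ∨ x = 2 * X := by omega
    rcases hx with rfl | rfl
    · exact Or.inr (Or.inr (Or.inl ⟨rfl, by simp only; omega, le_rfl⟩))
    · exact Or.inr (Or.inr (Or.inr ⟨rfl, rfl⟩))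
  exact ((h4.symm.trans h3.symm).trans h2).trans h1

theorem arch_reach {M s t : ℤ} (hs : s < M) (ht : t < M) :
    (gridIn (arch M s t)).Reachable (2 * s, 0) (2 * t, 0) := by
  have h1 : (gridIn (arch M s t)).Reachable (2 * s, 0) (2 * s, M - min s t) := by
    apply reach_vert (by omega)
    intro y h1 h2
    exact Or.inl ⟨Or.inl rfl, h1, h2⟩
  have h2 : (gridIn (arch M s t)).Reachable (2 * t, 0) (2 * t, M - min s t) := by
    apply reach_vert (by omega)
    intro y h1 h2
    exact Or.inl ⟨Or.inr rfl, h1, h2⟩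
  have h3 : (gridIn (arch M s t)).Reachable (2 * min s t, M - min s t)
      (2 * max s t, M - min s t) := by
    apply reach_horiz (by omega)
    intro x h1 h2
    exact Or.inr ⟨rfl, h1, h2⟩
  have h4 : (gridIn (arch M s t)).Reachable (2 * s, M - min s t) (2 * t, M - min s t) := by
    rcases le_total s t with h | h
    · rwa [min_eq_left h, max_eq_right h] at *
    · rw [min_eq_right h, max_eq_left h] at *
      exact h3.symm
  exact (h1.trans h4).trans h2.symm

theorem route_route_same {M X s s' r r' : ℤ} (h1 : X ≤ s) (h1' : X ≤ s') (h2 : s < M)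
    (h2' : s' < M) (hr : 0 ≤ r) (hr3 : r ≤ 3) (hr' : 0 ≤ r') (hr3' : r' ≤ 3) (hne : s ≠ s')
    (hlt : s < s' ↔ r < r') (h0 : s = X ↔ r = 0) (h0' : s' = X ↔ r' = 0)
    (hne' : r ≠ r') {p : ℤ × ℤ} (hp : p ∈ route M X s r) (hp' : p ∈ route M X s' r') :
    p = (2 * X, -(3 * (M - X))) := by
  obtain ⟨x, y⟩ := p
  simp only [route, Set.mem_ofPred_eq] at hp hp'
  rw [Prod.mk.injEq]
  omega

theorem route_route_diff {M X X' s s' r r' : ℤ} (h1 : X ≤ s) (h1' : X' ≤ s') (h2 : s < M)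
    (h2' : s' < M) (hr : 0 ≤ r) (hr3 : r ≤ 3) (hr' : 0 ≤ r') (hr3' : r' ≤ 3)
    (d1 : X ≠ X') (d2 : X ≠ s') (d3 : s ≠ X') (d4 : s ≠ s')
    (n1 : ¬ (X < X' ∧ X' < s ∧ s < s')) (n2 : ¬ (X' < X ∧ X < s' ∧ s' < s))
    {p : ℤ × ℤ} (hp : p ∈ route M X s r) (hp' : p ∈ route M X' s' r') : False := by
  obtain ⟨x, y⟩ := p
  simp only [route, Set.mem_ofPred_eq] at hp hp'
  omega

theorem arch_arch {M s t s' t' : ℤ} (h : s < M) (h' : t < M) (h2 : s' < M) (h2' : t' < M)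
    (d1 : s ≠ s') (d2 : s ≠ t') (d3 : t ≠ s') (d4 : t ≠ t') (d5 : s ≠ t) (d6 : s' ≠ t')
    (hn : Btw s t s' ↔ Btw s t t')
    {p : ℤ × ℤ} (hp : p ∈ arch M s t) (hp' : p ∈ arch M s' t') : False := by
  obtain ⟨x, y⟩ := p
  simp only [arch, Set.mem_ofPred_eq] at hp hp'
  unfold Btw at hn
  omega

theorem arch_route {M s t s' X r : ℤ} (h : s < M) (h' : t < M) (h1 : X ≤ s') (h2 : s' < M)
    (hr : 0 ≤ r) (hr3 : r ≤ 3) (d1 : s ≠ s') (d3 : t ≠ s')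
    {p : ℤ × ℤ} (hp : p ∈ arch M s t) (hp' : p ∈ route M X s' r) : False := by
  obtain ⟨x, y⟩ := p
  simp only [arch, route, Set.mem_ofPred_eq] at hp hp'
  omega

/-- Drawing a noncrossing diagram with blocks of size at most four. -/
theorem draw {K W : Type*} [Fintype K] (nd : K → Bool → W) (slot : K → Bool → ℤ)
    (inj : ∀ e f i j, slot e i = slot f j → e = f ∧ i = j)
    (hM : ∀ e f, e ≠ f → (Btw (slot e false) (slot e true) (slot f false) ↔
      Btw (slot e false) (slot e true) (slot f true)))
    (hP : ∀ a b c d i j k l, slot a i < slot b j → slot b j < slot c k →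
      slot c k < slot d l → nd a i = nd c k → nd b j = nd d l → nd a i = nd b j)
    (hdeg : ∀ n, Set.ncard {d : K × Bool | nd d.1 d.2 = n} ≤ 4) :
    ∃ (Z : W → ℤ × ℤ) (Dr : K → Set (ℤ × ℤ)),
      (∀ k, (gridIn (Dr k)).Reachable (Z (nd k false)) (Z (nd k true))) ∧
      (∀ k i, Z (nd k i) ∈ Dr k) ∧
      (∀ k k' p, k ≠ k' → p ∈ Dr k → p ∈ Dr k' → ∃ i j, p = Z (nd k i) ∧ nd k i = nd k' j) ∧
      (∀ k k' i j, nd k i ≠ nd k' j → Z (nd k i) ≠ Z (nd k' j) ∧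
        ¬ GridStep (Z (nd k i)) (Z (nd k' j))) ∧
      (∀ k p, p ∈ Dr k → -1 ≤ p.1 ∧ p.1 ≤ 4 * Fintype.card K ∧
        -(6 * (Fintype.card K : ℤ) + 2) ≤ p.2 ∧ p.2 ≤ 2 * Fintype.card K) := by
  classical
  -- compressed slots
  let rk : K → Bool → ℤ := fun k i =>
    ((Finset.univ.filter (fun d : K × Bool => slot d.1 d.2 < slot k i)).card : ℤ)
  have rk_mono : ∀ k k' i i', slot k i < slot k' i' → rk k i < rk k' i' := by
    intro k k' i i' h
    simp only [rk, Nat.cast_lt]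
    apply Finset.card_lt_card
    rw [Finset.ssubset_iff_of_subset]
    · exact ⟨(k, i), by simp [h], by simp⟩
    · intro d hd
      simp only [Finset.mem_filter, Finset.mem_univ, true_and] at hd ⊢
      omega
  have rk_lt : ∀ k k' i i', rk k i < rk k' i' ↔ slot k i < slot k' i' := by
    intro k k' i i'
    refine ⟨fun h => ?_, rk_mono _ _ _ _⟩
    rcases lt_trichotomy (slot k i) (slot k' i') with h1 | h1 | h1
    · exact h1
    · obtain ⟨rfl, rfl⟩ := inj _ _ _ _ h1
      exact absurd h (lt_irrefl _)
    · exact absurd h (rk_mono _ _ _ _ h1).le.not_gt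
  have rk_inj : ∀ k k' i i', rk k i = rk k' i' → k = k' ∧ i = i' := by
    intro k k' i i' h
    apply inj
    rcases lt_trichotomy (slot k i) (slot k' i') with h1 | h1 | h1
    · have := rk_mono _ _ _ _ h1; omega
    · exact h1
    · have := rk_mono _ _ _ _ h1; omega
  obtain ⟨M, hMdef⟩ : ∃ M : ℤ, M = 2 * (Fintype.card K : ℤ) := ⟨_, rfl⟩
  have rk_nonneg : ∀ k i, 0 ≤ rk k i := fun k i => by simp [rk]
  have rk_M : ∀ k i, rk k i < M := by
    intro k i
    have : (Finset.univ.filter (fun d : K × Bool => slot d.1 d.2 < slot k i)).card <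
        (Finset.univ : Finset (K × Bool)).card := by
      apply Finset.card_lt_card
      rw [Finset.ssubset_iff_of_subset (Finset.subset_univ _)]
      exact ⟨(k, i), by simp, by simp⟩
    rw [Finset.card_univ, Fintype.card_prod, Fintype.card_bool] at this
    simp only [rk]
    omega
  have rk_ne : ∀ {k k'} (i i'), k ≠ k' → rk k i ≠ rk k' i' :=
    fun i i' h h' => h (rk_inj _ _ _ _ h').1
  have hM' : ∀ e f, e ≠ f → (Btw (rk e false) (rk e true) (rk f false) ↔
      Btw (rk e false) (rk e true) (rk f true)) := by
    intro e f hef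
    have h0 := hM e f hef
    have l1 := rk_lt e f false false
    have l2 := rk_lt e f true false
    have l3 := rk_lt e f false true
    have l4 := rk_lt e f true true
    have n1 := rk_ne false false hef
    have n2 := rk_ne true false hef
    have n3 := rk_ne false true hef
    have n4 := rk_ne true true hef
    have q1 : slot e false ≠ slot f false := fun h => hef (inj _ _ _ _ h).1
    have q2 : slot e true ≠ slot f false := fun h => hef (inj _ _ _ _ h).1
    have q3 : slot e false ≠ slot f true := fun h => hef (inj _ _ _ _ h).1
    have q4 : slot e true ≠ slot f true := fun h => hef (inj _ _ _ _ h).1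
    unfold Btw at *
    omega
  -- leftmost slots of the nodes
  have hXex : ∀ n : W, ∃ X : ℤ, ∀ k i, nd k i = n → X ≤ rk k i ∧ ∃ k' i', nd k' i' = n ∧
      X = rk k' i' := by
    intro n
    by_cases hn : (Finset.univ.filter (fun d : K × Bool => nd d.1 d.2 = n)).Nonempty
    · obtain ⟨d, hd, hmin⟩ := Finset.exists_min_image _ (fun d : K × Bool => rk d.1 d.2) hn
      simp only [Finset.mem_filter, Finset.mem_univ, true_and] at hd hmin
      exact ⟨rk d.1 d.2, fun k i h => ⟨hmin (k, i) h, d.1, d.2, hd, rfl⟩⟩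
    · refine ⟨0, fun k i h => ?_⟩
      exact absurd ⟨(k, i), by simp [h]⟩ hn
  choose X hX using hXex
  -- ranks within the nodes
  let r : K → Bool → ℤ := fun k i => ((Finset.univ.filter
    (fun d : K × Bool => nd d.1 d.2 = nd k i ∧ rk d.1 d.2 < rk k i)).card : ℤ)
  have r0 : ∀ k i, 0 ≤ r k i := fun k i => by simp [r]
  have r3 : ∀ k i, r k i ≤ 3 := by
    intro k i
    have h1 : (Finset.univ.filter
      (fun d : K × Bool => nd d.1 d.2 = nd k i ∧ rk d.1 d.2 < rk k i)).card <
      (Finset.univ.filter (fun d : K × Bool => nd d.1 d.2 = nd k i)).card := by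
      apply Finset.card_lt_card
      rw [Finset.ssubset_iff_of_subset]
      · exact ⟨(k, i), by simp, by simp⟩
      · intro d hd
        simp only [Finset.mem_filter, Finset.mem_univ, true_and] at hd ⊢
        exact hd.1
    have h2 := hdeg (nd k i)
    rw [Set.ncard_eq_toFinset_card'] at h2
    have h3 : (Finset.univ.filter (fun d : K × Bool => nd d.1 d.2 = nd k i)).card ≤ 4 := by
      convert h2 using 2
      ext d; simp
    simp only [r]
    omega
  have r_mono : ∀ k i k' i', nd k i = nd k' i' → rk k i < rk k' i' → r k i < r k' i' := by
    intro k i k' i' hn h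
    simp only [r, Nat.cast_lt]
    apply Finset.card_lt_card
    rw [Finset.ssubset_iff_of_subset]
    · exact ⟨(k, i), by simp [h, hn], by simp⟩
    · intro d hd
      simp only [Finset.mem_filter, Finset.mem_univ, true_and] at hd ⊢
      exact ⟨hd.1.trans hn, hd.2.trans h⟩
  have rX : ∀ k i, rk k i = X (nd k i) ↔ r k i = 0 := by
    intro k i
    obtain ⟨h1, k', i', hn, hx⟩ := hX (nd k i) k i rfl
    constructor
    · intro h
      simp only [r, Nat.cast_eq_zero, Finset.card_eq_zero, Finset.filter_eq_empty_iff]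
      rintro d - ⟨h2, h3⟩
      have := (hX (nd k i) d.1 d.2 h2).1
      omega
    · intro h
      by_contra hne
      have := r_mono k' i' k i hn (by omega)
      have := r0 k' i'
      omega
  have X0 : ∀ k i, 0 ≤ X (nd k i) := by
    intro k i
    obtain ⟨h1, k', i', hn, hx⟩ := hX (nd k i) k i rfl
    rw [hx]; exact rk_nonneg _ _
  have hXle : ∀ k i, X (nd k i) ≤ rk k i := fun k i => (hX (nd k i) k i rfl).1
  have hXne : ∀ k i k' i', nd k i ≠ nd k' i' → X (nd k i) ≠ rk k' i' := by
    intro k i k' i' hne h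
    obtain ⟨h1, k2, i2, hn, hx⟩ := hX (nd k i) k i rfl
    obtain ⟨rfl, rfl⟩ := rk_inj _ _ _ _ (hx.symm.trans h)
    exact hne hn.symm
  have hXX : ∀ k i k' i', nd k i ≠ nd k' i' → X (nd k i) ≠ X (nd k' i') := by
    intro k i k' i' hne h
    obtain ⟨h1, k2, i2, hn, hx⟩ := hX (nd k' i') k' i' rfl
    exact hXne k i k2 i2 (by rw [hn]; exact hne) (h.trans hx)
  have hNC : ∀ k i k' i', nd k i ≠ nd k' i' →
      ¬ (X (nd k i) < X (nd k' i') ∧ X (nd k' i') < rk k i ∧ rk k i < rk k' i') := by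
    rintro k i k' i' hne ⟨h1, h2, h3⟩
    obtain ⟨-, a, ia, hna, hxa⟩ := hX (nd k i) k i rfl
    obtain ⟨-, b, ib, hnb, hxb⟩ := hX (nd k' i') k' i' rfl
    rw [hxa, hxb, rk_lt] at h1
    rw [hxb, rk_lt] at h2
    rw [rk_lt] at h3
    have := hP a b k k' ia ib i i' h1 h2 h3 hna hnb
    rw [hna, hnb] at this
    exact hne this
  let Z : W → ℤ × ℤ := fun n => (2 * X n, -(3 * (M - X n)))
  let Dr : K → Set (ℤ × ℤ) := fun k => {p | p ∈ arch M (rk k false) (rk k true) ∨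
    ∃ i, p ∈ route M (X (nd k i)) (rk k i) (r k i)}
  have hroute : ∀ k i k' i', k ≠ k' → ∀ p, p ∈ route M (X (nd k i)) (rk k i) (r k i) →
      p ∈ route M (X (nd k' i')) (rk k' i') (r k' i') →
      p = Z (nd k i) ∧ nd k i = nd k' i' := by
    intro k i k' i' hkk p hp hp'
    by_cases hn : nd k i = nd k' i'
    · refine ⟨?_, hn⟩
      have hne := rk_ne i i' hkk
      have m1 := r_mono k i k' i' hn
      have m2 := r_mono k' i' k i hn.symm
      have x1 := rX k i
      have x2 := rX k' i'
      have y1 := hXle k i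
      have y2 := hXle k' i'
      rw [← hn] at hp' x2 y2
      exact route_route_same y1 y2 (rk_M _ _) (rk_M _ _) (r0 k i) (r3 k i) (r0 k' i') (r3 k' i')
        hne ⟨m1, by omega⟩ x1 x2 (by omega) hp hp'
    · exfalso
      exact route_route_diff (hXle k i) (hXle k' i') (rk_M _ _) (rk_M _ _) (r0 k i) (r3 k i)
        (r0 k' i') (r3 k' i') (hXX _ _ _ _ hn) (hXne _ _ _ _ hn)
        (fun h => hXne k' i' k i (fun h => hn h.symm) h.symm) (rk_ne _ _ hkk)
        (hNC _ _ _ _ hn) (hNC _ _ _ _ (fun h => hn h.symm)) hp hp'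
  refine ⟨Z, Dr, ?_, ?_, ?_, ?_, ?_⟩
  · intro k
    have h1 : ∀ i, (gridIn (Dr k)).Reachable (Z (nd k i)) (2 * rk k i, 0) := fun i =>
      gridIn_mono (fun p hp => Or.inr ⟨i, hp⟩)
        (route_reach (hXle k i) (rk_M k i) (r0 k i) (r3 k i))
    have h2 : (gridIn (Dr k)).Reachable (2 * rk k false, 0) (2 * rk k true, 0) :=
      gridIn_mono (fun p hp => Or.inl hp) (arch_reach (rk_M _ _) (rk_M _ _))
    exact ((h1 false).trans h2).trans (h1 true).symm
  · intro k i
    exact Or.inr ⟨i, Or.inr (Or.inr (Or.inr ⟨rfl, rfl⟩))⟩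
  · intro k k' p hkk hp hp'
    have hself : ∀ k, rk k false ≠ rk k true := fun k h => by
      have := (rk_inj _ _ _ _ h).2
      simp at this
    rcases hp with hp | ⟨i, hp⟩ <;> rcases hp' with hp' | ⟨i', hp'⟩
    · exact (arch_arch (rk_M _ _) (rk_M _ _) (rk_M _ _) (rk_M _ _) (rk_ne _ _ hkk)
        (rk_ne _ _ hkk) (rk_ne _ _ hkk) (rk_ne _ _ hkk) (hself k) (hself k') (hM' k k' hkk)
        hp hp').elim
    · exact (arch_route (rk_M _ _) (rk_M _ _) (hXle _ _) (rk_M _ _) (r0 _ _) (r3 _ _)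
        (rk_ne _ _ hkk) (rk_ne _ _ hkk) hp hp').elim
    · exact (arch_route (rk_M _ _) (rk_M _ _) (hXle _ _) (rk_M _ _) (r0 _ _) (r3 _ _)
        (rk_ne _ _ hkk.symm) (rk_ne _ _ hkk.symm) hp' hp).elim
    · obtain ⟨h1, h2⟩ := hroute k i k' i' hkk p hp hp'
      exact ⟨i, i', h1, h2⟩
  · intro k k' i j hn
    have := hXX k i k' j hn
    constructor
    · intro h
      have := congrArg Prod.fst h
      simp only [Z] at this
      omega
    · intro h
      simp only [GridStep, Z] at h
      omega
  · intro k p hp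
    obtain ⟨x, y⟩ := p
    rcases hp with hp | ⟨i, hp⟩
    · simp only [arch, Set.mem_ofPred_eq] at hp
      have a1 := rk_nonneg k false
      have a2 := rk_nonneg k true
      have a3 := rk_M k false
      have a4 := rk_M k true
      simp only
      omega
    · simp only [route, Set.mem_ofPred_eq] at hp
      have a1 := rk_nonneg k i
      have a2 := X0 k i
      have a3 := rk_M k i
      have a4 := hXle k i
      have a5 := r0 k i
      have a6 := r3 k i
      simp only
      omega

end CPGArea

namespace CPGArea

/-! ### Extracting the contact multigraph of a family of paths -/

/-- Indexed version of a family of pairwise interiorly disjoint grid paths in the box `[0,N]²`. -/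
structure PS (V : Type) where
  P : V → ℕ → ℤ × ℤ
  m : V → ℕ
  N : ℤ
  hN : 0 ≤ N
  pos : ∀ v, 1 ≤ m v
  step : ∀ v t, t < m v → GridStep (P v t) (P v (t + 1))
  inj : ∀ v s t, s ≤ m v → t ≤ m v → P v s = P v t → s = t
  dis : ∀ u v s t, u ≠ v → s ≤ m u → t ≤ m v → P u s = P v t →
    (s = 0 ∨ s = m u) ∨ (t = 0 ∨ t = m v)
  seg : ∀ u v s t, s < m u → t < m v →
    ((P u s = P v t ∧ P u (s + 1) = P v (t + 1)) ∨ (P u s = P v (t + 1) ∧ P u (s + 1) = P v t)) →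
    u = v ∧ s = t
  box : ∀ v t, t ≤ m v → 0 ≤ (P v t).1 ∧ (P v t).1 ≤ N ∧ 0 ≤ (P v t).2 ∧ (P v t).2 ≤ N

namespace PS
variable {V : Type} (S : PS V)

/-- The nodes: all end points of paths. -/
def Node (p : ℤ × ℤ) : Prop := ∃ v, p = S.P v 0 ∨ p = S.P v (S.m v)

open Classical in
/-- The index of the last node before (or at) position `t`. -/
noncomputable def nb (v : V) : ℕ → ℕ
  | 0 => 0
  | t + 1 => if S.Node (S.P v (t + 1)) then t + 1 else nb v t

theorem node_zero (v : V) : S.Node (S.P v 0) := ⟨v, Or.inl rfl⟩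
theorem node_last (v : V) : S.Node (S.P v (S.m v)) := ⟨v, Or.inr rfl⟩

theorem nb_le (v : V) (t : ℕ) : S.nb v t ≤ t := by
  induction t with
  | zero => exact le_refl _
  | succ t ih =>
    rw [nb]; split_ifs <;> omega

theorem nb_node (v : V) (t : ℕ) : S.Node (S.P v (S.nb v t)) := by
  induction t with
  | zero => exact S.node_zero v
  | succ t ih =>
    rw [nb]; split_ifs with h
    · exact h
    · exact ih

theorem nb_of_node {v : V} {t : ℕ} (h : S.Node (S.P v t)) : S.nb v t = t := by
  cases t with
  | zero => rfl
  | succ t => rw [nb, if_pos h]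

theorem nb_of_not {v : V} {t : ℕ} (h : ¬ S.Node (S.P v (t + 1))) : S.nb v (t + 1) = S.nb v t := by
  rw [nb, if_neg h]

theorem nb_nb (v : V) (t : ℕ) : S.nb v (S.nb v t) = S.nb v t := S.nb_of_node (S.nb_node v t)

theorem nb_ge {v : V} {s t : ℕ} (h : S.Node (S.P v s)) (hst : s ≤ t) : s ≤ S.nb v t := by
  induction t with
  | zero => omega
  | succ t ih =>
    rw [nb]; split_ifs with h'
    · exact hst
    · rcases Nat.lt_or_ge t s with h2 | h2
      · have : s = t + 1 := by omega
        subst this; exact absurd h h'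
      · exact ih h2

/-- The pieces of the paths between consecutive nodes, indexed by their last segment. -/
def K : Type := {x : V × ℕ // x.2 < S.m x.1 ∧ S.Node (S.P x.1 (x.2 + 1))}

/-- The end nodes of a piece. -/
noncomputable def nd (k : S.K) : Bool → ℤ × ℤ
  | false => S.P k.1.1 (S.nb k.1.1 k.1.2)
  | true => S.P k.1.1 (k.1.2 + 1)

theorem common_node {u v : V} {s t : ℕ} (huv : u ≠ v) (hs : s ≤ S.m u) (ht : t ≤ S.m v)
    (h : S.P u s = S.P v t) : S.Node (S.P u s) := by
  rcases S.dis u v s t huv hs ht h with (h1 | h1) | (h1 | h1)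
  · exact ⟨u, Or.inl (by rw [h1])⟩
  · exact ⟨u, Or.inr (by rw [h1])⟩
  · exact ⟨v, Or.inl (by rw [h, h1])⟩
  · exact ⟨v, Or.inr (by rw [h, h1])⟩

/-- A two-bit code for the direction of a unit step. -/
def dirc (n q : ℤ × ℤ) : Bool × Bool :=
  (decide (0 < q.1 - n.1 + (q.2 - n.2)), decide (q.1 = n.1))

theorem dirc_inj {n q q' : ℤ × ℤ} (h : GridStep n q) (h' : GridStep n q')
    (e : dirc n q = dirc n q') : q = q' := by
  unfold dirc at e
  unfold GridStep at h h'
  simp only [Prod.mk.injEq, decide_eq_decide] at e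
  obtain ⟨e1, e2⟩ := e
  ext <;> omega

theorem gstep_symm {p q : ℤ × ℤ} (h : GridStep p q) : GridStep q p := by
  unfold GridStep at *; omega

/-- The neighbour of the end node of a piece along the piece. -/
noncomputable def nbr (k : S.K) : Bool → ℤ × ℤ
  | false => S.P k.1.1 (S.nb k.1.1 k.1.2 + 1)
  | true => S.P k.1.1 k.1.2

theorem nd_nbr (k : S.K) (i : Bool) : GridStep (S.nd k i) (S.nbr k i) := by
  obtain ⟨⟨v, t⟩, h1, h2⟩ := k
  have := S.nb_le v t
  cases i
  · exact S.step v _ (lt_of_le_of_lt this h1)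
  · exact gstep_symm (S.step v t h1)

theorem dart_inj (k k' : S.K) (i j : Bool) (h : S.nd k i = S.nd k' j)
    (h' : S.nbr k i = S.nbr k' j) : k = k' ∧ i = j := by
  obtain ⟨⟨v, t⟩, h1, h2⟩ := k
  obtain ⟨⟨v', t'⟩, h1', h2'⟩ := k'
  simp only at h1 h2 h1' h2'
  have a := S.nb_le v t
  have a' := S.nb_le v' t'
  cases i <;> cases j <;> simp only [nd, nbr] at h h'
  · obtain ⟨rfl, e⟩ := S.seg v v' _ _ (by omega) (by omega) (Or.inl ⟨h, h'⟩)
    refine ⟨?_, rfl⟩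
    have : t = t' := by
      rcases lt_trichotomy t t' with c | c | c
      · have := S.nb_ge h2 (show t + 1 ≤ t' by omega)
        omega
      · exact c
      · have := S.nb_ge h2' (show t' + 1 ≤ t by omega)
        omega
    subst this; rfl
  · obtain ⟨rfl, e⟩ := S.seg v v' _ _ (by omega) (by omega) (Or.inr ⟨h, h'⟩)
    rw [e] at h
    have := S.inj v _ _ (by omega) (by omega) h
    omega
  · obtain ⟨rfl, e⟩ := S.seg v v' _ _ (by omega) (by omega) (Or.inr ⟨h', h⟩)
    rw [← e] at h
    have := S.inj v _ _ (by omega) (by omega) h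
    omega
  · obtain ⟨rfl, e⟩ := S.seg v v' _ _ (by omega) (by omega) (Or.inl ⟨h', h⟩)
    subst e
    exact ⟨rfl, rfl⟩

theorem deg (n : ℤ × ℤ) : Set.ncard {d : S.K × Bool | S.nd d.1 d.2 = n} ≤ 4 := by
  have := Set.ncard_le_ncard_of_injOn (s := {d : S.K × Bool | S.nd d.1 d.2 = n})
    (t := (Set.univ : Set (Bool × Bool)))
    (fun d => dirc n (S.nbr d.1 d.2)) (fun _ _ => Set.mem_univ _) ?_ Set.finite_univ
  · rw [Set.ncard_univ] at this
    simpa using this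
  · rintro ⟨k, i⟩ hk ⟨k', j⟩ hk' e
    simp only [Set.mem_ofPred_eq] at hk hk' e
    have s1 := S.nd_nbr k i
    have s2 := S.nd_nbr k' j
    rw [hk] at s1
    rw [hk'] at s2
    obtain ⟨rfl, rfl⟩ := S.dart_inj k k' i j (hk.trans hk'.symm) (dirc_inj s1 s2 e)
    rfl

theorem K_inj : ∃ f : S.K → V × Bool × Bool × Bool, Function.Injective f := by
  have : ∀ k : S.K, ∃ (u : V) (b : Bool), S.nd k true = if b then S.P u 0 else S.P u (S.m u) := by
    rintro ⟨⟨v, t⟩, h1, u, h2 | h2⟩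
    · exact ⟨u, true, by simpa [nd] using h2⟩
    · exact ⟨u, false, by simpa [nd] using h2⟩
  choose u b h using this
  refine ⟨fun k => (u k, b k, dirc (S.nd k true) (S.nbr k true)), fun k k' e => ?_⟩
  simp only [Prod.mk.injEq] at e
  obtain ⟨e1, e2, e3⟩ := e
  have hn : S.nd k true = S.nd k' true := by rw [h k, h k', e1, e2]
  rw [hn] at e3
  have s1 := S.nd_nbr k true
  rw [hn] at s1
  exact (S.dart_inj k k' true true hn (dirc_inj s1 (S.nd_nbr k' true) e3)).1

theorem edge_exists (p q : ℤ × ℤ) :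
    ∃ (e : GE) (i : Bool), GridStep p q → gpt e i = p ∧ gpt e (!i) = q := by
  by_cases h : GridStep p q
  · obtain ⟨a, b⟩ := p
    obtain ⟨c, d⟩ := q
    unfold GridStep at h
    simp only at h
    have : (c = a + 1 ∧ d = b) ∨ (c = a - 1 ∧ d = b) ∨ (c = a ∧ d = b + 1) ∨ (c = a ∧ d = b - 1) := by
      omega
    rcases this with ⟨rfl, rfl⟩ | ⟨rfl, rfl⟩ | ⟨rfl, rfl⟩ | ⟨rfl, rfl⟩
    · exact ⟨(false, a, d), false, fun _ => by simp [gpt]⟩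
    · exact ⟨(false, a - 1, d), true, fun _ => by simp [gpt]⟩
    · exact ⟨(true, c, b), false, fun _ => by simp [gpt]⟩
    · exact ⟨(true, c, b - 1), true, fun _ => by simp [gpt]⟩
  · exact ⟨(false, 0, 0), false, fun h' => absurd h' h⟩

theorem gS_of {N : ℤ} {e : GE} (h : ∀ i, 0 ≤ (gpt e i).1 ∧ (gpt e i).1 ≤ N ∧ 0 ≤ (gpt e i).2 ∧
    (gpt e i).2 ≤ N) : gS N e := by
  have h0 := h false
  have h1 := h true
  refine ⟨?_, ?_, h1.2.1, h1.2.2.2⟩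
  · simpa [gpt] using h0.1
  · simpa [gpt] using h0.2.2.1

theorem phi_exists : ∃ phi : ℤ × ℤ → ℤ × ℤ, ∀ v t, t ≤ S.m v →
    phi (S.P v t) = S.P v (S.nb v t) := by
  have : ∀ p : ℤ × ℤ, ∃ q, ∀ v t, t ≤ S.m v → p = S.P v t → q = S.P v (S.nb v t) := by
    intro p
    by_cases h : ∃ v t, t ≤ S.m v ∧ p = S.P v t
    · obtain ⟨v, t, ht, rfl⟩ := h
      refine ⟨S.P v (S.nb v t), fun v' t' ht' e => ?_⟩
      by_cases hv : v = v'
      · subst hv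
        rw [S.inj v _ _ ht ht' e]
      · have hn := S.common_node hv ht ht' e
        rw [S.nb_of_node hn]
        rw [e] at hn
        rw [S.nb_of_node hn, e]
    · refine ⟨p, fun v t ht e => absurd ⟨v, t, ht, e⟩ h⟩
  choose phi hphi using this
  exact ⟨phi, fun v t ht => hphi _ v t ht rfl⟩

theorem bool_swap {α : Type*} (f : Bool → α) (i : Bool) : f i = f (!i) ↔ f false = f true := by
  cases i
  · exact Iff.rfl
  · exact eq_comm

theorem btw_symm {a b x : ℤ} : Btw a b x ↔ Btw b a x := or_comm

theorem btw_xor (f h : Bool → ℤ) (a b : Bool)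
    (H : Btw (f false) (f true) (h false) ↔ Btw (f false) (f true) (h true)) :
    Btw (f (xor false a)) (f (xor true a)) (h (xor false b)) ↔
      Btw (f (xor false a)) (f (xor true a)) (h (xor true b)) := by
  cases a <;> cases b
  · exact H
  · exact H.symm
  · exact btw_symm.trans (H.trans btw_symm)
  · exact btw_symm.trans (H.symm.trans btw_symm)

theorem slots [Fintype V] : ∃ slot : S.K → Bool → ℤ,
    (∀ e f i j, slot e i = slot f j → e = f ∧ i = j) ∧
    (∀ e f, e ≠ f → (Btw (slot e false) (slot e true) (slot f false) ↔
      Btw (slot e false) (slot e true) (slot f true))) ∧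
    (∀ a b c d i j k l, slot a i < slot b j → slot b j < slot c k → slot c k < slot d l →
      S.nd a i = S.nd c k → S.nd b j = S.nd d l → S.nd a i = S.nd b j) := by
  classical
  choose ed oi hed using edge_exists
  obtain ⟨phi, hphi⟩ := S.phi_exists
  let F : Finset GE := Finset.univ.biUnion fun v =>
    ((Finset.range (S.m v)).filter fun t => ¬ S.Node (S.P v (t + 1))).image
      fun t => ed (S.P v t) (S.P v (t + 1))
  have memF : ∀ e, e ∈ F ↔ ∃ v t, t < S.m v ∧ ¬ S.Node (S.P v (t + 1)) ∧
      ed (S.P v t) (S.P v (t + 1)) = e := by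
    intro e
    simp only [F, Finset.mem_biUnion, Finset.mem_univ, true_and, Finset.mem_image,
      Finset.mem_filter, Finset.mem_range, and_assoc]
  have h1 : ∀ v t, t < S.m v → gpt (ed (S.P v t) (S.P v (t + 1))) (oi (S.P v t) (S.P v (t + 1)))
      = S.P v t ∧ gpt (ed (S.P v t) (S.P v (t + 1))) (!oi (S.P v t) (S.P v (t + 1)))
      = S.P v (t + 1) := fun v t ht => hed _ _ (S.step v t ht)
  have hS : ∀ v t, t < S.m v → gS S.N (ed (S.P v t) (S.P v (t + 1))) := by
    intro v t ht
    apply gS_of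
    intro i
    obtain ⟨a, b⟩ := h1 v t ht
    by_cases hi : i = oi (S.P v t) (S.P v (t + 1))
    · subst hi; rw [a]; exact S.box v t ht.le
    · have : i = !oi (S.P v t) (S.P v (t + 1)) := by
        cases i <;> cases h : oi (S.P v t) (S.P v (t + 1)) <;> simp_all
      rw [this, b]; exact S.box v _ ht
  have edinj : ∀ u v s t, s < S.m u → t < S.m v →
      ed (S.P u s) (S.P u (s + 1)) = ed (S.P v t) (S.P v (t + 1)) → u = v ∧ s = t := by
    intro u v s t hs ht e
    obtain ⟨a, b⟩ := h1 u s hs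
    obtain ⟨a', b'⟩ := h1 v t ht
    rw [← e] at a' b'
    apply S.seg u v s t hs ht
    generalize oi (S.P u s) (S.P u (s + 1)) = x at a b
    generalize oi (S.P v t) (S.P v (t + 1)) = y at a' b'
    by_cases hxy : x = y
    · subst hxy
      exact Or.inl ⟨a.symm.trans a', b.symm.trans b'⟩
    · have : y = !x := by cases x <;> cases y <;> simp_all
      subst this
      rw [Bool.not_not] at b'
      exact Or.inr ⟨a.symm.trans b', b.symm.trans a'⟩
  obtain ⟨g, T', pos', henc, hg, hgp⟩ := (grid_enc S.hN).contract_list (P := ℤ × ℤ) gpt phi F.toList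
    (by
      intro e he
      rw [Finset.mem_toList, memF] at he
      obtain ⟨v, t, ht, -, rfl⟩ := he
      exact hS v t ht)
    (by
      intro e he
      rw [Finset.mem_toList, memF] at he
      obtain ⟨v, t, ht, hn, rfl⟩ := he
      obtain ⟨a, b⟩ := h1 v t ht
      have c : phi (S.P v t) = phi (S.P v (t + 1)) := by
        rw [hphi v t ht.le, hphi v (t + 1) ht, S.nb_of_not hn]
      refine (bool_swap (fun i => phi (gpt (ed (S.P v t) (S.P v (t + 1))) i))
        (oi (S.P v t) (S.P v (t + 1)))).1 ?_
      simp only [a, b]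
      exact c)
  have gstep : ∀ v t, t < S.m v → ¬ S.Node (S.P v (t + 1)) →
      g (S.P v t) = g (S.P v (t + 1)) := by
    intro v t ht hn
    obtain ⟨a, b⟩ := h1 v t ht
    have c := hg (ed (S.P v t) (S.P v (t + 1)))
      (by rw [Finset.mem_toList, memF]; exact ⟨v, t, ht, hn, rfl⟩)
    have d := (bool_swap (fun i => g (gpt (ed (S.P v t) (S.P v (t + 1))) i))
      (oi (S.P v t) (S.P v (t + 1)))).2 c
    simp only [a, b] at d
    exact d
  have gnb : ∀ v t, t ≤ S.m v → g (S.P v t) = g (S.P v (S.nb v t)) := by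
    intro v t
    induction t with
    | zero => intro _; rfl
    | succ t ih =>
      intro ht
      by_cases hn : S.Node (S.P v (t + 1))
      · rw [S.nb_of_node hn]
      · rw [S.nb_of_not hn, ← ih (by omega), gstep v t ht hn]
  have phind : ∀ k i, phi (S.nd k i) = S.nd k i := by
    rintro ⟨⟨v, t⟩, c1, c2⟩ i
    simp only at c1 c2
    have := S.nb_le v t
    cases i
    · simp only [nd]
      rw [hphi v _ (by omega), S.nb_nb]
    · simp only [nd]
      rw [hphi v _ (by omega), S.nb_of_node c2]
  let ke : S.K → GE := fun k => ed (S.P k.1.1 k.1.2) (S.P k.1.1 (k.1.2 + 1))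
  let ko : S.K → Bool := fun k => oi (S.P k.1.1 k.1.2) (S.P k.1.1 (k.1.2 + 1))
  have keinj : ∀ k k', ke k = ke k' → k = k' := by
    rintro ⟨⟨v, t⟩, c1, c2⟩ ⟨⟨v', t'⟩, c1', c2'⟩ e
    obtain ⟨rfl, rfl⟩ := edinj v v' t t' c1 c1' e
    rfl
  have keS : ∀ k, gS S.N (ke k) ∧ ke k ∉ F.toList := by
    rintro ⟨⟨v, t⟩, c1, c2⟩
    refine ⟨hS v t c1, fun hm => ?_⟩
    rw [Finset.mem_toList, memF] at hm
    obtain ⟨v', t', ht', hn, e⟩ := hm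
    obtain ⟨rfl, rfl⟩ := edinj _ _ _ _ ht' c1 e
    exact hn c2
  have klab : ∀ k i, g (gpt (ke k) (xor i (ko k))) = g (S.nd k i) := by
    rintro ⟨⟨v, t⟩, c1, c2⟩ i
    obtain ⟨a, b⟩ := h1 v t c1
    cases i
    · simp only [Bool.false_xor, nd, ke, ko]
      rw [a]
      exact gnb v t (le_of_lt c1)
    · simp only [Bool.true_xor, nd, ke, ko]
      rw [b]
  have kiff : ∀ k k' i j, g (gpt (ke k) (xor i (ko k))) = g (gpt (ke k') (xor j (ko k'))) ↔
      S.nd k i = S.nd k' j := by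
    intro k k' i j
    rw [klab, klab]
    refine ⟨fun h => ?_, fun h => by rw [h]⟩
    have := hgp _ _ h
    rwa [phind, phind] at this
  obtain ⟨slot, s1, s2, s3⟩ := henc.slots
  refine ⟨fun k i => slot (ke k) (xor i (ko k)), ?_, ?_, ?_⟩
  · intro e f i j h
    obtain ⟨a, b⟩ := s1 _ _ _ _ (keS e) (keS f) h
    have := keinj _ _ a
    subst this
    exact ⟨rfl, by simpa using b⟩
  · intro e f hef
    have := s2 (ke e) (ke f) (keS e) (keS f) (fun h => hef (keinj _ _ h))
    exact btw_xor (slot (ke e)) (slot (ke f)) (ko e) (ko f) this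
  · intro a b c d i j k l q1 q2 q3 q4 q5
    have := s3 (ke a) (ke b) (ke c) (ke d) _ _ _ _ (keS a) (keS b) (keS c) (keS d) q1 q2 q3
      ((kiff _ _ _ _).2 q4) ((kiff _ _ _ _).2 q5)
    exact (kiff _ _ _ _).1 this
end PS
end CPGArea

namespace CPGArea
namespace PS

/-! ### Assembling the new paths -/

theorem reach_list {A : Set (ℤ × ℤ)} {p q : ℤ × ℤ} (hp : p ∈ A) (h : (gridIn A).Reachable p q) :
    ∃ T : List (ℤ × ℤ), (p :: T).IsChain GridStep ∧ (p :: T).Nodup ∧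
      (p :: T).getLast? = some q ∧ ∀ x ∈ p :: T, x ∈ A := by
  classical
  obtain ⟨w⟩ := h
  have hw := w.toPath.2
  generalize w.toPath.1 = w' at hw
  have hsup : w'.support = p :: w'.support.tail := (SimpleGraph.Walk.cons_tail_support w').symm
  refine ⟨w'.support.tail, ?_, ?_, ?_, ?_⟩
  · rw [← hsup]
    exact (SimpleGraph.Walk.isChain_adj_support w').imp fun a b hab => hab.2.2
  · rw [← hsup]; exact hw.support_nodup
  · rw [← hsup, List.getLast?_eq_getLast_of_ne_nil (by simp)]
    simp
  · rw [← hsup]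
    clear hsup hw w
    intro x hx
    induction w' with
    | nil => simp at hx; rwa [hx]
    | cons hadj w' ih =>
      rw [SimpleGraph.Walk.support_cons, List.mem_cons] at hx
      rcases hx with rfl | hx
      · exact hadj.1
      · exact ih hadj.2.1 hx

variable {V : Type} (S : PS V)

theorem nd_form (k : S.K) (i : Bool) : ∃ s, s ≤ S.m k.1.1 ∧ s ≤ k.1.2 + 1 ∧
    S.nd k i = S.P k.1.1 s ∧ (i = false → s ≤ k.1.2) := by
  obtain ⟨⟨v, t⟩, h1, h2⟩ := k
  simp only at h1 h2
  have := S.nb_le v t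
  cases i
  · exact ⟨S.nb v t, by simp only; omega, by simp only; omega, rfl, fun _ => this⟩
  · exact ⟨t + 1, h1, le_refl _, rfl, fun h => by cases h⟩

theorem used {v : V} {t : ℕ} (ht : t ≤ S.m v) (hn : S.Node (S.P v t)) :
    ∃ (k : S.K) (i : Bool), k.1.1 = v ∧ S.nd k i = S.P v t := by
  classical
  cases t with
  | succ t => exact ⟨⟨(v, t), ht, hn⟩, true, rfl, rfl⟩
  | zero =>
    have hm := S.pos v
    have hex : ∃ s, s < S.m v ∧ S.Node (S.P v (s + 1)) := by
      refine ⟨S.m v - 1, by omega, ?_⟩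
      rw [Nat.sub_add_cancel hm]
      exact S.node_last v
    obtain ⟨h1, h2⟩ := Nat.find_spec hex
    refine ⟨⟨(v, Nat.find hex), h1, h2⟩, false, rfl, ?_⟩
    show S.P v (S.nb v (Nat.find hex)) = S.P v 0
    congr 1
    have hle := S.nb_le v (Nat.find hex)
    have hnode := S.nb_node v (Nat.find hex)
    cases hr : S.nb v (Nat.find hex) with
    | zero => rfl
    | succ r =>
      rw [hr] at hnode hle
      exact absurd ⟨by omega, hnode⟩ (Nat.find_min hex (m := r) (by omega))

theorem chain_exists (Z : ℤ × ℤ → ℤ × ℤ) (Dr : S.K → Set (ℤ × ℤ))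
    (d1 : ∀ k, (gridIn (Dr k)).Reachable (Z (S.nd k false)) (Z (S.nd k true)))
    (d2 : ∀ k i, Z (S.nd k i) ∈ Dr k)
    (d3 : ∀ k k' p, k ≠ k' → p ∈ Dr k → p ∈ Dr k' → ∃ i j, p = Z (S.nd k i) ∧ S.nd k i = S.nd k' j)
    (v : V) (t : ℕ) (ht : t ≤ S.m v) :
    ∃ L : List (ℤ × ℤ), L.IsChain GridStep ∧ L.Nodup ∧ L.head? = some (Z (S.P v 0)) ∧
      L.getLast? = some (Z (S.P v (S.nb v t))) ∧
      (∀ p ∈ L, p = Z (S.P v (S.nb v t)) ∨ ∃ k : S.K, k.1.1 = v ∧ k.1.2 < t ∧ p ∈ Dr k) ∧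
      (∀ s ≤ t, S.Node (S.P v s) → Z (S.P v s) ∈ L) := by
  induction t with
  | zero =>
    refine ⟨[Z (S.P v 0)], by simp, by simp, by simp, by simp [nb], ?_, ?_⟩
    · intro p hp
      left
      simpa [nb] using hp
    · intro s hs _
      have : s = 0 := by omega
      subst this; simp
  | succ t ih =>
    obtain ⟨L, c1, c2, c3, c4, c5, c6⟩ := ih (by omega)
    by_cases hn : S.Node (S.P v (t + 1))
    · let k : S.K := ⟨(v, t), ht, hn⟩
      obtain ⟨T, t1, t2, t3, t4⟩ := reach_list (d2 k false) (d1 k)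
      have hf : S.nd k false = S.P v (S.nb v t) := rfl
      have htr : S.nd k true = S.P v (t + 1) := rfl
      have hk2 : k.1.2 = t := rfl
      rw [hf] at t1 t2 t3 t4
      rw [htr] at t3
      have hLne : L ≠ [] := by rintro rfl; simp at c3
      rw [S.nb_of_node hn]
      refine ⟨L ++ T, ?_, ?_, ?_, ?_, ?_, ?_⟩
      · rw [List.isChain_append]
        refine ⟨c1, t1.tail, ?_⟩
        intro x hx y hy
        rw [c4] at hx
        simp only [Option.mem_def, Option.some.injEq] at hx
        subst hx
        cases T with
        | nil => simp at hy
        | cons b T =>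
          simp only [List.head?_cons, Option.mem_def, Option.some.injEq] at hy
          subst hy
          exact (List.isChain_cons_cons.1 t1).1
      · rw [List.nodup_append]
        refine ⟨c2, (List.nodup_cons.1 t2).2, ?_⟩
        rintro a ha b hb rfl
        have hnot : a ≠ Z (S.P v (S.nb v t)) := by
          rintro rfl
          exact (List.nodup_cons.1 t2).1 hb
        rcases c5 a ha with h | ⟨k', e1, e2, e3⟩
        · exact hnot h
        · have hkk : k ≠ k' := by
            rintro rfl
            rw [hk2] at e2
            omega
          obtain ⟨i, j, q1, q2⟩ := d3 k k' a hkk (t4 a (List.mem_cons_of_mem _ hb)) e3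
          cases i
          · exact hnot (by rw [q1, hf])
          · obtain ⟨s, s1, s2, s3, -⟩ := S.nd_form k' j
            rw [htr, s3, e1] at q2
            rw [e1] at s1
            have := S.inj v _ _ ht s1 q2
            omega
      · rw [List.head?_append_of_ne_nil _ hLne, c3]
      · rw [List.getLast?_append]
        cases T with
        | nil =>
          simp only [List.getLast?_singleton, Option.some.injEq] at t3
          simp [c4, t3]
        | cons b T =>
          rw [List.getLast?_cons_cons] at t3
          simp [t3]
      · intro p hp
        right
        rcases List.mem_append.1 hp with hp | hp
        · rcases c5 p hp with h | ⟨k', e1, e2, e3⟩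
          · exact ⟨k, rfl, Nat.lt_succ_self t, by rw [h, ← hf]; exact d2 k false⟩
          · exact ⟨k', e1, by omega, e3⟩
        · exact ⟨k, rfl, Nat.lt_succ_self t, t4 p (List.mem_cons_of_mem _ hp)⟩
      · intro s hs hsn
        rcases Nat.lt_or_ge t s with h | h
        · have : s = t + 1 := by omega
          subst this
          have hmem : Z (S.P v (t + 1)) ∈ Z (S.P v (S.nb v t)) :: T :=
            List.mem_of_mem_getLast? (by rw [t3]; rfl)
          rcases List.mem_cons.1 hmem with h' | h'
          · rw [h']
            exact List.mem_append_left _ (List.mem_of_mem_getLast? (by rw [c4]; rfl))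
          · exact List.mem_append_right _ h'
        · exact List.mem_append_left _ (c6 s h hsn)
    · rw [S.nb_of_not hn]
      refine ⟨L, c1, c2, c3, c4, ?_, ?_⟩
      · intro p hp
        rcases c5 p hp with h | ⟨k', e1, e2, e3⟩
        · exact Or.inl h
        · exact Or.inr ⟨k', e1, by omega, e3⟩
      · intro s hs hsn
        rcases Nat.lt_or_ge t s with h | h
        · have : s = t + 1 := by omega
          subst this
          exact absurd hsn hn
        · exact c6 s h hsn

theorem redraw [Fintype V] : ∃ (L : V → List (ℤ × ℤ)) (Z : ℤ × ℤ → ℤ × ℤ) (x y : ℤ) (w h : ℕ),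
    (∀ v, (L v).IsChain GridStep ∧ (L v).Nodup ∧ (L v).head? = some (Z (S.P v 0)) ∧
      (L v).getLast? = some (Z (S.P v (S.m v)))) ∧
    (∀ v s, s ≤ S.m v → S.Node (S.P v s) → Z (S.P v s) ∈ L v) ∧
    (∀ u v p, u ≠ v → p ∈ L u → p ∈ L v →
      ∃ s t, s ≤ S.m u ∧ t ≤ S.m v ∧ S.P u s = S.P v t ∧ p = Z (S.P u s)) ∧
    (∀ u v s t, s ≤ S.m u → t ≤ S.m v → S.Node (S.P u s) → S.Node (S.P v t) →
      S.P u s ≠ S.P v t → Z (S.P u s) ≠ Z (S.P v t) ∧ ¬ GridStep (Z (S.P u s)) (Z (S.P v t))) ∧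
    (∀ v p, p ∈ L v → x ≤ p.1 ∧ p.1 ≤ x + w ∧ y ≤ p.2 ∧ p.2 ≤ y + h) ∧
    w * h ≤ 3000 * (Fintype.card V) ^ 2 := by
  classical
  obtain ⟨f, hf⟩ := S.K_inj
  have : Finite S.K := Finite.of_injective f hf
  have : Fintype S.K := Fintype.ofFinite _
  have hcard : Fintype.card S.K ≤ 8 * Fintype.card V := by
    have := Fintype.card_le_of_injective f hf
    simp only [Fintype.card_prod, Fintype.card_bool] at this
    omega
  obtain ⟨slot, s1, s2, s3⟩ := S.slots
  obtain ⟨Z, Dr, d1, d2, d3, d4, d5⟩ := draw S.nd slot s1 s2 s3 S.deg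
  choose L hL using fun v => S.chain_exists Z Dr d1 d2 d3 v (S.m v) le_rfl
  have hmem : ∀ v p, p ∈ L v → ∃ k : S.K, k.1.1 = v ∧ p ∈ Dr k := by
    intro v p hp
    obtain ⟨-, -, -, -, c5, -⟩ := hL v
    rcases c5 p hp with h | ⟨k, e1, -, e3⟩
    · obtain ⟨k, i, e1, e2⟩ := S.used le_rfl (S.node_last v)
      rw [S.nb_of_node (S.node_last v), ← e2] at h
      exact ⟨k, e1, h ▸ d2 k i⟩
    · exact ⟨k, e1, e3⟩
  by_cases hV : Fintype.card V = 0
  · have := Fintype.card_eq_zero_iff.1 hV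
    exact ⟨L, Z, 0, 0, 0, 0, fun v => isEmptyElim v, fun v => isEmptyElim v, fun v => isEmptyElim v,
      fun v => isEmptyElim v, fun v => isEmptyElim v, by simp⟩
  refine ⟨L, Z, -1, -(6 * (Fintype.card S.K : ℤ) + 2), 4 * Fintype.card S.K + 1,
    8 * Fintype.card S.K + 2, ?_, ?_, ?_, ?_, ?_, ?_⟩
  · intro v
    obtain ⟨c1, c2, c3, c4, -, -⟩ := hL v
    rw [S.nb_of_node (S.node_last v)] at c4
    exact ⟨c1, c2, c3, c4⟩
  · intro v s hs hn
    obtain ⟨-, -, -, -, -, c6⟩ := hL v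
    exact c6 s hs hn
  · intro u v p huv hu hv
    obtain ⟨k, rfl, e2⟩ := hmem u p hu
    obtain ⟨k', rfl, e2'⟩ := hmem v p hv
    obtain ⟨i, j, q1, q2⟩ := d3 k k' p (by rintro rfl; exact huv rfl) e2 e2'
    obtain ⟨s, a1, -, a3, -⟩ := S.nd_form k i
    obtain ⟨t, b1, -, b3, -⟩ := S.nd_form k' j
    exact ⟨s, t, a1, b1, by rw [← a3, ← b3, q2], by rw [← a3, q1]⟩
  · intro u v s t hs ht hn hn' hne
    obtain ⟨k, i, -, e⟩ := S.used hs hn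
    obtain ⟨k', j, -, e'⟩ := S.used ht hn'
    rw [← e, ← e'] at hne ⊢
    exact d4 k k' i j hne
  · intro v p hp
    obtain ⟨k, -, e⟩ := hmem v p hp
    have := d5 k p e
    push_cast
    omega
  · have h1 : 4 * Fintype.card S.K + 1 ≤ 33 * Fintype.card V := by omega
    have h2 : 8 * Fintype.card S.K + 2 ≤ 66 * Fintype.card V := by omega
    calc _ ≤ (33 * Fintype.card V) * (66 * Fintype.card V) := Nat.mul_le_mul h1 h2
      _ ≤ _ := by nlinarith [sq_nonneg (Fintype.card V)]

end PS
end CPGArea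

namespace CPGArea

/-! ### Conversion between the two descriptions of path families -/

theorem infix_pair {l : List (ℤ × ℤ)} {t : ℕ} (h : t + 1 < l.length) :
    [l[t], l[t + 1]] <:+: l := by
  refine ⟨l.take t, l.drop (t + 2), ?_⟩
  have h1 : l.drop t = l[t] :: l.drop (t + 1) := List.drop_eq_getElem_cons (by omega)
  have h2 : l.drop (t + 1) = l[t + 1] :: l.drop (t + 2) := List.drop_eq_getElem_cons (by omega)
  calc _ = l.take t ++ l.drop t := by rw [h1, h2]; simp
    _ = l := List.take_append_drop t l

theorem consec_facts {l : List (ℤ × ℤ)} {p q : ℤ × ℤ} (hl : l.IsChain GridStep)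
    (h : ConsecIn l p q) : p ∈ l ∧ q ∈ l ∧ GridStep p q := by
  rcases h with h | h
  · have := hl.infix h
    exact ⟨h.subset (by simp), h.subset (by simp), by simpa using this⟩
  · have := hl.infix h
    exact ⟨h.subset (by simp), h.subset (by simp), PS.gstep_symm (by simpa using this)⟩

variable {V : Type} {G : SimpleGraph V}

theorem bound_exists [Fintype V] (R : CPGRep G) : ∃ M : ℤ, 0 ≤ M ∧ ∀ v, ∀ p ∈ (R.path v).pts,
    |p.1| ≤ M ∧ |p.2| ≤ M := by
  classical
  let A : Finset (ℤ × ℤ) := Finset.univ.biUnion fun v => (R.path v).pts.toFinset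
  refine ⟨∑ p ∈ A, (|p.1| + |p.2|), Finset.sum_nonneg fun p _ => by positivity, ?_⟩
  intro v p hp
  have hA : p ∈ A := by
    simp only [A, Finset.mem_biUnion, Finset.mem_univ, true_and, List.mem_toFinset]
    exact ⟨v, hp⟩
  have := Finset.single_le_sum (f := fun p : ℤ × ℤ => |p.1| + |p.2|)
    (fun p _ => by positivity) hA
  have h1 := abs_nonneg p.1
  have h2 := abs_nonneg p.2
  constructor <;> linarith

/-- The shifted points of a path. -/
def shp (M : ℤ) (l : List (ℤ × ℤ)) (t : ℕ) : ℤ × ℤ :=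
  ((l.getD t (0, 0)).1 + M, (l.getD t (0, 0)).2 + M)

theorem shp_inj {M : ℤ} {l l' : List (ℤ × ℤ)} {t t' : ℕ} (ht : t < l.length) (ht' : t' < l'.length) :
    shp M l t = shp M l' t' ↔ l[t] = l'[t'] := by
  unfold shp
  rw [List.getD_eq_getElem _ _ ht, List.getD_eq_getElem _ _ ht']
  constructor
  · intro h
    simp only [Prod.mk.injEq, add_left_inj] at h
    exact Prod.ext h.1 h.2
  · intro h; rw [h]

theorem endpoint_index {Q : GridPath} {t : ℕ} (ht : t < Q.pts.length)
    (h : Q.IsEndpoint Q.pts[t]) : t = 0 ∨ t = Q.pts.length - 1 := by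
  have hlen := Q.two_le_length
  rcases h with h | h
  · left
    unfold GridPath.first at h
    rw [List.head_eq_getElem] at h
    exact (Q.nodup.getElem_inj_iff).1 h
  · right
    unfold GridPath.last at h
    rw [List.getLast_eq_getElem] at h
    exact (Q.nodup.getElem_inj_iff).1 h

/-- The indexed family of a representation. -/
def toPS (R : CPGRep G) (M : ℤ) (h0 : 0 ≤ M)
    (hM : ∀ v, ∀ p ∈ (R.path v).pts, |p.1| ≤ M ∧ |p.2| ≤ M) : PS V where
  P v t := shp M (R.path v).pts t
  m v := (R.path v).pts.length - 1
  N := 2 * M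
  hN := by omega
  pos v := by have := (R.path v).two_le_length; omega
  step v t ht := by
    have h := (R.path v).step
    have := List.isChain_iff_getElem.1 h t (by omega)
    unfold shp
    rw [List.getD_eq_getElem _ _ (by omega), List.getD_eq_getElem _ _ (by omega)]
    unfold GridStep at *
    simp only
    omega
  inj v s t hs ht h := by
    have := (R.path v).two_le_length
    rw [shp_inj (by omega) (by omega)] at h
    exact ((R.path v).nodup.getElem_inj_iff).1 h
  dis u v s t huv hs ht h := by
    have hu := (R.path u).two_le_length
    have hv := (R.path v).two_le_length
    have ls : s < (R.path u).pts.length := by omega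
    have lt : t < (R.path v).pts.length := by omega
    rw [shp_inj ls lt] at h
    have hm : (R.path u).pts[s] ∈ (R.path v).toSet := by
      rw [h]; exact List.getElem_mem lt
    rcases R.interiorly_disjoint u v huv _ (List.getElem_mem ls) hm with c | c
    · exact Or.inl (endpoint_index ls c)
    · rw [h] at c
      exact Or.inr (endpoint_index lt c)
  seg u v s t hs ht h := by
    have ls : s + 1 < (R.path u).pts.length := by omega
    have lt : t + 1 < (R.path v).pts.length := by omega
    rw [shp_inj (by omega) (by omega), shp_inj (by omega) (by omega),
      shp_inj (by omega) (by omega), shp_inj (by omega) (by omega)] at h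
    by_cases huv : u = v
    · subst huv
      have nd := (R.path u).nodup
      simp only [nd.getElem_inj_iff] at h
      exact ⟨rfl, by omega⟩
    · exfalso
      refine R.no_shared_segment u v huv _ _ (Or.inl (infix_pair ls)) ?_
      rcases h with ⟨h1, h2⟩ | ⟨h1, h2⟩
      · rw [h1, h2]; exact Or.inl (infix_pair lt)
      · rw [h1, h2]; exact Or.inr (infix_pair lt)
  box v t ht := by
    have hv := (R.path v).two_le_length
    have lt : t < (R.path v).pts.length := by omega
    obtain ⟨a, b⟩ := hM v _ (List.getElem_mem lt)
    rw [abs_le] at a b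
    unfold shp
    rw [List.getD_eq_getElem _ _ lt]
    simp only
    omega

theorem main [Fintype V] (R : CPGRep G) : ∃ (R : CPGRep G) (x y : ℤ) (w h : ℕ),
    (∀ (u : V) (p : ℤ × ℤ), p ∈ (R.path u).toSet →
      x ≤ p.1 ∧ p.1 ≤ x + w ∧ y ≤ p.2 ∧ p.2 ≤ y + h) ∧
    w * h ≤ 3000 * (Fintype.card V) ^ 2 := by
  obtain ⟨M, h0, hM⟩ := bound_exists R
  have hcom : ∀ u v, (∃ p, p ∈ (R.path u).toSet ∧ p ∈ (R.path v).toSet) ↔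
      ∃ s t, s ≤ (toPS R M h0 hM).m u ∧ t ≤ (toPS R M h0 hM).m v ∧
        (toPS R M h0 hM).P u s = (toPS R M h0 hM).P v t := by
    intro u v
    have hu := (R.path u).two_le_length
    have hv := (R.path v).two_le_length
    constructor
    · rintro ⟨p, p1, p2⟩
      obtain ⟨s, hs, rfl⟩ := List.getElem_of_mem p1
      obtain ⟨t, ht, e⟩ := List.getElem_of_mem p2
      exact ⟨s, t, by simp only [toPS]; omega, by simp only [toPS]; omega,
        (shp_inj hs ht).2 e.symm⟩
    · rintro ⟨s, t, hs, ht, e⟩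
      simp only [toPS] at hs ht
      have ls : s < (R.path u).pts.length := by omega
      have lt : t < (R.path v).pts.length := by omega
      have e' := (shp_inj ls lt).1 e
      exact ⟨(R.path u).pts[s], List.getElem_mem ls, by rw [e']; exact List.getElem_mem lt⟩
  generalize toPS R M h0 hM = S at hcom
  obtain ⟨L, Z, x, y, w, h, l1, l2, l3, l4, l5, l6⟩ := S.redraw
  have hlen : ∀ v, 2 ≤ (L v).length := by
    intro v
    obtain ⟨-, -, a, b⟩ := l1 v
    have hm := S.pos v
    have hne : S.P v 0 ≠ S.P v (S.m v) := fun e => by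
      have := S.inj v _ _ (Nat.zero_le _) le_rfl e
      omega
    have hz := (l4 v v 0 (S.m v) (Nat.zero_le _) le_rfl (S.node_zero v) (S.node_last v) hne).1
    rcases hl : L v with _ | ⟨p, _ | ⟨q, l⟩⟩
    · rw [hl] at a; simp at a
    · rw [hl] at a b
      simp only [List.head?_cons, List.getLast?_singleton, Option.some.injEq] at a b
      exact absurd (a.symm.trans b) hz
    · simp
  let Q : V → GridPath := fun v => ⟨L v, hlen v, (l1 v).1, (l1 v).2.1⟩
  have hQ0 : ∀ v, (Q v).IsEndpoint (Z (S.P v 0)) := by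
    intro v
    left
    have := (l1 v).2.2.1
    rw [List.head?_eq_some_head (Q v).ne_nil] at this
    exact (Option.some.inj this).symm
  have hQ1 : ∀ v, (Q v).IsEndpoint (Z (S.P v (S.m v))) := by
    intro v
    right
    have := (l1 v).2.2.2
    rw [List.getLast?_eq_getLast_of_ne_nil (Q v).ne_nil] at this
    exact (Option.some.inj this).symm
  refine ⟨⟨Q, ?_, ?_, ?_⟩, x, y, w, h, l5, l6⟩
  · intro u v huv p hu hv
    obtain ⟨s, t, hs, ht, e, rfl⟩ := l3 u v p huv hu hv
    rcases S.dis u v s t huv hs ht e with (rfl | rfl) | (rfl | rfl)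
    · exact Or.inl (hQ0 u)
    · exact Or.inl (hQ1 u)
    · rw [e]; exact Or.inr (hQ0 v)
    · rw [e]; exact Or.inr (hQ1 v)
  · intro u v huv p q hu hv
    obtain ⟨a1, a2, a3⟩ := consec_facts (l1 u).1 hu
    obtain ⟨b1, b2, -⟩ := consec_facts (l1 v).1 hv
    obtain ⟨s, t, hs, ht, e, rfl⟩ := l3 u v p huv a1 b1
    obtain ⟨s', t', hs', ht', e', rfl⟩ := l3 u v q huv a2 b2
    by_cases hne : S.P u s = S.P u s'
    · rw [hne] at a3
      unfold GridStep at a3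
      simp at a3
    · exact (l4 u u s s' hs hs' (S.common_node huv hs ht e) (S.common_node huv hs' ht' e') hne).2 a3
  · intro u v huv
    rw [R.adj_iff u v huv, hcom]
    constructor
    · rintro ⟨s, t, hs, ht, e⟩
      have hn := S.common_node huv hs ht e
      exact ⟨Z (S.P u s), l2 u s hs hn, by rw [e] at hn ⊢; exact l2 v t ht hn⟩
    · rintro ⟨p, hu, hv⟩
      obtain ⟨s, t, hs, ht, e, -⟩ := l3 u v p huv hu hv
      exact ⟨s, t, hs, ht, e⟩

end CPGArea

/-- There is a constant `C > 0` such that every CPG graph on `n` vertices admits a CPG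
representation all of whose paths lie in an axis-parallel rectangle of the grid of area
at most `C · n²`. -/
theorem cpg_representation_in_quadratic_area :
    ∃ C : ℕ, 0 < C ∧
      ∀ (V : Type) [Fintype V] (G : SimpleGraph V), IsCPG G →
        ∃ (R : CPGRep G) (x y : ℤ) (w h : ℕ),
          (∀ (u : V) (p : ℤ × ℤ), p ∈ (R.path u).toSet →
            x ≤ p.1 ∧ p.1 ≤ x + w ∧ y ≤ p.2 ∧ p.2 ≤ y + h) ∧
          w * h ≤ C * (Fintype.card V) ^ 2 := by
  refine ⟨3000, by norm_num, ?_⟩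
  rintro V _ G ⟨R⟩
  exact CPGArea.main R
end
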